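/- Supremum-in-time L² bound with L¹ tail (Lemma 3.1). Let v be a local weak subsolution (respectively supersolution) of the homogeneous equation ∂_t v − div(𝒜(t,x,Dv)) + ℒv = 0 in Ω_T. Then for every R ∈ (0,1] and (t₀,x₀) with I_{2R}^⊖(t₀) × B_{2R}(x₀) compactly contained in I × Ω, there exists C > 0 depending only on d, s, Λ such that ess sup_{t ∈ I_{5R/6}^⊖(t₀)} (⨍_{B_{5R/6}(x₀)} v₊²(t,x) dx)^{1/2} ≤ C (⨍_{I_R^⊖(t₀)} ⨍_{B_R(x₀)} v₊² dx dt)^{1/2} + C ⨍_{I_R^⊖(t₀)} Tail(v₊(t); x₀, R) dt (respectively the same with v₋ in place of v₊), where v₊ = max{v,0} and v₋ = max{−v,0}. -/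

import Mathlib

open MeasureTheory Set Filter Metric
open scoped ENNReal NNReal Topology RealInnerProductSpace

noncomputable section

/-- Euclidean space `ℝ^d`. -/
abbrev Ed (d : ℕ) : Type := EuclideanSpace ℝ (Fin d)

variable {d : ℕ}

/-- Backward time interval `I_r^⊖(t₀) = (t₀ - r², t₀)`. -/
def Iminus (t₀ r : ℝ) : Set ℝ := Set.Ioo (t₀ - r ^ 2) t₀

/-- Parabolic cylinder `Q_r(t₀,x₀) = I_r^⊖(t₀) × B_r(x₀)`. -/
def pCyl (t₀ : ℝ) (x₀ : Ed d) (r : ℝ) : Set (ℝ × Ed d) :=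
  (Iminus t₀ r) ×ˢ (Metric.ball x₀ r)

/-- Nonlocal tail `Tail(v; x₀, R) = R² ∫_{ℝ^d ∖ B_R(x₀)} |v(y)| |x₀ - y|^{-d-2s} dy`. -/
def Tail (s : ℝ) (v : Ed d → ℝ) (x₀ : Ed d) (R : ℝ) : ℝ :=
  R ^ 2 * ∫ y in (Metric.ball x₀ R)ᶜ, |v y| / ‖x₀ - y‖ ^ ((d : ℝ) + 2 * s)

/-- Caloric Riesz potential `ℐ^ν_α(t₀,x₀;R) = ∫₀^R ν(Q_ρ(t₀,x₀)) ρ^{-(d+2-α)} dρ/ρ`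
for a nonnegative measure `ν`. -/
def RieszPot (ν : Measure (ℝ × Ed d)) (α : ℝ) (t₀ : ℝ) (x₀ : Ed d) (R : ℝ) : ℝ :=
  ∫ ρ in Set.Ioo (0 : ℝ) R, (ν (pCyl t₀ x₀ ρ)).toReal / ρ ^ ((d : ℝ) + 2 - α) / ρ

/-- The structure conditions (1.2)-(1.3) on the vector field `𝒜`. -/
structure VectorFieldHyp (d : ℕ) (Λ : ℝ) (A : ℝ → Ed d → Ed d → Ed d) : Prop where
  meas : ∀ ξ : Ed d, Measurable fun p : ℝ × Ed d => A p.1 p.2 ξ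
  cont : ∀ t x, Continuous (A t x)
  growth : ∀ t x ξ, ‖A t x ξ‖ ≤ Λ * ‖ξ‖
  monotone : ∀ t x ξ η, Λ⁻¹ * ‖η - ξ‖ ^ 2 ≤ ⟪A t x η - A t x ξ, η - ξ⟫

/-- The ellipticity and symmetry conditions on the jump kernel `K`. -/
structure KernelHyp (d : ℕ) (s Λ : ℝ) (K : ℝ → Ed d → Ed d → ℝ) : Prop where
  meas : Measurable fun p : ℝ × Ed d × Ed d => K p.1 p.2.1 p.2.2
  symm : ∀ t x y, K t x y = K t y x
  lower : ∀ t x y, x ≠ y → Λ⁻¹ / ‖x - y‖ ^ ((d : ℝ) + 2 * s) ≤ K t x y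
  upper : ∀ t x y, x ≠ y → K t x y ≤ Λ / ‖x - y‖ ^ ((d : ℝ) + 2 * s)

/-- Membership of `v` (with weak spatial gradient `Dv`) in the function space
`L²_loc(J; W^{1,2}_loc(Ω)) ∩ L^∞_loc(J; L²_loc(Ω)) ∩ L²_loc(J; 𝓛¹_{2s}(ℝ^d))`. -/
structure LocalWeakReg (d : ℕ) (s : ℝ) (J : Set ℝ) (Ω : Set (Ed d))
    (v : ℝ → Ed d → ℝ) (Dv : ℝ → Ed d → Ed d) : Prop where
  meas : Measurable (Function.uncurry v)
  measD : Measurable (Function.uncurry Dv)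
  grad : ∀ t ∈ J, ∀ φ : Ed d → ℝ, ContDiff ℝ (⊤ : ℕ∞) φ → HasCompactSupport φ →
    tsupport φ ⊆ Ω → ∀ e : Ed d,
      ∫ x, v t x * (fderiv ℝ φ x) e = - ∫ x, φ x * ⟪Dv t x, e⟫
  l2w12 : ∀ t₁ t₂ : ℝ, Set.Icc t₁ t₂ ⊆ J → ∀ Kc : Set (Ed d), IsCompact Kc → Kc ⊆ Ω →
    MeasureTheory.IntegrableOn
      (fun p : ℝ × Ed d => (v p.1 p.2) ^ 2 + ‖Dv p.1 p.2‖ ^ 2) ((Set.Ioo t₁ t₂) ×ˢ Kc)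
  linfl2 : ∀ t₁ t₂ : ℝ, Set.Icc t₁ t₂ ⊆ J → ∀ Kc : Set (Ed d), IsCompact Kc → Kc ⊆ Ω →
    ∃ M : ℝ, ∀ᵐ t ∂(volume.restrict (Set.Ioo t₁ t₂)), (∫ x in Kc, (v t x) ^ 2) ≤ M
  tail_ae : ∀ᵐ t : ℝ, t ∈ J →
    MeasureTheory.Integrable fun y : Ed d => |v t y| / (1 + ‖y‖ ^ ((d : ℝ) + 2 * s))
  tail_l2 : ∀ t₁ t₂ : ℝ, Set.Icc t₁ t₂ ⊆ J →
    MeasureTheory.IntegrableOn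
      (fun t => (∫ y : Ed d, |v t y| / (1 + ‖y‖ ^ ((d : ℝ) + 2 * s))) ^ 2) (Set.Ioo t₁ t₂)

/-- Smooth test functions with compact spatial support contained in `Ω`. -/
def IsTestFunction (Ω : Set (Ed d)) (φ : ℝ → Ed d → ℝ) : Prop :=
  ContDiff ℝ (⊤ : ℕ∞) (Function.uncurry φ) ∧
    ∃ Kc : Set (Ed d), IsCompact Kc ∧ Kc ⊆ Ω ∧ ∀ t, tsupport (φ t) ⊆ Kc

/-- The left-hand side of the weak formulation of
`∂_t u - div(𝒜(t,x,Du)) + ℒu` tested against `φ` on `(t₁,t₂] × Ω`. -/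
def mixedLHS (A : ℝ → Ed d → Ed d → Ed d) (K : ℝ → Ed d → Ed d → ℝ)
    (Ω : Set (Ed d)) (u : ℝ → Ed d → ℝ) (Du : ℝ → Ed d → Ed d)
    (φ : ℝ → Ed d → ℝ) (t₁ t₂ : ℝ) : ℝ :=
  -(∫ t in Set.Ioc t₁ t₂, ∫ x in Ω, u t x * deriv (fun τ => φ τ x) t)
    + (∫ x in Ω, u t₂ x * φ t₂ x) - (∫ x in Ω, u t₁ x * φ t₁ x)
    + (∫ t in Set.Ioc t₁ t₂, ∫ x in Ω, ⟪A t x (Du t x), gradient (φ t) x⟫)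
    + ∫ t in Set.Ioc t₁ t₂, ∫ x : Ed d, ∫ y : Ed d,
        (u t x - u t y) * (φ t x - φ t y) * K t x y

/-- Integral of a function against a finite signed measure. -/
def signedIntegral (μ : MeasureTheory.SignedMeasure (ℝ × Ed d)) (f : ℝ × Ed d → ℝ) : ℝ :=
  (∫ p, f p ∂μ.toJordanDecomposition.posPart)
    - ∫ p, f p ∂μ.toJordanDecomposition.negPart

/-- Local weak solution of `∂_t u - div(𝒜(t,x,Du)) + ℒu = μ` in `J × Ω`. -/
def IsLocalWeakSolution (A : ℝ → Ed d → Ed d → Ed d) (K : ℝ → Ed d → Ed d → ℝ)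
    (J : Set ℝ) (Ω : Set (Ed d)) (μ : MeasureTheory.SignedMeasure (ℝ × Ed d))
    (u : ℝ → Ed d → ℝ) (Du : ℝ → Ed d → Ed d) : Prop :=
  ∀ t₁ t₂ : ℝ, t₁ ≤ t₂ → Set.Icc t₁ t₂ ⊆ J →
    ∀ φ : ℝ → Ed d → ℝ, IsTestFunction Ω φ →
      mixedLHS A K Ω u Du φ t₁ t₂ =
        signedIntegral μ (Set.indicator ((Set.Ioc t₁ t₂) ×ˢ Ω) fun p => φ p.1 p.2)

/-- Local weak solution of the homogeneous equation
`∂_t v - div(𝒜(t,x,Dv)) + ℒv = 0` in `J × Ω`. -/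
def IsLocalWeakSolutionHom (A : ℝ → Ed d → Ed d → Ed d) (K : ℝ → Ed d → Ed d → ℝ)
    (J : Set ℝ) (Ω : Set (Ed d))
    (v : ℝ → Ed d → ℝ) (Dv : ℝ → Ed d → Ed d) : Prop :=
  ∀ t₁ t₂ : ℝ, t₁ ≤ t₂ → Set.Icc t₁ t₂ ⊆ J →
    ∀ φ : ℝ → Ed d → ℝ, IsTestFunction Ω φ → mixedLHS A K Ω v Dv φ t₁ t₂ = 0

/-- Local weak subsolution of the homogeneous equation in `J × Ω`. -/
def IsLocalWeakSubsolutionHom (A : ℝ → Ed d → Ed d → Ed d) (K : ℝ → Ed d → Ed d → ℝ)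
    (J : Set ℝ) (Ω : Set (Ed d))
    (v : ℝ → Ed d → ℝ) (Dv : ℝ → Ed d → Ed d) : Prop :=
  ∀ t₁ t₂ : ℝ, t₁ ≤ t₂ → Set.Icc t₁ t₂ ⊆ J →
    ∀ φ : ℝ → Ed d → ℝ, IsTestFunction Ω φ → (∀ t x, 0 ≤ φ t x) →
      mixedLHS A K Ω v Dv φ t₁ t₂ ≤ 0

/-- Local weak supersolution of the homogeneous equation in `J × Ω`. -/
def IsLocalWeakSupersolutionHom (A : ℝ → Ed d → Ed d → Ed d) (K : ℝ → Ed d → Ed d → ℝ)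
    (J : Set ℝ) (Ω : Set (Ed d))
    (v : ℝ → Ed d → ℝ) (Dv : ℝ → Ed d → Ed d) : Prop :=
  ∀ t₁ t₂ : ℝ, t₁ ≤ t₂ → Set.Icc t₁ t₂ ⊆ J →
    ∀ φ : ℝ → Ed d → ℝ, IsTestFunction Ω φ → (∀ t x, φ t x ≤ 0) →
      mixedLHS A K Ω v Dv φ t₁ t₂ ≤ 0

/-- The global excess functional `E(u,t₀,x₀,R)`. -/
def Excess (s q : ℝ) (u : ℝ → Ed d → ℝ) (t₀ : ℝ) (x₀ : Ed d) (R : ℝ) : ℝ :=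
  (⨍ t in Iminus t₀ R, (⨍ x in Metric.ball x₀ R,
      |u t x - ⨍ p in pCyl t₀ x₀ R, u p.1 p.2|) ^ q) ^ (1 / q)
  + (⨍ t in Iminus t₀ R,
      (Tail s (fun y => u t y - ⨍ p in pCyl t₀ x₀ R, u p.1 p.2) x₀ R) ^ q) ^ (1 / q)

theorem tendsto_eLpNorm_translate {G E : Type*} [NormedAddCommGroup G] [MeasurableSpace G]
    [BorelSpace G] [LocallyCompactSpace G] {μ : Measure G} [μ.IsAddHaarMeasure]
    [μ.InnerRegularCompactLTTop] [NormedAddCommGroup E] {U : G → E} (hU : MemLp U 2 μ) :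
    Tendsto (fun p : G => eLpNorm (fun q => U (q - p) - U q) 2 μ) (𝓝 0) (𝓝 0) := by
  have : Fact ((1 : ℝ≥0∞) ≤ 2) := ⟨by norm_num⟩
  have hmp : ∀ p : G, MeasurePreserving (fun q : G => q - p) μ μ :=
    fun p => measurePreserving_sub_right μ p
  let g : C(G, C(G, G)) := (ContinuousMap.mk (fun a : G × G => a.2 - a.1) (by fun_prop)).curry
  have hc : Continuous fun p : G => Lp.compMeasurePreserving (g p) (hmp p) (hU.toLp U) :=
    Continuous.compMeasurePreservingLp continuous_const g.continuous hmp (by norm_num)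
  have h0 := hc.tendsto 0
  rw [tendsto_iff_edist_tendsto_0] at h0
  refine h0.congr fun p => ?_
  rw [Lp.edist_def]
  refine eLpNorm_congr_ae ?_
  have h1 := Lp.coeFn_compMeasurePreserving (hU.toLp U) (hmp p)
  have h2 := Lp.coeFn_compMeasurePreserving (hU.toLp U) (hmp 0)
  have h3 := (hmp p).quasiMeasurePreserving.ae (hU.coeFn_toLp)
  have h4 := (hmp 0).quasiMeasurePreserving.ae (hU.coeFn_toLp)
  filter_upwards [h1, h2, h3, h4] with q a1 a2 a3 a4
  simp only [Pi.sub_apply]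
  erw [a1, a2]
  rw [sub_zero] at a4
  simp only [Function.comp_apply, a3, a4, sub_zero]

/-- An average of a family of functions against a probability density stays within the largest
`L²` distance. -/
theorem eLpNorm_average_sub_le {P X E : Type*} [MeasurableSpace P] [MeasurableSpace X]
    {μ : Measure P} {ν : Measure X} [SFinite μ] [SFinite ν]
    [NormedAddCommGroup E] [NormedSpace ℝ E] [MeasurableSpace E] [BorelSpace E]
    [SecondCountableTopology E]
    {ρ : P → ℝ} (hρ : ∀ p, 0 ≤ ρ p) (hρm : Measurable ρ) (hρi : Integrable ρ μ)
    (hρ1 : ∫ p, ρ p ∂μ = 1)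
    {h : P → X → E} (hh : Measurable (Function.uncurry h)) {ω : ℝ≥0∞}
    (hω : ∀ p, ρ p ≠ 0 → eLpNorm (h p) 2 ν ≤ ω) :
    eLpNorm (fun q => ∫ p, ρ p • h p q ∂μ) 2 ν ≤ ω := by
  set m : Measure P := μ.withDensity (fun p => ENNReal.ofReal (ρ p)) with hm
  have hmu : m univ = 1 := by
    rw [hm, withDensity_apply _ MeasurableSet.univ, Measure.restrict_univ,
      ← ofReal_integral_eq_lintegral_ofReal hρi (.of_forall hρ), hρ1, ENNReal.ofReal_one]
  have : IsProbabilityMeasure m := ⟨hmu⟩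
  have hsec : ∀ p, Measurable (h p) := fun p => hh.comp measurable_prodMk_left
  have hsec' : ∀ q, Measurable fun p => h p q := fun q => hh.comp measurable_prodMk_right
  have hω2 : ∀ p, ρ p ≠ 0 → ∫⁻ q, ‖h p q‖ₑ ^ (2 : ℝ) ∂ν ≤ ω ^ (2 : ℝ) := by
    intro p hp
    have := hω p hp
    rw [eLpNorm_eq_lintegral_rpow_enorm_toReal (by norm_num) (by norm_num)] at this
    simp only [ENNReal.toReal_ofNat, one_div] at this
    rwa [ENNReal.rpow_inv_le_iff (by norm_num)] at this
  have hpt : ∀ q, ‖∫ p, ρ p • h p q ∂μ‖ₑ ^ (2 : ℝ) ≤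
      ∫⁻ p, ENNReal.ofReal (ρ p) * ‖h p q‖ₑ ^ (2 : ℝ) ∂μ := by
    intro q
    have e1 : ‖∫ p, ρ p • h p q ∂μ‖ₑ ≤ ∫⁻ p, ‖h p q‖ₑ ∂m := by
      refine (enorm_integral_le_lintegral_enorm _).trans (le_of_eq ?_)
      rw [hm, lintegral_withDensity_eq_lintegral_mul _ (by fun_prop) (hsec' q).enorm]
      refine lintegral_congr fun p => ?_
      rw [enorm_smul, Real.enorm_eq_ofReal (hρ p)]; rfl
    have e2 : ∫⁻ p, ‖h p q‖ₑ ∂m ≤ (∫⁻ p, ‖h p q‖ₑ ^ (2 : ℝ) ∂m) ^ ((2 : ℝ)⁻¹) := by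
      have := eLpNorm_le_eLpNorm_of_exponent_le (p := 1) (q := 2) (by norm_num)
        (hsec' q).aestronglyMeasurable (μ := m)
      rw [eLpNorm_one_eq_lintegral_enorm,
        eLpNorm_eq_lintegral_rpow_enorm_toReal (by norm_num) (by norm_num)] at this
      simpa using this
    calc ‖∫ p, ρ p • h p q ∂μ‖ₑ ^ (2 : ℝ)
        ≤ ((∫⁻ p, ‖h p q‖ₑ ^ (2 : ℝ) ∂m) ^ ((2 : ℝ)⁻¹)) ^ (2 : ℝ) :=
          ENNReal.rpow_le_rpow (e1.trans e2) (by norm_num)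
      _ = ∫⁻ p, ‖h p q‖ₑ ^ (2 : ℝ) ∂m := by
          rw [← ENNReal.rpow_mul]; norm_num
      _ = _ := by
          rw [hm, lintegral_withDensity_eq_lintegral_mul _ (by fun_prop)
            ((hsec' q).enorm.pow_const _)]; rfl
  rw [eLpNorm_eq_lintegral_rpow_enorm_toReal (by norm_num) (by norm_num)]
  simp only [ENNReal.toReal_ofNat, one_div]
  rw [ENNReal.rpow_inv_le_iff (by norm_num)]
  calc ∫⁻ q, ‖∫ p, ρ p • h p q ∂μ‖ₑ ^ (2 : ℝ) ∂ν
      ≤ ∫⁻ q, ∫⁻ p, ENNReal.ofReal (ρ p) * ‖h p q‖ₑ ^ (2 : ℝ) ∂μ ∂ν := lintegral_mono hpt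
    _ = ∫⁻ p, ∫⁻ q, ENNReal.ofReal (ρ p) * ‖h p q‖ₑ ^ (2 : ℝ) ∂ν ∂μ := by
        refine lintegral_lintegral_swap ?_
        have : Measurable fun z : X × P => h z.2 z.1 := hh.comp measurable_swap
        exact ((ENNReal.measurable_ofReal.comp (hρm.comp measurable_snd)).mul
          (this.enorm.pow_const _)).aemeasurable
    _ ≤ ∫⁻ p, ENNReal.ofReal (ρ p) * ω ^ (2 : ℝ) ∂μ := by
        refine lintegral_mono fun p => ?_
        rw [lintegral_const_mul _ ((hsec p).enorm.pow_const _)]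
        rcases eq_or_ne (ρ p) 0 with h0 | h0
        · simp [h0]
        · gcongr; exact hω2 p h0
    _ = ω ^ (2 : ℝ) := by
        rw [lintegral_mul_const _ (by fun_prop),
          ← ofReal_integral_eq_lintegral_ofReal hρi (.of_forall hρ), hρ1, ENNReal.ofReal_one,
          one_mul]

theorem integrable_mul_of_memLp {X : Type*} [MeasurableSpace X] {μ : Measure X} {f g : X → ℝ}
    (hf : MemLp f 2 μ) (hg : MemLp g 2 μ) : Integrable (fun x => f x * g x) μ :=
  hf.integrable_mul hg

theorem integral_abs_mul_le_eLpNorm {X : Type*} [MeasurableSpace X] {μ : Measure X} {f g : X → ℝ}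
    (hf : MemLp f 2 μ) (hg : MemLp g 2 μ) :
    ∫ x, |f x * g x| ∂μ ≤ (eLpNorm f 2 μ).toReal * (eLpNorm g 2 μ).toReal := by
  have h := eLpNorm_smul_le_mul_eLpNorm (p := 2) (q := 2) (r := 1) hg.1 hf.1
  rw [eLpNorm_one_eq_lintegral_enorm] at h
  have h2 : ∫ x, |f x * g x| ∂μ = (∫⁻ x, ‖f x * g x‖ₑ ∂μ).toReal := by
    simpa using integral_norm_eq_lintegral_enorm (hf.1.mul hg.1)
  rw [h2, ← ENNReal.toReal_mul]
  exact ENNReal.toReal_mono (ENNReal.mul_ne_top hf.2.ne hg.2.ne) (by simpa using h)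

/-- The standard jump kernel `|z|^{-d-2s}`. -/
def jumpKer (s : ℝ) (z : Ed d) : ℝ := (‖z‖ ^ ((d : ℝ) + 2 * s))⁻¹

theorem jumpKer_nonneg (s : ℝ) (z : Ed d) : 0 ≤ jumpKer s z := by
  unfold jumpKer; positivity

theorem jumpKer_neg (s : ℝ) (z : Ed d) : jumpKer s (-z) = jumpKer s z := by
  simp [jumpKer]

@[fun_prop]
theorem measurable_jumpKer (s : ℝ) : Measurable (jumpKer s : Ed d → ℝ) := by
  unfold jumpKer; fun_prop

theorem exists_lintegral_ball_sq_mul_jumpKer_le (hd : 2 ≤ d) {s : ℝ} (hs : s ∈ Ioo (0 : ℝ) 1) :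
    ∃ C : ℝ, 0 < C ∧ ∀ r : ℝ, 0 < r →
      ∫⁻ z in ball (0 : Ed d) r, ENNReal.ofReal (‖z‖ ^ 2 * jumpKer s z) ≤
        ENNReal.ofReal (C * r ^ (2 - 2 * s)) := by
  obtain ⟨hs0, hs1⟩ := hs
  have : Nontrivial (Ed d) := by
    have : Nonempty (Fin d) := ⟨⟨0, by lia⟩⟩
    infer_instance
  set c : ℝ := d * (volume : Measure (Ed d)).real (ball 0 1) with hc
  have hd0 : (0 : ℝ) < d := by exact_mod_cast (by lia : 0 < d)
  have hvol : 0 < (volume : Measure (Ed d)).real (ball 0 1) :=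
    ENNReal.toReal_pos (measure_ball_pos _ _ one_pos).ne' measure_ball_lt_top.ne
  have hc0 : 0 < c := by positivity
  refine ⟨c / (2 - 2 * s), div_pos hc0 (by linarith), fun r hr => ?_⟩
  set f : ℝ → ℝ := fun y => y ^ 2 * (y ^ ((d : ℝ) + 2 * s))⁻¹ with hf
  have hprod : ∀ y ∈ Ioi (0 : ℝ), y ^ (d - 1) * f y = y ^ (1 - 2 * s) := by
    intro y hy
    have hy : 0 < y := hy
    rw [hf]
    simp only
    rw [← Real.rpow_natCast, ← Real.rpow_natCast, ← Real.rpow_neg hy.le, ← Real.rpow_add hy,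
      ← Real.rpow_add hy]
    congr 1
    rw [Nat.cast_sub (by lia)]
    push_cast; ring
  have hint0 : IntegrableOn (fun y : ℝ => y ^ (1 - 2 * s)) (Ioo 0 r) :=
    (intervalIntegral.integrableOn_Ioo_rpow_iff hr).2 (by linarith)
  have hInt : IntegrableOn (fun x : Ed d => f ‖x‖) (ball 0 r) := by
    rw [integrableOn_fun_norm_addHaar]
    simp only [finrank_euclideanSpace, Fintype.card_fin, smul_eq_mul]
    refine hint0.congr_fun (fun y hy => (hprod y hy.1).symm) measurableSet_Ioo
  change ∫⁻ z in ball (0 : Ed d) r, ENNReal.ofReal (f ‖z‖) ≤ _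
  have hfn : ∀ z : Ed d, 0 ≤ f ‖z‖ := fun z => by rw [hf]; positivity
  rw [← ofReal_integral_eq_lintegral_ofReal hInt (.of_forall hfn)]
  refine ENNReal.ofReal_le_ofReal (le_of_eq ?_)
  rw [← integral_indicator measurableSet_ball]
  have e1 : (fun z : Ed d => (ball (0 : Ed d) r).indicator (fun x => f ‖x‖) z) =
      fun z => (Iio r).indicator f ‖z‖ := by
    ext z; simp [indicator]
  rw [e1, integral_fun_norm_addHaar volume ((Iio r).indicator f)]
  simp only [finrank_euclideanSpace, Fintype.card_fin, smul_eq_mul, nsmul_eq_mul]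
  have e2 : ∫ y in Ioi (0 : ℝ), y ^ (d - 1) * (Iio r).indicator f y =
      ∫ y in Ioc (0 : ℝ) r, y ^ (1 - 2 * s) := by
    have hprod' : ∀ y ∈ Ioi (0 : ℝ), y ^ (d - 1) * (Iio r).indicator f y =
        (Iio r).indicator (fun y => y ^ (1 - 2 * s)) y := by
      intro y hy
      by_cases hyr : y ∈ Iio r
      · simp only [indicator_of_mem hyr, hprod y hy]
      · simp [indicator_of_notMem hyr]
    rw [setIntegral_congr_fun measurableSet_Ioi hprod', setIntegral_indicator measurableSet_Iio,
      Ioi_inter_Iio, integral_Ioc_eq_integral_Ioo]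
  rw [e2, ← intervalIntegral.integral_of_le hr.le, integral_rpow (Or.inl (by linarith)),
    Real.zero_rpow (by linarith)]
  rw [show 1 - 2 * s + 1 = 2 - 2 * s by ring, hc]; ring

theorem exists_lintegral_compl_ball_jumpKer_le (hd : 2 ≤ d) {s : ℝ} (hs : s ∈ Ioo (0 : ℝ) 1) :
    ∃ C : ℝ, 0 < C ∧ ∀ r : ℝ, 0 < r →
      ∫⁻ z in (ball (0 : Ed d) r)ᶜ, ENNReal.ofReal (jumpKer s z) ≤
        ENNReal.ofReal (C * r ^ (- (2 * s))) := by
  obtain ⟨hs0, hs1⟩ := hs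
  have : Nontrivial (Ed d) := by
    have : Nonempty (Fin d) := ⟨⟨0, by lia⟩⟩
    infer_instance
  set c : ℝ := d * (volume : Measure (Ed d)).real (ball 0 1) with hc
  have hd0 : (0 : ℝ) < d := by exact_mod_cast (by lia : 0 < d)
  have hvol : 0 < (volume : Measure (Ed d)).real (ball 0 1) :=
    ENNReal.toReal_pos (measure_ball_pos _ _ one_pos).ne' measure_ball_lt_top.ne
  have hc0 : 0 < c := by positivity
  refine ⟨c / (2 * s), by positivity, fun r hr => ?_⟩
  set f : ℝ → ℝ := (Ici r).indicator fun y => (y ^ ((d : ℝ) + 2 * s))⁻¹ with hf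
  have hprod : ∀ y ∈ Ioi (0 : ℝ), y ^ (d - 1) * f y =
      (Ici r).indicator (fun y => y ^ (-1 - 2 * s)) y := by
    intro y hy
    have hy : 0 < y := hy
    rw [hf]
    by_cases hyr : y ∈ Ici r
    · simp only [indicator_of_mem hyr]
      rw [← Real.rpow_natCast, ← Real.rpow_neg hy.le, ← Real.rpow_add hy]
      congr 1
      rw [Nat.cast_sub (by lia)]
      push_cast; ring
    · simp [indicator_of_notMem hyr]
  have hsub : Ioi (0 : ℝ) ∩ Ici r = Ici r := by
    ext y; simp only [mem_inter_iff, mem_Ioi, mem_Ici]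
    exact ⟨fun h => h.2, fun h => ⟨by linarith, h⟩⟩
  have hint0 : IntegrableOn (fun y : ℝ => y ^ (-1 - 2 * s)) (Ici r) := by
    rw [integrableOn_Ici_iff_integrableOn_Ioi]
    exact integrableOn_Ioi_rpow_of_lt (by linarith) hr
  have hInt : Integrable (fun x : Ed d => f ‖x‖) := by
    rw [integrable_fun_norm_addHaar]
    simp only [finrank_euclideanSpace, Fintype.card_fin, smul_eq_mul]
    rw [integrableOn_congr_fun hprod measurableSet_Ioi]
    exact (hint0.integrable_indicator measurableSet_Ici).integrableOn
  have e1 : ∫⁻ z in (ball (0 : Ed d) r)ᶜ, ENNReal.ofReal (jumpKer s z) =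
      ∫⁻ z : Ed d, ENNReal.ofReal (f ‖z‖) := by
    rw [← lintegral_indicator measurableSet_ball.compl]
    refine lintegral_congr fun z => ?_
    by_cases h : r ≤ ‖z‖ <;> simp [hf, indicator, h, jumpKer]
  have hfn : ∀ z : Ed d, 0 ≤ f ‖z‖ := fun z =>
    indicator_nonneg (fun y hy => by have : 0 < y := hr.trans_le hy; positivity) _
  rw [e1, ← ofReal_integral_eq_lintegral_ofReal hInt (.of_forall hfn)]
  refine ENNReal.ofReal_le_ofReal (le_of_eq ?_)
  rw [integral_fun_norm_addHaar volume f]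
  simp only [finrank_euclideanSpace, Fintype.card_fin, smul_eq_mul, nsmul_eq_mul]
  rw [setIntegral_congr_fun measurableSet_Ioi hprod, setIntegral_indicator measurableSet_Ici, hsub,
    integral_Ici_eq_integral_Ioi, integral_Ioi_rpow_of_lt (by linarith) hr]
  rw [show -1 - 2 * s + 1 = -(2 * s) by ring, hc]; field_simp

theorem ofReal_sq_sub_le_lintegral_fderiv {E : Type*} [NormedAddCommGroup E] [NormedSpace ℝ E]
    {h : E → ℝ} (hh : ContDiff ℝ 1 h) (x y : E) :
    ENNReal.ofReal ((h x - h y) ^ 2) ≤ ENNReal.ofReal (‖y - x‖ ^ 2) *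
      ∫⁻ θ in Ioc (0 : ℝ) 1, ‖fderiv ℝ h (x + θ • (y - x))‖ₑ ^ (2 : ℝ) := by
  have hcont : Continuous fun θ : ℝ => fderiv ℝ h (x + θ • (y - x)) :=
    (hh.continuous_fderiv one_ne_zero).comp (by fun_prop)
  have hftc : ∫ θ in Ioc (0 : ℝ) 1, fderiv ℝ h (x + θ • (y - x)) (y - x) = h y - h x := by
    rw [← intervalIntegral.integral_of_le zero_le_one]
    have hder : ∀ θ ∈ uIcc (0 : ℝ) 1, HasDerivAt (fun θ : ℝ => h (x + θ • (y - x)))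
        (fderiv ℝ h (x + θ • (y - x)) (y - x)) θ := by
      intro θ _
      have h1 : HasDerivAt (fun θ : ℝ => x + θ • (y - x)) (y - x) θ := by
        simpa using ((hasDerivAt_id θ).smul_const (y - x)).const_add x
      exact ((hh.differentiable one_ne_zero).differentiableAt.hasFDerivAt).comp_hasDerivAt θ h1
    rw [intervalIntegral.integral_eq_sub_of_hasDerivAt hder]
    · simp
    · exact (hcont.clm_apply continuous_const).intervalIntegrable _ _
  have hJ : (∫⁻ θ in Ioc (0 : ℝ) 1, ‖fderiv ℝ h (x + θ • (y - x))‖ₑ) ^ (2 : ℝ) ≤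
      ∫⁻ θ in Ioc (0 : ℝ) 1, ‖fderiv ℝ h (x + θ • (y - x))‖ₑ ^ (2 : ℝ) := by
    have : IsProbabilityMeasure (volume.restrict (Ioc (0 : ℝ) 1)) := ⟨by simp⟩
    have := eLpNorm_le_eLpNorm_of_exponent_le (p := 1) (q := 2) (by norm_num)
      hcont.aestronglyMeasurable (μ := volume.restrict (Ioc (0 : ℝ) 1))
    rw [eLpNorm_one_eq_lintegral_enorm,
      eLpNorm_eq_lintegral_rpow_enorm_toReal (by norm_num) (by norm_num)] at this
    simp only [ENNReal.toReal_ofNat, one_div] at this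
    exact (ENNReal.le_rpow_inv_iff (by norm_num)).1 this
  have hsq : ∀ a : ℝ, ENNReal.ofReal (a ^ 2) = ‖a‖ₑ ^ (2 : ℝ) := by
    intro a
    rw [← sq_abs, ENNReal.ofReal_pow (abs_nonneg a), ← Real.enorm_eq_ofReal_abs]
    norm_cast
  have hsq' : ENNReal.ofReal (‖y - x‖ ^ 2) = ‖y - x‖ₑ ^ (2 : ℝ) := by
    rw [hsq, enorm_norm]
  calc ENNReal.ofReal ((h x - h y) ^ 2) = ‖h y - h x‖ₑ ^ (2 : ℝ) := by
        rw [← hsq]; congr 1; ring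
    _ ≤ ((∫⁻ θ in Ioc (0 : ℝ) 1, ‖fderiv ℝ h (x + θ • (y - x))‖ₑ) * ‖y - x‖ₑ) ^ (2 : ℝ) := by
        gcongr
        rw [← hftc, ← lintegral_mul_const _ hcont.enorm.measurable]
        refine (enorm_integral_le_lintegral_enorm _).trans (lintegral_mono fun θ => ?_)
        exact ContinuousLinearMap.le_opENorm _ _
    _ ≤ _ := by
        rw [ENNReal.mul_rpow_of_nonneg _ _ (by norm_num), mul_comm, hsq']
        gcongr

theorem lintegral_gagliardo_le (s : ℝ) {h : Ed d → ℝ} (hh : ContDiff ℝ 1 h) (x₀ : Ed d) (r : ℝ) :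
    ∫⁻ x in ball x₀ r, ∫⁻ y in ball x₀ r, ENNReal.ofReal ((h x - h y) ^ 2 * jumpKer s (x - y)) ≤
      (∫⁻ z in ball (0 : Ed d) (2 * r), ENNReal.ofReal (‖z‖ ^ 2 * jumpKer s z)) *
        ∫⁻ x in ball x₀ r, ‖fderiv ℝ h x‖ₑ ^ (2 : ℝ) := by
  set B := ball x₀ r with hB
  have hBm : MeasurableSet B := measurableSet_ball
  set H : Ed d → ℝ≥0∞ := B.indicator fun x => ‖fderiv ℝ h x‖ₑ ^ (2 : ℝ) with hH
  have hHm : Measurable H :=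
    ((hh.continuous_fderiv one_ne_zero).enorm.measurable.pow_const _).indicator hBm
  set c : Ed d → ℝ≥0∞ := (ball (0 : Ed d) (2 * r)).indicator
    fun z => ENNReal.ofReal (‖z‖ ^ 2 * jumpKer s z) with hc
  have hcm : Measurable c := Measurable.indicator (by fun_prop) measurableSet_ball
  have key : ∀ x ∈ B, ∫⁻ y in B, ENNReal.ofReal ((h x - h y) ^ 2 * jumpKer s (x - y)) ≤
      ∫⁻ z, c z * ∫⁻ θ in Ioc (0 : ℝ) 1, H (x + θ • z) := by
    intro x hx
    rw [← lintegral_indicator hBm, ← lintegral_add_left_eq_self _ x]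
    refine lintegral_mono fun z => ?_
    by_cases hz : x + z ∈ B
    · rw [indicator_of_mem hz]
      have hz2 : z ∈ ball (0 : Ed d) (2 * r) := by
        rw [mem_ball_zero_iff]
        have h1 := mem_ball_iff_norm.1 hx
        have h2 := mem_ball_iff_norm.1 hz
        calc ‖z‖ = ‖(x + z - x₀) - (x - x₀)‖ := by congr 1; abel
          _ ≤ ‖x + z - x₀‖ + ‖x - x₀‖ := norm_sub_le _ _
          _ < 2 * r := by linarith
      have e : ∀ θ ∈ Ioc (0 : ℝ) 1, ‖fderiv ℝ h (x + θ • z)‖ₑ ^ (2 : ℝ) = H (x + θ • z) := by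
        intro θ hθ
        rw [hH, indicator_of_mem]
        have := (convex_ball x₀ r).add_smul_sub_mem hx hz ⟨hθ.1.le, hθ.2⟩
        rwa [add_sub_cancel_left] at this
      rw [hc, indicator_of_mem hz2, ENNReal.ofReal_mul (sq_nonneg _),
        ENNReal.ofReal_mul (sq_nonneg _), mul_right_comm]
      rw [show x - (x + z) = -z by abel, jumpKer_neg]
      gcongr
      have := ofReal_sq_sub_le_lintegral_fderiv hh x (x + z)
      rw [add_sub_cancel_left, setLIntegral_congr_fun measurableSet_Ioc e] at this
      exact this
    · rw [indicator_of_notMem hz]; exact zero_le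
  calc ∫⁻ x in B, ∫⁻ y in B, ENNReal.ofReal ((h x - h y) ^ 2 * jumpKer s (x - y))
      ≤ ∫⁻ x in B, ∫⁻ z, c z * ∫⁻ θ in Ioc (0 : ℝ) 1, H (x + θ • z) :=
        setLIntegral_mono' hBm key
    _ ≤ ∫⁻ x, ∫⁻ z, c z * ∫⁻ θ in Ioc (0 : ℝ) 1, H (x + θ • z) :=
        setLIntegral_le_lintegral _ _
    _ = ∫⁻ z, ∫⁻ x, c z * ∫⁻ θ in Ioc (0 : ℝ) 1, H (x + θ • z) := by
        refine lintegral_lintegral_swap (Measurable.aemeasurable ?_)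
        refine (hcm.comp measurable_snd).mul ?_
        refine Measurable.lintegral_prod_right' (f := fun w : (Ed d × Ed d) × ℝ =>
          H (w.1.1 + w.2 • w.1.2)) ?_
        exact hHm.comp (by fun_prop)
    _ = ∫⁻ z, c z * ∫⁻ x, H x := by
        refine lintegral_congr fun z => ?_
        rw [lintegral_const_mul _ (Measurable.lintegral_prod_right' (f := fun w : Ed d × ℝ =>
          H (w.1 + w.2 • z)) (hHm.comp (by fun_prop)))]
        congr 1
        have hm2 : Measurable (Function.uncurry fun (a : Ed d) (θ : ℝ) => H (a + θ • z)) :=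
          hHm.comp (f := fun w : Ed d × ℝ => w.1 + w.2 • z) (by fun_prop)
        rw [lintegral_lintegral_swap hm2.aemeasurable]
        simp_rw [lintegral_add_right_eq_self]
        simp
    _ = _ := by
        rw [lintegral_mul_const _ hcm, hc, lintegral_indicator measurableSet_ball, hH,
          lintegral_indicator hBm]

/-- The weighted difference quotient whose `L²` norm is the fractional seminorm. -/
def gag (s : ℝ) (U : ℝ × Ed d → ℝ) (q : ℝ × Ed d × Ed d) : ℝ :=
  (U (q.1, q.2.1) - U (q.1, q.2.2)) * √(jumpKer s (q.2.1 - q.2.2))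

@[fun_prop]
theorem measurable_gag (s : ℝ) {U : ℝ × Ed d → ℝ} (hU : Measurable U) : Measurable (gag s U) := by
  unfold gag
  have h1 : Measurable fun q : ℝ × Ed d × Ed d => U (q.1, q.2.1) := hU.comp (by fun_prop)
  have h2 : Measurable fun q : ℝ × Ed d × Ed d => U (q.1, q.2.2) := hU.comp (by fun_prop)
  fun_prop

theorem gag_sub (s : ℝ) (U V : ℝ × Ed d → ℝ) : gag s (U - V) = gag s U - gag s V := by
  ext q; simp only [gag, Pi.sub_apply]; ring

theorem enorm_gag_sq (s : ℝ) (U : ℝ × Ed d → ℝ) (q : ℝ × Ed d × Ed d) :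
    ‖gag s U q‖ₑ ^ (2 : ℝ) = ENNReal.ofReal
      ((U (q.1, q.2.1) - U (q.1, q.2.2)) ^ 2 * jumpKer s (q.2.1 - q.2.2)) := by
  rw [Real.enorm_eq_ofReal_abs, ENNReal.rpow_ofNat, ← ENNReal.ofReal_pow (abs_nonneg _), sq_abs]
  simp only [gag]
  rw [mul_pow, Real.sq_sqrt (jumpKer_nonneg _ _)]

/-- The square root of the constant in the embedding of `W^{1,2}` into the fractional space on a
ball of radius `r`. -/
def gagConst (d : ℕ) (s r : ℝ) : ℝ≥0∞ :=
  (∫⁻ z in ball (0 : Ed d) (2 * r), ENNReal.ofReal (‖z‖ ^ 2 * jumpKer s z)) ^ (2 : ℝ)⁻¹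

theorem eLpNorm_gag_le (s : ℝ) {E : Type*} [NormedAddCommGroup E] [MeasurableSpace E]
    [OpensMeasurableSpace E] {U : ℝ × Ed d → ℝ}
    (hU : Measurable U) {W : ℝ × Ed d → E} (hW : Measurable W)
    {I : Set ℝ} (hI : MeasurableSet I) (x₀ : Ed d) (r : ℝ)
    (hUs : ∀ t ∈ I, ContDiff ℝ 1 fun x => U (t, x))
    (hUW : ∀ t ∈ I, ∀ x ∈ ball x₀ r, ‖fderiv ℝ (fun x => U (t, x)) x‖ ≤ ‖W (t, x)‖) :
    eLpNorm (gag s U) 2 (volume.restrict (I ×ˢ ball x₀ r ×ˢ ball x₀ r)) ≤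
      gagConst d s r * eLpNorm W 2 (volume.restrict (I ×ˢ ball x₀ r)) := by
  rw [eLpNorm_eq_lintegral_rpow_enorm_toReal (by norm_num) (by norm_num),
    eLpNorm_eq_lintegral_rpow_enorm_toReal (by norm_num) (by norm_num)]
  simp only [ENNReal.toReal_ofNat, one_div]
  rw [gagConst, ← ENNReal.mul_rpow_of_nonneg _ _ (by norm_num)]
  gcongr
  have hBm : MeasurableSet (ball x₀ r) := measurableSet_ball
  rw [Measure.volume_eq_prod, ← Measure.prod_restrict, Measure.volume_eq_prod,
    ← Measure.prod_restrict, lintegral_prod _ (by fun_prop),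
    Measure.volume_eq_prod, ← Measure.prod_restrict, lintegral_prod _ (by fun_prop),
    ← lintegral_const_mul _ (Measurable.lintegral_prod_right'
      (f := fun p : ℝ × Ed d => ‖W p‖ₑ ^ (2 : ℝ)) (by fun_prop))]
  refine setLIntegral_mono' hI fun t ht => ?_
  rw [lintegral_prod _ (by fun_prop)]
  simp only [enorm_gag_sq]
  refine (lintegral_gagliardo_le s (hUs t ht) x₀ r).trans ?_
  refine mul_le_mul' le_rfl ?_
  refine setLIntegral_mono' hBm fun x hx => ?_
  gcongr
  rw [enorm_le_iff_norm_le]; exact hUW t ht x hx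

theorem eLpNorm_gag_sub_le_of_tendsto (s : ℝ) {V : ℕ → ℝ × Ed d → ℝ} {U : ℝ × Ed d → ℝ}
    {DV : ℕ → ℝ × Ed d → Ed d} {W : ℝ × Ed d → Ed d} (hV : ∀ n, Measurable (V n))
    (hU : Measurable U) (hDV : ∀ n, Measurable (DV n)) (hW : Measurable W)
    {I : Set ℝ} (hI : MeasurableSet I) (x₀ : Ed d) (r : ℝ) (hC : gagConst d s r ≠ ∞)
    (hVs : ∀ n t, ContDiff ℝ 1 fun x => V n (t, x))
    (hVD : ∀ n, ∀ t ∈ I, ∀ x ∈ ball x₀ r,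
      fderiv ℝ (fun x => V n (t, x)) x = innerSL ℝ (DV n (t, x)))
    (hVU : Tendsto (fun n => eLpNorm (V n - U) 2 (volume.restrict (I ×ˢ ball x₀ r))) atTop (𝓝 0))
    (hDW : Tendsto (fun n => eLpNorm (DV n - W) 2 (volume.restrict (I ×ˢ ball x₀ r)))
      atTop (𝓝 0)) (n : ℕ) :
    eLpNorm (gag s (V n) - gag s U) 2 (volume.restrict (I ×ˢ ball x₀ r ×ˢ ball x₀ r)) ≤
      gagConst d s r * eLpNorm (DV n - W) 2 (volume.restrict (I ×ˢ ball x₀ r)) := by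
  obtain ⟨ns, hns, hae⟩ := (tendstoInMeasure_of_tendsto_eLpNorm (by norm_num)
    (fun k => (hV k).aestronglyMeasurable) hU.aestronglyMeasurable hVU).exists_seq_tendsto_ae
  set μ2 := (volume : Measure (ℝ × Ed d)).restrict (I ×ˢ ball x₀ r) with hμ2
  set μ3 := (volume : Measure (ℝ × Ed d × Ed d)).restrict (I ×ˢ ball x₀ r ×ˢ ball x₀ r) with hμ3
  have e2 : μ2 = (volume.restrict I).prod (volume.restrict (ball x₀ r)) := by
    rw [hμ2, Measure.volume_eq_prod, Measure.prod_restrict]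
  have e3 : μ3 = (volume.restrict I).prod
      ((volume.restrict (ball x₀ r)).prod (volume.restrict (ball x₀ r))) := by
    rw [hμ3, Measure.volume_eq_prod, ← Measure.prod_restrict, Measure.volume_eq_prod,
      Measure.prod_restrict (ball x₀ r)]
  have q1 : Measure.QuasiMeasurePreserving (fun q : ℝ × Ed d × Ed d => (q.1, q.2.1)) μ3 μ2 := by
    rw [e2, e3]
    exact Measure.quasiMeasurePreserving_fst.comp
      (measurePreserving_prodAssoc _ _ _).symm.quasiMeasurePreserving
  have q2 : Measure.QuasiMeasurePreserving (fun q : ℝ × Ed d × Ed d => (q.1, q.2.2)) μ3 μ2 := by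
    rw [e2, e3]
    exact Measure.quasiMeasurePreserving_fst.comp
      ((measurePreserving_prodAssoc _ _ _).symm.comp
        ((MeasurePreserving.id _).prod Measure.measurePreserving_swap)).quasiMeasurePreserving
  have hlim : ∀ᵐ q ∂μ3, Tendsto (fun k => (gag s (V n) - gag s (V (ns k))) q) atTop
      (𝓝 ((gag s (V n) - gag s U) q)) := by
    filter_upwards [q1.ae hae, q2.ae hae] with q h1 h2
    exact tendsto_const_nhds.sub ((h1.sub h2).mul_const _)
  refine (Lp.eLpNorm_lim_le_liminf_eLpNorm (p := 2)
    (fun k => ((measurable_gag s (hV n)).sub (measurable_gag s (hV (ns k)))).aestronglyMeasurable)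
    _ hlim).trans ?_
  have hb : ∀ k, eLpNorm (gag s (V n) - gag s (V (ns k))) 2 μ3 ≤
      gagConst d s r * (eLpNorm (DV n - W) 2 μ2 + eLpNorm (DV (ns k) - W) 2 μ2) := by
    intro k
    rw [← gag_sub]
    refine (eLpNorm_gag_le s ((hV n).sub (hV (ns k))) ((hDV n).sub (hDV (ns k))) hI x₀ r
      (fun t _ => (hVs n t).sub (hVs _ t)) fun t ht x hx => ?_).trans ?_
    · have : fderiv ℝ (fun x => (V n - V (ns k)) (t, x)) x =
          innerSL ℝ ((DV n - DV (ns k)) (t, x)) := by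
        simp only [Pi.sub_apply]
        rw [fderiv_fun_sub ((hVs n t).differentiable one_ne_zero).differentiableAt
          ((hVs _ t).differentiable one_ne_zero).differentiableAt, hVD n t ht x hx,
          hVD _ t ht x hx, map_sub]
      rw [this, innerSL_apply_norm]
    · gcongr
      have : DV n - DV (ns k) = (DV n - W) - (DV (ns k) - W) := by abel
      rw [this]
      exact eLpNorm_sub_le ((hDV n).sub hW).aestronglyMeasurable
        ((hDV _).sub hW).aestronglyMeasurable (by norm_num)
  have ht : Tendsto (fun k => gagConst d s r *
      (eLpNorm (DV n - W) 2 μ2 + eLpNorm (DV (ns k) - W) 2 μ2)) atTop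
      (𝓝 (gagConst d s r * (eLpNorm (DV n - W) 2 μ2 + 0))) :=
    ENNReal.Tendsto.const_mul (tendsto_const_nhds.add (hDW.comp hns.tendsto_atTop)) (Or.inr hC)
  rw [add_zero] at ht
  exact (liminf_le_liminf (.of_forall hb)).trans ht.liminf_eq.le

instance : (volume : Measure (ℝ × Ed d)).IsAddHaarMeasure :=
  inferInstanceAs ((volume : Measure ℝ).prod (volume : Measure (Ed d))).IsAddHaarMeasure

instance : (volume : Measure (Ed d × Ed d)).IsAddHaarMeasure :=
  inferInstanceAs ((volume : Measure (Ed d)).prod (volume : Measure (Ed d))).IsAddHaarMeasure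

instance : (volume : Measure (ℝ × Ed d × Ed d)).IsAddHaarMeasure :=
  Measure.prod.instIsAddHaarMeasure (volume : Measure ℝ) (volume : Measure (Ed d × Ed d))

/-- The time derivative of a function on space-time. -/
def dt (φ : ℝ × Ed d → ℝ) (q : ℝ × Ed d) : ℝ := deriv (fun τ => φ (τ, q.2)) q.1

/-- The spatial derivative of a function on space-time. -/
def dx (φ : ℝ × Ed d → ℝ) (q : ℝ × Ed d) : Ed d →L[ℝ] ℝ := fderiv ℝ (fun x => φ (q.1, x)) q.2

theorem hasDerivAt_dt {φ : ℝ × Ed d → ℝ} (hφ : Differentiable ℝ φ) (q : ℝ × Ed d) :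
    HasDerivAt (fun τ => φ (τ, q.2)) (fderiv ℝ φ q (1, 0)) q.1 := by
  have h1 : HasDerivAt (fun τ : ℝ => (τ, q.2)) ((1 : ℝ), (0 : Ed d)) q.1 :=
    (hasDerivAt_id _).prodMk (hasDerivAt_const _ _)
  exact (hφ q).hasFDerivAt.comp_hasDerivAt (f := fun τ : ℝ => (τ, q.2)) q.1 h1

theorem dt_eq {φ : ℝ × Ed d → ℝ} (hφ : Differentiable ℝ φ) (q : ℝ × Ed d) :
    dt φ q = fderiv ℝ φ q (1, 0) := (hasDerivAt_dt hφ q).deriv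

theorem hasFDerivAt_dx {φ : ℝ × Ed d → ℝ} (hφ : Differentiable ℝ φ) (q : ℝ × Ed d) :
    HasFDerivAt (fun x => φ (q.1, x))
      ((fderiv ℝ φ q).comp (ContinuousLinearMap.inr ℝ ℝ (Ed d))) q.2 := by
  have h1 : HasFDerivAt (fun x : Ed d => (q.1, x)) (ContinuousLinearMap.inr ℝ ℝ (Ed d)) q.2 :=
    hasFDerivAt_prodMk_right _ _
  exact (hφ q).hasFDerivAt.comp (f := fun x : Ed d => (q.1, x)) q.2 h1

theorem dx_eq {φ : ℝ × Ed d → ℝ} (hφ : Differentiable ℝ φ) (q : ℝ × Ed d) :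
    dx φ q = (fderiv ℝ φ q).comp (ContinuousLinearMap.inr ℝ ℝ (Ed d)) :=
  (hasFDerivAt_dx hφ q).fderiv

theorem continuous_dt {φ : ℝ × Ed d → ℝ} (hφ : ContDiff ℝ 1 φ) : Continuous (dt φ) := by
  have : dt φ = fun q => fderiv ℝ φ q (1, 0) :=
    funext fun q => dt_eq (hφ.differentiable one_ne_zero) q
  rw [this]
  exact (hφ.continuous_fderiv one_ne_zero).clm_apply continuous_const

theorem continuous_dx {φ : ℝ × Ed d → ℝ} (hφ : ContDiff ℝ 1 φ) : Continuous (dx φ) := by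
  have : dx φ = fun q => (fderiv ℝ φ q).comp (ContinuousLinearMap.inr ℝ ℝ (Ed d)) :=
    funext fun q => dx_eq (hφ.differentiable one_ne_zero) q
  rw [this]
  exact (hφ.continuous_fderiv one_ne_zero).clm_comp continuous_const

theorem dt_eq_zero {φ : ℝ × Ed d → ℝ} (hφ : Differentiable ℝ φ) {q : ℝ × Ed d}
    (hq : q ∉ tsupport φ) : dt φ q = 0 := by
  rw [dt_eq hφ, fderiv_of_notMem_tsupport ℝ hq]; rfl

theorem dx_eq_zero {φ : ℝ × Ed d → ℝ} (hφ : Differentiable ℝ φ) {q : ℝ × Ed d}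
    (hq : q ∉ tsupport φ) : dx φ q = 0 := by
  rw [dx_eq hφ, fderiv_of_notMem_tsupport ℝ hq]; ext; simp

theorem hasCompactSupport_dt {φ : ℝ × Ed d → ℝ} (hφ : Differentiable ℝ φ)
    (hc : HasCompactSupport φ) : HasCompactSupport (dt φ) :=
  hc.mono' fun _ hq => by_contra fun h => hq (dt_eq_zero hφ h)

theorem hasCompactSupport_dx {φ : ℝ × Ed d → ℝ} (hφ : Differentiable ℝ φ)
    (hc : HasCompactSupport φ) : HasCompactSupport (dx φ) :=
  hc.mono' fun _ hq => by_contra fun h => hq (dx_eq_zero hφ h)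

theorem dt_comp_add (φ : ℝ × Ed d → ℝ) (p q : ℝ × Ed d) :
    dt (fun q => φ (q + p)) q = dt φ (q + p) := by
  simp only [dt, Prod.fst_add, Prod.snd_add]
  exact deriv_comp_add_const (fun τ => φ (τ, q.2 + p.2)) p.1 q.1

theorem dx_comp_add (φ : ℝ × Ed d → ℝ) (p q : ℝ × Ed d) :
    dx (fun q => φ (q + p)) q = dx φ (q + p) := by
  simp only [dx, Prod.fst_add, Prod.snd_add]
  exact fderiv_comp_add_right (f := fun x => φ (q.1 + p.1, x)) p.2

/-- The diagonal shift acting on a time and a pair of points. -/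
def tdiag (p : ℝ × Ed d) : ℝ × Ed d × Ed d := (p.1, p.2, p.2)

@[fun_prop]
theorem continuous_tdiag : Continuous (tdiag : ℝ × Ed d → ℝ × Ed d × Ed d) := by
  unfold tdiag; fun_prop

theorem gag_comp_add (s : ℝ) (φ : ℝ × Ed d → ℝ) (p : ℝ × Ed d) (q : ℝ × Ed d × Ed d) :
    gag s (fun q => φ (q + p)) q = gag s φ (q + tdiag p) := by
  simp only [gag, tdiag, Prod.fst_add, Prod.snd_add, add_sub_add_right_eq_sub]
  rfl

/-- The weak formulation with frozen coefficients. -/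
def testForm (s : ℝ) (V : ℝ × Ed d → ℝ) (a : ℝ × Ed d → Ed d) (b : ℝ × Ed d × Ed d → ℝ)
    (g : ℝ × Ed d → ℝ) (φ : ℝ × Ed d → ℝ) : ℝ :=
  -(∫ q, V q * dt φ q) + ((∫ q, dx φ q (a q)) + (∫ q, b q * gag s φ q) + 2 * ∫ q, g q * φ q)

theorem testForm_comp_add (s : ℝ) (V : ℝ × Ed d → ℝ) (a : ℝ × Ed d → Ed d)
    (b : ℝ × Ed d × Ed d → ℝ) (g : ℝ × Ed d → ℝ) (φ : ℝ × Ed d → ℝ) (p : ℝ × Ed d) :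
    testForm s V a b g (fun q => φ (q + p)) =
      testForm s (fun q => V (q - p)) (fun q => a (q - p)) (fun q => b (q - tdiag p))
        (fun q => g (q - p)) φ := by
  simp only [testForm, dt_comp_add, dx_comp_add, gag_comp_add]
  rw [← integral_sub_right_eq_self (fun q => V q * dt φ (q + p)) p,
    ← integral_sub_right_eq_self (fun q => dx φ (q + p) (a q)) p,
    ← integral_sub_right_eq_self (fun q => b q * gag s φ (q + tdiag p)) (tdiag p),
    ← integral_sub_right_eq_self (fun q => g q * φ (q + p)) p]
  simp only [sub_add_cancel]

theorem memLp_of_continuous_compact {E : Type*} [NormedAddCommGroup E] {ψ : ℝ × Ed d → E}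
    (hψ : Continuous ψ) (hc : HasCompactSupport ψ) : MemLp ψ 2 volume :=
  hψ.memLp_of_hasCompactSupport hc

theorem tsupport_comp_add_subset {ψ : ℝ × Ed d → ℝ} {ε : ℝ} {p : ℝ × Ed d}
    (hp : ‖p‖ < ε) : tsupport (fun q => ψ (q + p)) ⊆ thickening ε (tsupport ψ) := by
  have h1 : tsupport (fun q => ψ (q + p)) ⊆ (fun q => q + p) ⁻¹' tsupport ψ :=
    tsupport_comp_subset_preimage ψ (by fun_prop)
  intro q hq
  rw [mem_thickening_iff]
  exact ⟨q + p, h1 hq, by simpa [dist_eq_norm] using hp⟩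

/-- Averaging a translation-stable weak inequality against a mollifier. -/
theorem testForm_average_le (s : ℝ) {V : ℝ × Ed d → ℝ} {a : ℝ × Ed d → Ed d}
    {b : ℝ × Ed d × Ed d → ℝ} {g : ℝ × Ed d → ℝ} (hV : Integrable V)
    (ha : MemLp a 2) (hb : MemLp b 2) (hg : MemLp g 2) {U : Set (ℝ × Ed d)}
    (hineq : ∀ φ : ℝ × Ed d → ℝ, ContDiff ℝ (⊤ : ℕ∞) φ → HasCompactSupport φ → tsupport φ ⊆ U →
      (∀ q, 0 ≤ φ q) → testForm s V a b g φ ≤ 0)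
    {S : Set (ℝ × Ed d × Ed d)} {ε : ℝ}
    (hbS : ∀ p : ℝ × Ed d, ‖p‖ < ε → ∀ q ∉ S, b (q - tdiag p) = 0)
    {ω : ℝ} (hω : 0 ≤ ω)
    (hωa : ∀ p : ℝ × Ed d, ‖p‖ < ε → eLpNorm (fun q => a (q - p) - a q) 2 ≤ ENNReal.ofReal ω)
    (hωg : ∀ p : ℝ × Ed d, ‖p‖ < ε → eLpNorm (fun q => g (q - p) - g q) 2 ≤ ENNReal.ofReal ω)
    (hωb : ∀ p : ℝ × Ed d, ‖p‖ < ε →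
      eLpNorm (fun q => b (q - tdiag p) - b q) 2 ≤ ENNReal.ofReal ω)
    (ρ : ContDiffBump (0 : ℝ × Ed d)) (hρ : ρ.rOut ≤ ε)
    {ψ : ℝ × Ed d → ℝ} (hψ : ContDiff ℝ (⊤ : ℕ∞) ψ) (hψc : HasCompactSupport ψ)
    (hψU : thickening ε (tsupport ψ) ⊆ U) (hψ0 : ∀ q, 0 ≤ ψ q)
    (hψg : MemLp (gag s ψ) 2 (volume.restrict S)) :
    testForm s (fun q => ∫ p, ρ.normed volume p * V (q - p)) a b g ψ ≤
      ω * ((eLpNorm (dx ψ) 2).toReal + (eLpNorm (gag s ψ) 2 (volume.restrict S)).toReal +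
        2 * (eLpNorm ψ 2).toReal) := by
  have hψ1 : ContDiff ℝ 1 ψ := hψ.of_le (by exact_mod_cast le_top)
  have hψd : Differentiable ℝ ψ := hψ1.differentiable one_ne_zero
  have hdx : MemLp (dx ψ) 2 volume :=
    memLp_of_continuous_compact (continuous_dx hψ1) (hasCompactSupport_dx hψd hψc)
  have hdt : MemLp (dt ψ) 2 volume :=
    memLp_of_continuous_compact (continuous_dt hψ1) (hasCompactSupport_dt hψd hψc)
  have hψ2 : MemLp ψ 2 volume := memLp_of_continuous_compact hψ1.continuous hψc
  have msub : ∀ p : ℝ × Ed d, MeasurePreserving (fun q : ℝ × Ed d => q - p) volume volume :=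
    fun p => measurePreserving_sub_right _ p
  have msub3 : ∀ p : ℝ × Ed d × Ed d,
      MeasurePreserving (fun q : ℝ × Ed d × Ed d => q - p) volume volume :=
    fun p => measurePreserving_sub_right _ p
  set N : ℝ := (eLpNorm (dx ψ) 2).toReal + (eLpNorm (gag s ψ) 2 (volume.restrict S)).toReal +
        2 * (eLpNorm ψ 2).toReal with hN
  set E : ℝ := (∫ q, dx ψ q (a q)) + (∫ q, b q * gag s ψ q) + 2 * ∫ q, g q * ψ q with hE
  have iclm : ∀ c : ℝ × Ed d → Ed d, MemLp c 2 → Integrable (fun q => dx ψ q (c q)) := by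
    intro c hc
    refine (integrable_mul_of_memLp hdx.norm hc.norm).mono' ?_ (.of_forall fun q => ?_)
    · exact (ContinuousLinearMap.apply ℝ ℝ |>.flip |>.aestronglyMeasurable_comp₂
        hdx.1 hc.1)
    · exact (dx ψ q).le_opNorm _
  have ib : ∀ c : ℝ × Ed d × Ed d → ℝ, MemLp c 2 → (∀ q ∉ S, c q = 0) →
      Integrable (fun q => c q * gag s ψ q) ∧
        ∫ q, c q * gag s ψ q = ∫ q in S, c q * gag s ψ q := by
    intro c hc h0
    have hsub : Function.support (fun q => c q * gag s ψ q) ⊆ S := by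
      intro q hq
      by_contra h
      exact hq (by simp [h0 q h])
    refine ⟨?_, (setIntegral_eq_integral_of_forall_compl_eq_zero fun q h => by
      simp [h0 q h]).symm⟩
    exact (integrableOn_iff_integrable_of_support_subset hsub).1
      (integrable_mul_of_memLp (hc.restrict S) hψg)
  have point : ∀ p : ℝ × Ed d, ‖p‖ < ε → E - ω * N ≤ ∫ q, V (q - p) * dt ψ q := by
    intro p hp
    have h0 : ‖(0 : ℝ × Ed d)‖ < ε := by rw [norm_zero]; exact (norm_nonneg p).trans_lt hp
    have h := hineq (fun q => ψ (q + p)) (hψ.comp (by fun_prop))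
      (hψc.comp_homeomorph (Homeomorph.addRight p))
      ((tsupport_comp_add_subset hp).trans hψU) (fun q => hψ0 _)
    rw [testForm_comp_add] at h
    have hap : MemLp (fun q => a (q - p)) 2 := ha.comp_measurePreserving (msub p)
    have hgp : MemLp (fun q => g (q - p)) 2 := hg.comp_measurePreserving (msub p)
    have hbp : MemLp (fun q => b (q - tdiag p)) 2 := hb.comp_measurePreserving (msub3 _)
    have e1 : |(∫ q, dx ψ q (a (q - p))) - ∫ q, dx ψ q (a q)| ≤ ω * (eLpNorm (dx ψ) 2).toReal := by
      rw [← integral_sub (iclm _ hap) (iclm _ ha)]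
      calc |∫ q, (dx ψ q (a (q - p)) - dx ψ q (a q))| ≤ ∫ q, |dx ψ q (a (q - p)) - dx ψ q (a q)| :=
            abs_integral_le_integral_abs
        _ ≤ ∫ q, |‖a (q - p) - a q‖ * ‖dx ψ q‖| := by
            refine integral_mono ((iclm _ hap).sub (iclm _ ha)).abs
              (integrable_mul_of_memLp (hap.sub ha).norm hdx.norm).abs fun q => ?_
            simp only [← map_sub, abs_mul, abs_norm]
            rw [mul_comm]
            exact (dx ψ q).le_opNorm _
        _ ≤ _ := by
            refine (integral_abs_mul_le_eLpNorm (hap.sub ha).norm hdx.norm).trans ?_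
            rw [eLpNorm_norm, eLpNorm_norm]
            gcongr
            exact ENNReal.toReal_le_of_le_ofReal hω (hωa p hp)
    have e2 : |(∫ q, g (q - p) * ψ q) - ∫ q, g q * ψ q| ≤ ω * (eLpNorm ψ 2).toReal := by
      rw [← integral_sub (integrable_mul_of_memLp hgp hψ2) (integrable_mul_of_memLp hg hψ2)]
      simp only [← sub_mul]
      refine abs_integral_le_integral_abs.trans
        ((integral_abs_mul_le_eLpNorm (hgp.sub hg) hψ2).trans ?_)
      gcongr
      exact ENNReal.toReal_le_of_le_ofReal hω (hωg p hp)
    have hb0 : ∀ q ∉ S, b q = 0 := by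
      intro q hq
      have h1 := hbS 0 h0 q hq
      rwa [show tdiag (0 : ℝ × Ed d) = 0 from rfl, sub_zero] at h1
    have e3 : |(∫ q, b (q - tdiag p) * gag s ψ q) - ∫ q, b q * gag s ψ q| ≤
        ω * (eLpNorm (gag s ψ) 2 (volume.restrict S)).toReal := by
      rw [(ib _ hbp (hbS p hp)).2, (ib _ hb hb0).2,
        ← integral_sub (ib _ hbp (hbS p hp)).1.integrableOn (ib _ hb hb0).1.integrableOn]
      simp only [← sub_mul]
      refine abs_integral_le_integral_abs.trans
        ((integral_abs_mul_le_eLpNorm ((hbp.sub hb).restrict S) hψg).trans ?_)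
      gcongr
      exact ENNReal.toReal_le_of_le_ofReal hω
        ((eLpNorm_mono_measure _ Measure.restrict_le_self).trans (hωb p hp))
    rw [testForm] at h
    rw [hE, hN]
    linarith [(abs_le.1 e1).1, (abs_le.1 e2).1, (abs_le.1 e3).1]
  have hρi : Integrable (ρ.normed volume) := ρ.integrable_normed
  obtain ⟨M, hM⟩ := (hasCompactSupport_dt hψd hψc).exists_bound_of_continuous (continuous_dt hψ1)
  have iprod : Integrable (fun w : (ℝ × Ed d) × (ℝ × Ed d) =>
      ρ.normed volume w.2 * V (w.1 - w.2) * dt ψ w.1) (volume.prod volume) := by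
    refine Integrable.mul_bdd (c := M) ?_ ?_ (.of_forall fun w => hM w.1)
    · exact hρi.convolution_integrand (ContinuousLinearMap.mul ℝ ℝ) hV
    · exact ((continuous_dt hψ1).comp continuous_fst).aestronglyMeasurable
  have fub : ∫ q, (∫ p, ρ.normed volume p * V (q - p)) * dt ψ q =
      ∫ p, ρ.normed volume p * ∫ q, V (q - p) * dt ψ q := by
    simp_rw [← integral_mul_const, ← integral_const_mul]
    rw [integral_integral_swap iprod]
    simp only [mul_assoc]
  have havg : E - ω * N ≤ ∫ p, ρ.normed volume p * ∫ q, V (q - p) * dt ψ q := by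
    calc E - ω * N = ∫ p, ρ.normed volume p * (E - ω * N) := by
          rw [integral_mul_const, ρ.integral_normed, one_mul]
      _ ≤ _ := by
          refine integral_mono (hρi.mul_const _) ?_ fun p => ?_
          · refine iprod.integral_prod_right.congr (.of_forall fun p => ?_)
            simp only [mul_assoc]
            exact integral_const_mul _ _
          · by_cases hp : ‖p‖ < ε
            · exact mul_le_mul_of_nonneg_left (point p hp) (ρ.nonneg_normed p)
            · have : ρ.normed volume p = 0 := by
                rw [← Function.notMem_support, ρ.support_normed_eq]
                simp only [mem_ball_zero_iff, not_lt]
                exact hρ.trans (not_lt.1 hp)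
              simp [this]
  rw [testForm, fub]
  linarith

/-- Mollification in space-time. -/
def moll {E : Type*} [NormedAddCommGroup E] [NormedSpace ℝ E] (ρ : ContDiffBump (0 : ℝ × Ed d))
    (U : ℝ × Ed d → E) (q : ℝ × Ed d) : E := ∫ p, ρ.normed volume p • U (q - p)

theorem moll_eq_convolution (ρ : ContDiffBump (0 : ℝ × Ed d)) (V : ℝ × Ed d → ℝ) :
    moll ρ V = convolution (ρ.normed volume) V (ContinuousLinearMap.mul ℝ ℝ) volume := by
  ext q; simp [moll, convolution]

theorem contDiff_moll (ρ : ContDiffBump (0 : ℝ × Ed d)) {V : ℝ × Ed d → ℝ} (hV : Integrable V) :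
    ContDiff ℝ (⊤ : ℕ∞) (moll ρ V) := by
  rw [moll_eq_convolution]
  exact ρ.hasCompactSupport_normed.contDiff_convolution_left _ ρ.contDiff_normed
    hV.locallyIntegrable

theorem measurable_moll {E : Type*} [NormedAddCommGroup E] [NormedSpace ℝ E] [MeasurableSpace E]
    [BorelSpace E] [SecondCountableTopology E] (ρ : ContDiffBump (0 : ℝ × Ed d))
    {U : ℝ × Ed d → E} (hU : Measurable U) : Measurable (moll ρ U) := by
  have h1 : Measurable (ρ.normed volume : ℝ × Ed d → ℝ) :=
    (ρ.contDiff_normed (n := 0)).continuous.measurable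
  have h2 : StronglyMeasurable (Function.uncurry fun (q p : ℝ × Ed d) =>
      ρ.normed volume p • U (q - p)) := by
    apply Measurable.stronglyMeasurable
    exact (h1.comp measurable_snd).smul (hU.comp (measurable_fst.sub measurable_snd))
  exact (h2.integral_prod_right (ν := volume)).measurable

theorem eLpNorm_moll_sub_le {E : Type*} [NormedAddCommGroup E] [NormedSpace ℝ E]
    [MeasurableSpace E] [BorelSpace E] [SecondCountableTopology E] [CompleteSpace E]
    (ρ : ContDiffBump (0 : ℝ × Ed d))
    {U : ℝ × Ed d → E} (hU : Measurable U) (hUi : Integrable U) {ω : ℝ≥0∞}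
    (h : ∀ p : ℝ × Ed d, ‖p‖ < ρ.rOut → eLpNorm (fun q => U (q - p) - U q) 2 ≤ ω) :
    eLpNorm (moll ρ U - U) 2 ≤ ω := by
  have hρc : Continuous (ρ.normed volume : ℝ × Ed d → ℝ) :=
    (ρ.contDiff_normed (n := 0)).continuous
  have key := eLpNorm_average_sub_le (μ := volume) (ν := volume) (ρ := ρ.normed volume)
    (fun p => ρ.nonneg_normed p) hρc.measurable ρ.integrable_normed ρ.integral_normed
    (h := fun (p q : ℝ × Ed d) => U (q - p) - U q)
    ((hU.comp (measurable_snd.sub measurable_fst)).sub (hU.comp measurable_snd)) (ω := ω)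
    (fun p hp => h p (by
      have : p ∈ Function.support (ρ.normed volume : ℝ × Ed d → ℝ) := hp
      rwa [ρ.support_normed_eq, mem_ball_zero_iff] at this))
  convert key using 2
  ext1 q
  obtain ⟨M, hM⟩ := ρ.hasCompactSupport_normed (μ := volume) |>.exists_bound_of_continuous hρc
  simp only [smul_sub]
  rw [integral_sub, integral_smul_const, ρ.integral_normed, one_smul]
  · rfl
  · exact (hUi.comp_sub_left q).bdd_smul M hρc.aestronglyMeasurable (.of_forall hM)
  · exact ρ.integrable_normed.smul_const _

theorem exists_mollifier {V : ℝ × Ed d → ℝ} {W a : ℝ × Ed d → Ed d} {b : ℝ × Ed d × Ed d → ℝ}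
    {g : ℝ × Ed d → ℝ} (hV : MemLp V 2) (hW : MemLp W 2) (ha : MemLp a 2)
    (hb : MemLp b 2) (hg : MemLp g 2) {ω η : ℝ} (hω : 0 < ω) (hη : 0 < η) :
    ∃ ρ : ContDiffBump (0 : ℝ × Ed d), ρ.rOut < η ∧ ∀ p : ℝ × Ed d, ‖p‖ < ρ.rOut →
      eLpNorm (fun q => V (q - p) - V q) 2 ≤ ENNReal.ofReal ω ∧
      eLpNorm (fun q => W (q - p) - W q) 2 ≤ ENNReal.ofReal ω ∧
      eLpNorm (fun q => a (q - p) - a q) 2 ≤ ENNReal.ofReal ω ∧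
      eLpNorm (fun q => g (q - p) - g q) 2 ≤ ENNReal.ofReal ω ∧
      eLpNorm (fun q => b (q - tdiag p) - b q) 2 ≤ ENNReal.ofReal ω := by
  have hpos : (0 : ℝ≥0∞) < ENNReal.ofReal ω := ENNReal.ofReal_pos.2 hω
  have ht : Tendsto (tdiag : ℝ × Ed d → ℝ × Ed d × Ed d) (𝓝 0) (𝓝 0) :=
    continuous_tdiag.tendsto' 0 0 rfl
  have ev := ((tendsto_eLpNorm_translate hV).eventually_le_const hpos).and
    (((tendsto_eLpNorm_translate hW).eventually_le_const hpos).and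
    (((tendsto_eLpNorm_translate ha).eventually_le_const hpos).and
    (((tendsto_eLpNorm_translate hg).eventually_le_const hpos).and
    (((tendsto_eLpNorm_translate hb).comp ht).eventually_le_const hpos))))
  obtain ⟨ε, hε, h⟩ := Metric.eventually_nhds_iff.1 ev
  have hm : 0 < min ε η := lt_min hε hη
  refine ⟨⟨min ε η / 4, min ε η / 2, by positivity, by linarith⟩, ?_, fun p hp => ?_⟩
  · have := min_le_right ε η
    change min ε η / 2 < η
    linarith
  · change ‖p‖ < min ε η / 2 at hp
    have := min_le_left ε η
    exact h (y := p) (by rw [dist_zero_right]; linarith)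

theorem dx_moll (ρ : ContDiffBump (0 : ℝ × Ed d)) {V : ℝ × Ed d → ℝ} {W : ℝ × Ed d → Ed d}
    (hV : Integrable V) (hW : Integrable W) {O : Set (Ed d)}
    (hgrad : ∀ t, ∀ φ : Ed d → ℝ, ContDiff ℝ (⊤ : ℕ∞) φ → HasCompactSupport φ →
      tsupport φ ⊆ O → ∀ e : Ed d,
      ∫ x, V (t, x) * (fderiv ℝ φ x) e = - ∫ x, φ x * ⟪W (t, x), e⟫)
    {q : ℝ × Ed d} (hq : closedBall q.2 ρ.rOut ⊆ O) :
    dx (moll ρ V) q = innerSL ℝ (moll ρ W q) := by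
  set r : ℝ × Ed d → ℝ := ρ.normed volume with hr
  have hrs : ContDiff ℝ (⊤ : ℕ∞) r := ρ.contDiff_normed
  have hr1 : ContDiff ℝ 1 r := hrs.of_le (by exact_mod_cast le_top)
  have hrd : Differentiable ℝ r := hr1.differentiable one_ne_zero
  have hrc : HasCompactSupport r := ρ.hasCompactSupport_normed
  obtain ⟨M, hM⟩ := hrc.exists_bound_of_continuous hr1.continuous
  have hfc : Continuous fun p => fderiv ℝ r p := hr1.continuous_fderiv one_ne_zero
  obtain ⟨M', hM'⟩ := (hrc.fderiv ℝ).exists_bound_of_continuous hfc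
  have hder := hrc.hasFDerivAt_convolution_left (ContinuousLinearMap.mul ℝ ℝ) hr1
    hV.locallyIntegrable q
  rw [← moll_eq_convolution] at hder
  have hmd : Differentiable ℝ (moll ρ V) :=
    (contDiff_moll ρ hV).differentiable (by simp)
  ext e
  rw [dx_eq hmd, hder.fderiv, innerSL_apply_apply]
  have hInt : Integrable fun p => (ContinuousLinearMap.precompL (ℝ × Ed d)
      (ContinuousLinearMap.mul ℝ ℝ)) (fderiv ℝ r p) (V (q - p)) := by
    refine ((hV.comp_sub_left q).norm.const_mul M').mono' ?_ (.of_forall fun p => ?_)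
    · exact ContinuousLinearMap.aestronglyMeasurable_comp₂ _ hfc.aestronglyMeasurable
        (hV.comp_sub_left q).1
    · refine (ContinuousLinearMap.opNorm_le_bound _ (by positivity) fun w => ?_).trans
        (mul_le_mul_of_nonneg_right (hM' p) (norm_nonneg _))
      simp only [ContinuousLinearMap.precompL_apply, ContinuousLinearMap.mul_apply', norm_mul]
      have := (fderiv ℝ r p).le_opNorm w
      calc ‖fderiv ℝ r p w‖ * ‖V (q - p)‖ ≤ (‖fderiv ℝ r p‖ * ‖w‖) * ‖V (q - p)‖ := by gcongr
        _ = _ := by ring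
  have lhs : ((convolution (fderiv ℝ r) V (ContinuousLinearMap.precompL (ℝ × Ed d)
      (ContinuousLinearMap.mul ℝ ℝ)) volume q).comp (ContinuousLinearMap.inr ℝ ℝ (Ed d))) e =
      ∫ p, V p * fderiv ℝ r (q - p) (0, e) := by
    rw [← integral_sub_left_eq_self _ volume q]
    simp only [sub_sub_cancel, convolution]
    rw [ContinuousLinearMap.comp_apply, ContinuousLinearMap.integral_apply hInt]
    refine integral_congr_ae (.of_forall fun p => ?_)
    simp [mul_comm]
  have rhs : ⟪moll ρ W q, e⟫ = ∫ p, r (q - p) * ⟪W p, e⟫ := by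
    rw [← integral_sub_left_eq_self _ volume q]
    simp only [sub_sub_cancel, moll]
    rw [real_inner_comm, ← innerSL_apply_apply ℝ, ← ContinuousLinearMap.integral_comp_comm]
    · refine integral_congr_ae (.of_forall fun p => ?_)
      simp only [map_smul, innerSL_apply_apply, smul_eq_mul, real_inner_comm, hr]
    · exact (hW.comp_sub_left q).bdd_smul M hr1.continuous.aestronglyMeasurable
        (.of_forall hM)
  have i1 : Integrable fun p => V p * fderiv ℝ r (q - p) (0, e) := by
    refine hV.mul_bdd (c := M' * ‖((0 : ℝ), e)‖) ?_ (.of_forall fun p => ?_)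
    · exact ((hfc.comp (continuous_const.sub continuous_id)).clm_apply
        continuous_const).aestronglyMeasurable
    · exact ((fderiv ℝ r (q - p)).le_opNorm _).trans
        (mul_le_mul_of_nonneg_right (hM' _) (norm_nonneg _))
  have i2 : Integrable fun p => r (q - p) * ⟪W p, e⟫ := by
    refine (hW.inner_const e).bdd_mul (c := M) ?_ (.of_forall fun p => hM _)
    exact (hr1.continuous.comp (continuous_const.sub continuous_id)).aestronglyMeasurable
  rw [lhs, rhs, Measure.volume_eq_prod, integral_prod _ i1, integral_prod _ i2]
  refine integral_congr_ae (.of_forall fun τ => ?_)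
  have hφs : ContDiff ℝ (⊤ : ℕ∞) fun x : Ed d => r (q - (τ, x)) := hrs.comp (by fun_prop)
  have hsup : tsupport (fun x : Ed d => r (q - (τ, x))) ⊆ closedBall q.2 ρ.rOut := by
    refine closure_minimal (fun x hx => ?_) isClosed_closedBall
    have : q - (τ, x) ∈ Function.support r := hx
    rw [hr, ρ.support_normed_eq, mem_ball_zero_iff] at this
    rw [mem_closedBall, dist_comm, dist_eq_norm]
    exact (norm_snd_le (q - (τ, x))).trans this.le
  have := hgrad τ (fun x => r (q - (τ, x))) hφs
    ((isCompact_closedBall _ _).of_isClosed_subset (isClosed_tsupport _) hsup)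
    (hsup.trans hq) e
  have hfd : ∀ x : Ed d, fderiv ℝ (fun x : Ed d => r (q - (τ, x))) x e =
      - fderiv ℝ r (q - (τ, x)) (0, e) := by
    intro x
    have h1 : HasFDerivAt (fun x : Ed d => q - (τ, x)) (-ContinuousLinearMap.inr ℝ ℝ (Ed d)) x :=
      (hasFDerivAt_prodMk_right τ x).const_sub q
    have h2 := (hrd (q - (τ, x))).hasFDerivAt.comp (f := fun x : Ed d => q - (τ, x)) x h1
    have h3 : HasFDerivAt (fun x : Ed d => r (q - (τ, x))) _ x := h2
    rw [h3.fderiv]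
    simp
  simp only [hfd, mul_neg, integral_neg, neg_inj] at this
  exact this

/-- A smooth regularisation of the positive part. -/
def reg (δ a : ℝ) : ℝ := (a + √(a ^ 2 + δ ^ 2)) / 2

/-- The product of the regularised positive part and its derivative. -/
def regF (δ a : ℝ) : ℝ := reg δ a ^ 2 / √(a ^ 2 + δ ^ 2)

/-- The derivative of `regF`, expressed through `u = a / √(a² + δ²)`. -/
def regF' (δ a : ℝ) : ℝ :=
  (1 + a / √(a ^ 2 + δ ^ 2)) ^ 2 * (2 - a / √(a ^ 2 + δ ^ 2)) / 4

section reg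

variable {δ : ℝ}

theorem sqrt_sq_add_sq_pos (hδ : 0 < δ) (a : ℝ) : 0 < √(a ^ 2 + δ ^ 2) := by positivity

theorem abs_lt_sqrt_sq_add_sq (hδ : 0 < δ) (a : ℝ) : |a| < √(a ^ 2 + δ ^ 2) := by
  rw [← Real.sqrt_sq_eq_abs]
  exact Real.sqrt_lt_sqrt (sq_nonneg a) (by nlinarith)

theorem abs_div_sqrt_lt_one (hδ : 0 < δ) (a : ℝ) : |a / √(a ^ 2 + δ ^ 2)| < 1 := by
  rw [abs_div, abs_of_pos (sqrt_sq_add_sq_pos hδ a), div_lt_one (sqrt_sq_add_sq_pos hδ a)]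
  exact abs_lt_sqrt_sq_add_sq hδ a

theorem reg_pos (hδ : 0 < δ) (a : ℝ) : 0 < reg δ a := by
  have := (abs_lt.1 (abs_lt_sqrt_sq_add_sq hδ a)).1
  unfold reg; linarith

theorem regF_pos (hδ : 0 < δ) (a : ℝ) : 0 < regF δ a := by
  have := reg_pos hδ a
  have := sqrt_sq_add_sq_pos hδ a
  unfold regF; positivity

theorem regF_le_reg (hδ : 0 < δ) (a : ℝ) : regF δ a ≤ reg δ a := by
  have h := (abs_lt.1 (abs_lt_sqrt_sq_add_sq hδ a)).2
  have := reg_pos hδ a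
  rw [regF, div_le_iff₀ (sqrt_sq_add_sq_pos hδ a), sq]
  gcongr
  unfold reg; linarith

theorem le_reg (hδ : 0 < δ) (a : ℝ) : a ≤ reg δ a := by
  have h := (abs_lt.1 (abs_lt_sqrt_sq_add_sq hδ a)).2
  unfold reg; linarith

theorem regF'_pos (hδ : 0 < δ) (a : ℝ) : 0 < regF' δ a := by
  have h := abs_lt.1 (abs_div_sqrt_lt_one hδ a)
  have h1 : 0 < 1 + a / √(a ^ 2 + δ ^ 2) := by linarith
  have h2 : 0 < 2 - a / √(a ^ 2 + δ ^ 2) := by linarith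
  unfold regF'; positivity

theorem regF'_le_one (hδ : 0 < δ) (a : ℝ) : regF' δ a ≤ 1 := by
  have h := abs_lt.1 (abs_div_sqrt_lt_one hδ a)
  unfold regF'
  set u := a / √(a ^ 2 + δ ^ 2)
  nlinarith [mul_nonneg (sq_nonneg (1 - u)) (by linarith : 0 ≤ 2 + u)]

theorem reg_eq (hδ : 0 < δ) (a : ℝ) :
    reg δ a = √(a ^ 2 + δ ^ 2) * ((1 + a / √(a ^ 2 + δ ^ 2)) / 2) := by
  have := (sqrt_sq_add_sq_pos hδ a).ne'
  unfold reg; field_simp; ring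

theorem regF_eq (hδ : 0 < δ) (a : ℝ) :
    regF δ a = reg δ a * ((1 + a / √(a ^ 2 + δ ^ 2)) / 2) := by
  have := (sqrt_sq_add_sq_pos hδ a).ne'
  unfold regF reg; field_simp; ring

theorem regF_sq_le (hδ : 0 < δ) (a : ℝ) : regF δ a ^ 2 ≤ regF' δ a * reg δ a ^ 2 := by
  have h := abs_lt.1 (abs_div_sqrt_lt_one hδ a)
  rw [regF_eq hδ, mul_pow, mul_comm]
  refine mul_le_mul_of_nonneg_right ?_ (sq_nonneg _)
  unfold regF'
  set u := a / √(a ^ 2 + δ ^ 2)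
  nlinarith [sq_nonneg (1 + u)]

theorem hasDerivAt_sqrt_sq_add_sq (hδ : 0 < δ) (a : ℝ) :
    HasDerivAt (fun a => √(a ^ 2 + δ ^ 2)) (a / √(a ^ 2 + δ ^ 2)) a := by
  have h : HasDerivAt (fun a : ℝ => a ^ 2 + δ ^ 2) (2 * a) a := by
    simpa using (hasDerivAt_pow 2 a).add_const (δ ^ 2)
  convert h.sqrt (by positivity) using 1
  have := (sqrt_sq_add_sq_pos hδ a).ne'
  field_simp

theorem hasDerivAt_reg (hδ : 0 < δ) (a : ℝ) :
    HasDerivAt (reg δ) ((1 + a / √(a ^ 2 + δ ^ 2)) / 2) a :=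
  ((hasDerivAt_id a).add (hasDerivAt_sqrt_sq_add_sq hδ a)).div_const 2

theorem hasDerivAt_half_reg_sq (hδ : 0 < δ) (a : ℝ) :
    HasDerivAt (fun a => reg δ a ^ 2 / 2) (regF δ a) a := by
  refine (((hasDerivAt_reg hδ a).pow 2).div_const 2).congr_deriv ?_
  rw [regF_eq hδ]; simp; ring

theorem hasDerivAt_div_sqrt (hδ : 0 < δ) (a : ℝ) :
    HasDerivAt (fun a => a / √(a ^ 2 + δ ^ 2)) (δ ^ 2 / √(a ^ 2 + δ ^ 2) ^ 3) a := by
  have hS := sqrt_sq_add_sq_pos hδ a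
  refine ((hasDerivAt_id a).div (hasDerivAt_sqrt_sq_add_sq hδ a) hS.ne').congr_deriv ?_
  have h2 : √(a ^ 2 + δ ^ 2) ^ 2 = a ^ 2 + δ ^ 2 := Real.sq_sqrt (by positivity)
  simp only [id]
  have h3 : δ ^ 2 = √(a ^ 2 + δ ^ 2) ^ 2 - a ^ 2 := by rw [h2]; ring
  generalize √(a ^ 2 + δ ^ 2) = S at *
  rw [h3]
  field_simp

theorem hasDerivAt_regF (hδ : 0 < δ) (a : ℝ) : HasDerivAt (regF δ) (regF' δ a) a := by
  have h1 := (hasDerivAt_reg hδ a).mul (((hasDerivAt_div_sqrt hδ a).const_add 1).div_const 2)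
  have : regF δ = reg δ * fun a => (1 + a / √(a ^ 2 + δ ^ 2)) / 2 := funext fun a => regF_eq hδ a
  rw [this]
  refine h1.congr_deriv ?_
  have hS := sqrt_sq_add_sq_pos hδ a
  have h2 : √(a ^ 2 + δ ^ 2) ^ 2 = a ^ 2 + δ ^ 2 := Real.sq_sqrt (by positivity)
  have h3 : δ ^ 2 = √(a ^ 2 + δ ^ 2) ^ 2 - a ^ 2 := by rw [h2]; ring
  rw [regF', reg_eq hδ]
  generalize √(a ^ 2 + δ ^ 2) = S at *
  rw [h3]
  field_simp
  ring

theorem contDiff_reg (hδ : 0 < δ) {n : WithTop ℕ∞} : ContDiff ℝ n (reg δ) := by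
  unfold reg
  exact (contDiff_id.add (ContDiff.sqrt (by fun_prop) fun a => by positivity)).div_const 2

theorem contDiff_regF (hδ : 0 < δ) {n : WithTop ℕ∞} : ContDiff ℝ n (regF δ) := by
  unfold regF
  exact ((contDiff_reg hδ).pow 2).div (ContDiff.sqrt (by fun_prop) fun a => by positivity)
    fun a => (sqrt_sq_add_sq_pos hδ a).ne'

theorem regF'_monotone (hδ : 0 < δ) : Monotone (regF' δ) := by
  have hu : Monotone fun a : ℝ => a / √(a ^ 2 + δ ^ 2) := by
    refine monotone_of_hasDerivAt_nonneg (fun a => hasDerivAt_div_sqrt hδ a) fun a => ?_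
    have := sqrt_sq_add_sq_pos hδ a
    simp only [Pi.zero_apply]
    positivity
  intro a b hab
  have ha := abs_lt.1 (abs_div_sqrt_lt_one hδ a)
  have hb := abs_lt.1 (abs_div_sqrt_lt_one hδ b)
  have h := hu hab
  simp only at h
  unfold regF'
  generalize a / √(a ^ 2 + δ ^ 2) = x at *
  generalize b / √(b ^ 2 + δ ^ 2) = y at *
  have : 0 ≤ (y - x) * (3 - x ^ 2 - x * y - y ^ 2) := by
    refine mul_nonneg (by linarith) ?_
    nlinarith
  nlinarith

theorem regF_convex (hδ : 0 < δ) {a b : ℝ} (hab : b ≤ a) :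
    regF δ b + regF' δ b * (a - b) ≤ regF δ a := by
  rcases hab.eq_or_lt with rfl | hlt
  · simp
  obtain ⟨c, hc, h⟩ := exists_hasDerivAt_eq_slope (regF δ) (regF' δ) hlt
    (contDiff_regF hδ (n := 0)).continuous.continuousOn fun x _ => hasDerivAt_regF hδ x
  have h1 := regF'_monotone hδ hc.1.le
  rw [eq_div_iff (by linarith)] at h
  nlinarith [mul_le_mul_of_nonneg_right h1 (by linarith : 0 ≤ a - b)]

theorem neg_mul_regF_le (hδ : 0 < δ) (b : ℝ) : -b * regF δ b ≤ reg δ b ^ 2 := by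
  have hS := sqrt_sq_add_sq_pos hδ b
  have := (abs_lt.1 (abs_lt_sqrt_sq_add_sq hδ b)).1
  rw [regF, mul_div_assoc', div_le_iff₀ hS, mul_comm]
  exact mul_le_mul_of_nonneg_left (by linarith) (sq_nonneg _)

/-- The algebraic inequality behind the nonlocal Caccioppoli estimate. -/
theorem nonlocal_caccioppoli_le (hδ : 0 < δ) (a b : ℝ) {x y : ℝ} (hx : 0 ≤ x) (hy : 0 ≤ y) :
    -(3 * (reg δ a ^ 2 + reg δ b ^ 2) * (x - y) ^ 2) ≤
      (a - b) * (regF δ a * x ^ 2 - regF δ b * y ^ 2) := by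
  wlog hab : b ≤ a generalizing a b x y
  · have := this b a hy hx (le_of_not_ge hab)
    nlinarith
  have hF := regF_convex hδ hab
  have hFb := regF_pos hδ b
  have hF' := regF'_pos hδ b
  have h1 : (a - b) * regF δ b ≤ reg δ a * reg δ b + reg δ b ^ 2 := by
    have h2 := neg_mul_regF_le hδ b
    have h3 : a * regF δ b ≤ reg δ a * reg δ b :=
      mul_le_mul (le_reg hδ a) (regF_le_reg hδ b) hFb.le (reg_pos hδ a).le
    linarith
  have h4 : 2 * (a - b) * regF δ b * x * (y - x) ≤
      (a - b) ^ 2 * regF' δ b * x ^ 2 + reg δ b ^ 2 * (y - x) ^ 2 := by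
    have h5 := regF_sq_le hδ b
    have h6 : 2 * ((a - b) * x * regF' δ b) * (regF δ b * (y - x)) ≤
        ((a - b) * x * regF' δ b) ^ 2 + (regF δ b * (y - x)) ^ 2 := two_mul_le_add_sq _ _
    have h7 : (regF δ b * (y - x)) ^ 2 ≤ regF' δ b * reg δ b ^ 2 * (y - x) ^ 2 := by
      rw [mul_pow]; gcongr
    refine le_of_mul_le_mul_left ?_ hF'
    nlinarith
  have h8 : (a - b) * (regF' δ b * (a - b)) * x ^ 2 ≤ (a - b) * (regF δ a - regF δ b) * x ^ 2 := by
    have : 0 ≤ a - b := by linarith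
    gcongr
    linarith
  have h9 : (a - b) * regF δ b * (y - x) ^ 2 ≤
      (reg δ a * reg δ b + reg δ b ^ 2) * (y - x) ^ 2 := by gcongr
  have h10 : reg δ a * reg δ b ≤ reg δ a ^ 2 + reg δ b ^ 2 := by
    nlinarith [sq_nonneg (reg δ a - reg δ b), sq_nonneg (reg δ a), sq_nonneg (reg δ b)]
  have h11 : (reg δ a * reg δ b) * (y - x) ^ 2 ≤ (reg δ a ^ 2 + reg δ b ^ 2) * (y - x) ^ 2 := by
    gcongr
  have h12 : 0 ≤ reg δ a ^ 2 * (y - x) ^ 2 := by positivity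
  have h13 : 0 ≤ reg δ b ^ 2 * (y - x) ^ 2 := by positivity
  nlinarith

theorem abs_reg_sub_le (hδ : 0 < δ) (a b : ℝ) : |reg δ a - max b 0| ≤ |a - b| + δ := by
  have h1 : √(a ^ 2 + δ ^ 2) ≤ |a| + δ := by
    rw [Real.sqrt_le_left (by positivity)]
    nlinarith [sq_abs a, abs_nonneg a]
  have h2 := abs_lt_sqrt_sq_add_sq hδ a
  have h3 : |max a 0 - max b 0| ≤ |a - b| := abs_max_sub_max_le_abs a b 0
  have h4 : max a 0 = (a + |a|) / 2 := by
    rcases le_total 0 a with h | h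
    · rw [max_eq_left h, abs_of_nonneg h]; ring
    · rw [max_eq_right h, abs_of_nonpos h]; ring
  have h5 : |reg δ a - max a 0| ≤ δ := by
    rw [h4, reg, abs_le]; constructor <;> linarith
  calc |reg δ a - max b 0| = |(max a 0 - max b 0) + (reg δ a - max a 0)| := by ring_nf
    _ ≤ _ := (abs_add_le _ _).trans (by linarith)

theorem reg_sub_regF_le (hδ : 0 < δ) (a : ℝ) : reg δ a - regF δ a ≤ δ := by
  have hS := sqrt_sq_add_sq_pos hδ a
  have h2 : √(a ^ 2 + δ ^ 2) ^ 2 = a ^ 2 + δ ^ 2 := Real.sq_sqrt (by positivity)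
  have h3 : δ ≤ √(a ^ 2 + δ ^ 2) := Real.le_sqrt_of_sq_le (by nlinarith [sq_nonneg a])
  rw [regF, sub_le_iff_le_add, ← sub_le_iff_le_add', le_div_iff₀ hS, reg]
  generalize √(a ^ 2 + δ ^ 2) = S at *
  nlinarith

theorem abs_regF_sub_le (hδ : 0 < δ) (a b : ℝ) : |regF δ a - max b 0| ≤ |a - b| + 2 * δ := by
  have h1 := abs_le.1 (abs_reg_sub_le hδ a b)
  have h2 := reg_sub_regF_le hδ a
  have h3 := regF_le_reg hδ a
  rw [abs_le]; constructor <;> linarith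

end reg

theorem isClosedEmbedding_prodMk_left {X Y : Type*} [TopologicalSpace X] [TopologicalSpace Y]
    [T1Space Y] (y : Y) : Topology.IsClosedEmbedding fun x : X => (x, y) := by
  refine ⟨isEmbedding_prodMkLeft y, ?_⟩
  have : range (fun x : X => (x, y)) = Prod.snd ⁻¹' {y} := by
    ext ⟨a, b⟩; simp [eq_comm]
  rw [this]
  exact isClosed_singleton.preimage continuous_snd

/-- The energy test function. -/
def enTest (δ : ℝ) (v : ℝ × Ed d → ℝ) (ζ : Ed d → ℝ) (Θ : ℝ → ℝ) (q : ℝ × Ed d) : ℝ :=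
  regF δ (v q) * ζ q.2 ^ 2 * Θ q.1

section enTest

variable {δ : ℝ} {v : ℝ × Ed d → ℝ} {ζ : Ed d → ℝ} {Θ : ℝ → ℝ}

theorem contDiff_enTest (hδ : 0 < δ) (hv : ContDiff ℝ (⊤ : ℕ∞) v) (hζ : ContDiff ℝ (⊤ : ℕ∞) ζ)
    (hΘ : ContDiff ℝ (⊤ : ℕ∞) Θ) : ContDiff ℝ (⊤ : ℕ∞) (enTest δ v ζ Θ) := by
  unfold enTest
  exact (((contDiff_regF hδ).comp hv).mul ((hζ.comp contDiff_snd).pow 2)).mul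
    (hΘ.comp contDiff_fst)

theorem tsupport_mul_prod_subset {f : ℝ × Ed d → ℝ}
    (hf : ∀ q, Θ q.1 = 0 ∨ ζ q.2 = 0 → f q = 0) :
    tsupport f ⊆ tsupport Θ ×ˢ tsupport ζ := by
  refine closure_minimal (fun q hq => ?_) ((isClosed_tsupport _).prod (isClosed_tsupport _))
  refine ⟨subset_tsupport _ fun h => hq (hf q (Or.inl h)),
    subset_tsupport _ fun h => hq (hf q (Or.inr h))⟩

theorem tsupport_enTest_subset : tsupport (enTest δ v ζ Θ) ⊆ tsupport Θ ×ˢ tsupport ζ :=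
  tsupport_mul_prod_subset fun q h => by rcases h with h | h <;> simp [enTest, h]

theorem hasCompactSupport_of_prod {f : ℝ × Ed d → ℝ} (hζ : HasCompactSupport ζ)
    (hΘ : HasCompactSupport Θ) (hf : tsupport f ⊆ tsupport Θ ×ˢ tsupport ζ) :
    HasCompactSupport f :=
  (hΘ.isCompact.prod hζ.isCompact).of_isClosed_subset (isClosed_tsupport _) hf

theorem integral_dt_eq_zero {h : ℝ × Ed d → ℝ} (hh : ContDiff ℝ 1 h) (hc : HasCompactSupport h) :
    ∫ q, dt h q = 0 := by
  have hd := hh.differentiable one_ne_zero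
  have hi : Integrable (dt h) (volume.prod volume) :=
    (continuous_dt hh).integrable_of_hasCompactSupport (hasCompactSupport_dt hd hc)
  rw [Measure.volume_eq_prod, integral_prod_symm _ hi]
  refine integral_eq_zero_of_ae (.of_forall fun x => ?_)
  have hcx : HasCompactSupport fun t : ℝ => h (t, x) :=
    hc.comp_isClosedEmbedding (isClosedEmbedding_prodMk_left x)
  have hx : ContDiff ℝ 1 fun t : ℝ => h (t, x) := hh.comp (by fun_prop)
  refine integral_eq_zero_of_hasDerivAt_of_integrable (f := fun t => h (t, x))
    (fun t => ?_) ?_ (hx.continuous.integrable_of_hasCompactSupport hcx)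
  · have := hasDerivAt_dt hd (t, x)
    rw [← dt_eq hd] at this
    exact this
  · exact ((continuous_dt hh).comp (by fun_prop : Continuous fun t : ℝ => (t, x))
      ).integrable_of_hasCompactSupport
      ((hasCompactSupport_dt hd hc).comp_isClosedEmbedding (isClosedEmbedding_prodMk_left x))

theorem integral_mul_dt_enTest (hδ : 0 < δ) (hv : ContDiff ℝ (⊤ : ℕ∞) v)
    (hζ : ContDiff ℝ (⊤ : ℕ∞) ζ) (hΘ : ContDiff ℝ (⊤ : ℕ∞) Θ) (hζc : HasCompactSupport ζ)
    (hΘc : HasCompactSupport Θ) :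
    ∫ q, v q * dt (enTest δ v ζ Θ) q = ∫ q, reg δ (v q) ^ 2 / 2 * ζ q.2 ^ 2 * deriv Θ q.1 := by
  set h : ℝ × Ed d → ℝ := fun q =>
    (v q * regF δ (v q) - reg δ (v q) ^ 2 / 2) * ζ q.2 ^ 2 * Θ q.1 with hh
  have hhs : ContDiff ℝ (⊤ : ℕ∞) h :=
    (((hv.mul ((contDiff_regF hδ).comp hv)).sub ((((contDiff_reg hδ).comp hv).pow 2).div_const 2)
      ).mul ((hζ.comp contDiff_snd).pow 2)).mul (hΘ.comp contDiff_fst)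
  have hhc : HasCompactSupport h := hasCompactSupport_of_prod hζc hΘc
    (tsupport_mul_prod_subset fun q h' => by rcases h' with h' | h' <;> simp [hh, h'])
  have h0 := integral_dt_eq_zero (hhs.of_le (by exact_mod_cast le_top)) hhc
  have hvd : Differentiable ℝ v := hv.differentiable (by simp)
  have hψs := contDiff_enTest hδ hv hζ hΘ
  have hψ1 : ContDiff ℝ 1 (enTest δ v ζ Θ) := hψs.of_le (by exact_mod_cast le_top)
  have hψc : HasCompactSupport (enTest δ v ζ Θ) :=
    hasCompactSupport_of_prod hζc hΘc tsupport_enTest_subset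
  have hΘ1 : Continuous (deriv Θ) := hΘ.continuous_deriv (by exact_mod_cast le_top)
  have key : ∀ q, dt h q = v q * dt (enTest δ v ζ Θ) q -
      reg δ (v q) ^ 2 / 2 * ζ q.2 ^ 2 * deriv Θ q.1 := by
    intro q
    have e1 := hasDerivAt_dt hvd q
    have eΘ : HasDerivAt Θ (deriv Θ q.1) q.1 := (hΘ.differentiable (by simp) q.1).hasDerivAt
    have e2 : HasDerivAt (fun τ => regF δ (v (τ, q.2))) _ q.1 :=
      HasDerivAt.comp (h₂ := regF δ) q.1 (hasDerivAt_regF hδ (v q)) e1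
    have e3 : HasDerivAt (fun τ => reg δ (v (τ, q.2)) ^ 2 / 2) _ q.1 :=
      HasDerivAt.comp (h₂ := fun a => reg δ a ^ 2 / 2) q.1 (hasDerivAt_half_reg_sq hδ (v q)) e1
    have e4 : HasDerivAt (fun τ => h (τ, q.2)) _ q.1 :=
      (((e1.mul e2).sub e3).mul_const (ζ q.2 ^ 2)).mul eΘ
    have e5 : HasDerivAt (fun τ => enTest δ v ζ Θ (τ, q.2)) _ q.1 :=
      (e2.mul_const (ζ q.2 ^ 2)).mul eΘ
    rw [dt, e4.deriv, dt, e5.deriv]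
    simp only [Pi.sub_apply, Pi.mul_apply, Prod.mk.eta]
    ring
  have i1 : Integrable fun q => v q * dt (enTest δ v ζ Θ) q :=
    (hv.continuous.mul (continuous_dt hψ1)).integrable_of_hasCompactSupport
      (hasCompactSupport_dt (hψ1.differentiable one_ne_zero) hψc).mul_left
  have i2 : Integrable fun q => reg δ (v q) ^ 2 / 2 * ζ q.2 ^ 2 * deriv Θ q.1 := by
    refine Continuous.integrable_of_hasCompactSupport ?_ ?_
    · have h1 : Continuous fun q => reg δ (v q) :=
        (contDiff_reg hδ (n := 0)).continuous.comp hv.continuous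
      have h2 : Continuous fun q : ℝ × Ed d => ζ q.2 := hζ.continuous.comp continuous_snd
      have h3 : Continuous fun q : ℝ × Ed d => deriv Θ q.1 := hΘ1.comp continuous_fst
      fun_prop
    · refine (hΘc.isCompact.prod hζc.isCompact).of_isClosed_subset (isClosed_tsupport _) ?_
      refine closure_minimal (fun q hq => ?_) ((isClosed_tsupport _).prod (isClosed_tsupport _))
      refine ⟨?_, subset_tsupport _ fun h => hq (by simp [h])⟩
      exact support_deriv_subset fun h => hq (by simp [h])
  rw [integral_congr_ae (.of_forall key), integral_sub i1 i2] at h0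
  linarith

theorem dx_enTest (hδ : 0 < δ) (hv : Differentiable ℝ v) (hζ : Differentiable ℝ ζ)
    (q : ℝ × Ed d) :
    dx (enTest δ v ζ Θ) q = (regF' δ (v q) * ζ q.2 ^ 2 * Θ q.1) • dx v q +
      (2 * regF δ (v q) * ζ q.2 * Θ q.1) • fderiv ℝ ζ q.2 := by
  have e1 := hasFDerivAt_dx hv q
  rw [← dx_eq hv] at e1
  have eζ := (hζ q.2).hasFDerivAt
  have e2 : HasFDerivAt (fun x => regF δ (v (q.1, x))) (regF' δ (v q) • dx v q) q.2 :=
    HasDerivAt.comp_hasFDerivAt (h₂ := regF δ) q.2 (hasDerivAt_regF hδ (v q)) e1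
  have e3 : HasFDerivAt (fun x => enTest δ v ζ Θ (q.1, x)) _ q.2 :=
    (e2.mul (eζ.pow 2)).mul_const (Θ q.1)
  rw [dx, e3.fderiv]
  ext e
  simp
  ring

theorem le_dx_enTest_apply (hδ : 0 < δ) (hv : Differentiable ℝ v) (hζ : Differentiable ℝ ζ)
    {q : ℝ × Ed d} {D W a : Ed d} {Λ L : ℝ} (hΛ : 1 ≤ Λ) (hD : dx v q = innerSL ℝ D)
    (ha : ‖a‖ ≤ Λ * ‖W‖) (haW : Λ⁻¹ * ‖W‖ ^ 2 ≤ ⟪a, W⟫) (hζ0 : 0 ≤ ζ q.2) (hζ1 : ζ q.2 ≤ 1)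
    (hL : ‖fderiv ℝ ζ q.2‖ ≤ L) (hΘ : 0 ≤ Θ q.1) :
    -(Λ ^ 3 * L ^ 2 * (reg δ (v q) ^ 2 * Θ q.1)) - Θ q.1 * (‖a‖ * ‖D - W‖) ≤
      dx (enTest δ v ζ Θ) q a := by
  rw [dx_enTest hδ hv hζ, hD]
  simp only [_root_.add_apply, _root_.smul_apply, innerSL_apply_apply, smul_eq_mul]
  have hF := regF_pos hδ (v q)
  have hF' := regF'_pos hδ (v q)
  have hF1 := regF'_le_one hδ (v q)
  have hFF := regF_sq_le hδ (v q)
  have hr := reg_pos hδ (v q)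
  generalize regF δ (v q) = F at *
  generalize regF' δ (v q) = F' at *
  generalize reg δ (v q) = f at *
  generalize ζ q.2 = z at *
  generalize Θ q.1 = θ at *
  have hΛ0 : 0 < Λ := by linarith
  have hL0 : 0 ≤ L := (norm_nonneg _).trans hL
  have h1 : ⟪D, a⟫ ≥ Λ⁻¹ * ‖W‖ ^ 2 - ‖a‖ * ‖D - W‖ := by
    have e : ⟪D, a⟫ = ⟪a, W⟫ + ⟪D - W, a⟫ := by
      rw [inner_sub_left, real_inner_comm a W]; ring
    have := (abs_le.1 (abs_real_inner_le_norm (D - W) a)).1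
    rw [e]; nlinarith
  have h2 : fderiv ℝ ζ q.2 a ≥ -(L * (Λ * ‖W‖)) := by
    have h := (fderiv ℝ ζ q.2).le_opNorm a
    have h' : ‖fderiv ℝ ζ q.2‖ * ‖a‖ ≤ L * (Λ * ‖W‖) := by gcongr
    have := (abs_le.1 ((Real.norm_eq_abs _ ▸ h).trans h')).1
    linarith
  have h3 : F' * z ^ 2 * θ * (Λ⁻¹ * ‖W‖ ^ 2 - ‖a‖ * ‖D - W‖) ≤ F' * z ^ 2 * θ * ⟪D, a⟫ := by
    gcongr
  have h4 : 2 * F * z * θ * (-(L * (Λ * ‖W‖))) ≤ 2 * F * z * θ * fderiv ℝ ζ q.2 a := by gcongr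
  have h5 : F' * z ^ 2 * (‖a‖ * ‖D - W‖) ≤ ‖a‖ * ‖D - W‖ := by
    have : F' * z ^ 2 ≤ 1 * 1 ^ 2 := by gcongr
    have h6 : 0 ≤ ‖a‖ * ‖D - W‖ := by positivity
    nlinarith
  have h7 : 2 * F * z * (L * (Λ * ‖W‖)) ≤ F' * z ^ 2 * (Λ⁻¹ * ‖W‖ ^ 2) + Λ ^ 3 * L ^ 2 * f ^ 2 := by
    have h8 : F * F ≤ F' * f ^ 2 := by nlinarith
    have h9 : 2 * (F' * z * ‖W‖) * (F * Λ ^ 2 * L) ≤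
        (F' * z * ‖W‖) ^ 2 + (F * Λ ^ 2 * L) ^ 2 := two_mul_le_add_sq _ _
    have h10 : (F * Λ ^ 2 * L) ^ 2 ≤ F' * f ^ 2 * (Λ ^ 4 * L ^ 2) := by
      have : (F * Λ ^ 2 * L) ^ 2 = F * F * (Λ ^ 4 * L ^ 2) := by ring
      rw [this]; gcongr
    have h11 : F' * Λ * (2 * F * z * (L * (Λ * ‖W‖))) ≤
        F' * Λ * (F' * z ^ 2 * (Λ⁻¹ * ‖W‖ ^ 2) + Λ ^ 3 * L ^ 2 * f ^ 2) := by
      have : F' * Λ * (F' * z ^ 2 * (Λ⁻¹ * ‖W‖ ^ 2) + Λ ^ 3 * L ^ 2 * f ^ 2) =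
          (F' * z * ‖W‖) ^ 2 + F' * f ^ 2 * (Λ ^ 4 * L ^ 2) := by field_simp
      rw [this]
      nlinarith
    exact le_of_mul_le_mul_left h11 (by positivity)
  have h12 := mul_le_mul_of_nonneg_left h5 hΘ
  have h13 := mul_le_mul_of_nonneg_left h7 hΘ
  linear_combination h3 + h4 + h12 + h13

theorem le_gag_mul_gag_enTest (hδ : 0 < δ) {s L : ℝ} {q : ℝ × Ed d × Ed d}
    (hζ0 : ∀ x, 0 ≤ ζ x) (hL : ∀ x y, |ζ x - ζ y| ≤ L * ‖x - y‖) (hΘ : 0 ≤ Θ q.1) :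
    -(3 * L ^ 2 * ((reg δ (v (q.1, q.2.1)) ^ 2 * Θ q.1 + reg δ (v (q.1, q.2.2)) ^ 2 * Θ q.1) *
      (‖q.2.1 - q.2.2‖ ^ 2 * jumpKer s (q.2.1 - q.2.2)))) ≤
      gag s v q * gag s (enTest δ v ζ Θ) q := by
  have hk := jumpKer_nonneg s (q.2.1 - q.2.2)
  have hkk : √(jumpKer s (q.2.1 - q.2.2)) * √(jumpKer s (q.2.1 - q.2.2)) =
      jumpKer s (q.2.1 - q.2.2) := Real.mul_self_sqrt hk
  have e : gag s v q * gag s (enTest δ v ζ Θ) q =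
      (v (q.1, q.2.1) - v (q.1, q.2.2)) * (regF δ (v (q.1, q.2.1)) * ζ q.2.1 ^ 2 -
        regF δ (v (q.1, q.2.2)) * ζ q.2.2 ^ 2) * (Θ q.1 * jumpKer s (q.2.1 - q.2.2)) := by
    simp only [gag, enTest]
    linear_combination (v (q.1, q.2.1) - v (q.1, q.2.2)) * (regF δ (v (q.1, q.2.1)) * ζ q.2.1 ^ 2 -
        regF δ (v (q.1, q.2.2)) * ζ q.2.2 ^ 2) * Θ q.1 * hkk
  have h1 := nonlocal_caccioppoli_le hδ (v (q.1, q.2.1)) (v (q.1, q.2.2)) (hζ0 q.2.1) (hζ0 q.2.2)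
  have h2 : (ζ q.2.1 - ζ q.2.2) ^ 2 ≤ L ^ 2 * ‖q.2.1 - q.2.2‖ ^ 2 := by
    rw [← mul_pow, ← sq_abs (ζ q.2.1 - ζ q.2.2)]
    gcongr; exact hL _ _
  rw [e]
  refine le_trans ?_ (mul_le_mul_of_nonneg_right h1 (mul_nonneg hΘ hk))
  have h3 := mul_le_mul_of_nonneg_left h2 (by positivity :
    0 ≤ 3 * (reg δ (v (q.1, q.2.1)) ^ 2 + reg δ (v (q.1, q.2.2)) ^ 2))
  have h4 := mul_le_mul_of_nonneg_right h3 (mul_nonneg hΘ hk)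
  linear_combination h4

end enTest

theorem lintegral_kernel_ball_le {k : Ed d → ℝ≥0∞} (x₀ x : Ed d) (R : ℝ)
    (hx : x ∈ ball x₀ R) : ∫⁻ y in ball x₀ R, k (x - y) ≤ ∫⁻ z in ball 0 (2 * R), k z := by
  rw [← lintegral_indicator measurableSet_ball, ← lintegral_indicator measurableSet_ball,
    ← lintegral_sub_left_eq_self (fun z => (ball (0 : Ed d) (2 * R)).indicator k z) x]
  refine lintegral_mono fun y => ?_
  by_cases hy : y ∈ ball x₀ R
  · have : x - y ∈ ball (0 : Ed d) (2 * R) := by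
      rw [mem_ball_zero_iff, ← dist_eq_norm]
      have := dist_triangle_right x y x₀
      rw [mem_ball] at hx hy; linarith
    simp [hy, this]
  · simp [hy]

theorem volume_restrict_prod_two {X Y : Type*} [MeasureSpace X] [MeasureSpace Y]
    [SFinite (volume : Measure X)] [SFinite (volume : Measure Y)] (I : Set X) (B : Set Y) :
    (volume : Measure (X × Y)).restrict (I ×ˢ B) = (volume.restrict I).prod (volume.restrict B) :=
  (Measure.prod_restrict I B).symm

theorem lintegral_mul_kernel_le {F : ℝ × Ed d → ℝ≥0∞} (hF : Measurable F) {k : Ed d → ℝ≥0∞}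
    (hk : Measurable k) (I : Set ℝ) (x₀ : Ed d) (R : ℝ) :
    ∫⁻ q in I ×ˢ ball x₀ R ×ˢ ball x₀ R, F (q.1, q.2.1) * k (q.2.1 - q.2.2) ≤
      (∫⁻ z in ball 0 (2 * R), k z) * ∫⁻ q in I ×ˢ ball x₀ R, F q := by
  rw [volume_restrict_prod_two I (ball x₀ R ×ˢ ball x₀ R), lintegral_prod _ (by fun_prop),
    volume_restrict_prod_two I (ball x₀ R), lintegral_prod _ (by fun_prop),
    ← lintegral_const_mul _ (by fun_prop)]
  refine lintegral_mono fun t => ?_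
  simp only
  rw [volume_restrict_prod_two, lintegral_prod _ (by fun_prop),
    ← lintegral_const_mul _ (by fun_prop)]
  refine setLIntegral_mono' measurableSet_ball fun x hx => ?_
  simp only
  rw [lintegral_const_mul _ (by fun_prop), mul_comm]
  refine mul_le_mul' ?_ le_rfl
  exact lintegral_kernel_ball_le x₀ x R hx

theorem lintegral_mul_kernel_le' {F : ℝ × Ed d → ℝ≥0∞} (hF : Measurable F) {k : Ed d → ℝ≥0∞}
    (hk : Measurable k) (hkn : ∀ z, k (-z) = k z) (I : Set ℝ) (x₀ : Ed d) (R : ℝ) :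
    ∫⁻ q in I ×ˢ ball x₀ R ×ˢ ball x₀ R, F (q.1, q.2.2) * k (q.2.1 - q.2.2) ≤
      (∫⁻ z in ball 0 (2 * R), k z) * ∫⁻ q in I ×ˢ ball x₀ R, F q := by
  rw [volume_restrict_prod_two I (ball x₀ R ×ˢ ball x₀ R), lintegral_prod _ (by fun_prop),
    volume_restrict_prod_two I (ball x₀ R), lintegral_prod _ (by fun_prop),
    ← lintegral_const_mul _ (by fun_prop)]
  refine lintegral_mono fun t => ?_
  simp only
  rw [volume_restrict_prod_two, lintegral_prod_symm _ (by fun_prop),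
    ← lintegral_const_mul _ (by fun_prop)]
  refine setLIntegral_mono' measurableSet_ball fun x hx => ?_
  simp only
  rw [lintegral_const_mul _ (by fun_prop), mul_comm]
  refine mul_le_mul' ?_ le_rfl
  refine le_of_eq_of_le ?_ (lintegral_kernel_ball_le (k := k) x₀ x R hx)
  congr with y
  rw [← hkn, neg_sub]

theorem integrableOn_mul_kernel {s c : ℝ} (hc : 0 ≤ c) {f : ℝ × Ed d → ℝ} (hf : Measurable f)
    (hf0 : ∀ q, 0 ≤ f q) {I : Set ℝ} {x₀ : Ed d} {R : ℝ}
    (hfi : IntegrableOn f (I ×ˢ ball x₀ R))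
    (hk : ∫⁻ z in ball (0 : Ed d) (2 * R), ENNReal.ofReal (‖z‖ ^ 2 * jumpKer s z) ≤
      ENNReal.ofReal c) :
    IntegrableOn (fun q => (f (q.1, q.2.1) + f (q.1, q.2.2)) *
        (‖q.2.1 - q.2.2‖ ^ 2 * jumpKer s (q.2.1 - q.2.2))) (I ×ˢ ball x₀ R ×ˢ ball x₀ R) ∧
      ∫ q in I ×ˢ ball x₀ R ×ˢ ball x₀ R, (f (q.1, q.2.1) + f (q.1, q.2.2)) *
        (‖q.2.1 - q.2.2‖ ^ 2 * jumpKer s (q.2.1 - q.2.2)) ≤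
      2 * c * ∫ q in I ×ˢ ball x₀ R, f q := by
  have hjm := measurable_jumpKer (d := d) s
  have hkm : Measurable fun z : Ed d => ENNReal.ofReal (‖z‖ ^ 2 * jumpKer s z) := by fun_prop
  have hFm : Measurable fun q => ENNReal.ofReal (f q) := by fun_prop
  have hkn : ∀ z : Ed d, ENNReal.ofReal (‖-z‖ ^ 2 * jumpKer s (-z)) =
      ENNReal.ofReal (‖z‖ ^ 2 * jumpKer s z) := fun z => by rw [norm_neg, jumpKer_neg]
  have hfI : ∫⁻ q in I ×ˢ ball x₀ R, ENNReal.ofReal (f q) =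
      ENNReal.ofReal (∫ q in I ×ˢ ball x₀ R, f q) :=
    (ofReal_integral_eq_lintegral_ofReal hfi (.of_forall hf0)).symm
  have hint0 : 0 ≤ ∫ q in I ×ˢ ball x₀ R, f q := integral_nonneg hf0
  have hm : Measurable fun q : ℝ × Ed d × Ed d => (f (q.1, q.2.1) + f (q.1, q.2.2)) *
        (‖q.2.1 - q.2.2‖ ^ 2 * jumpKer s (q.2.1 - q.2.2)) := by fun_prop
  have h0 : ∀ q : ℝ × Ed d × Ed d, 0 ≤ (f (q.1, q.2.1) + f (q.1, q.2.2)) *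
        (‖q.2.1 - q.2.2‖ ^ 2 * jumpKer s (q.2.1 - q.2.2)) := fun q =>
    mul_nonneg (add_nonneg (hf0 _) (hf0 _)) (mul_nonneg (by positivity) (jumpKer_nonneg _ _))
  have hl : ∫⁻ q in I ×ˢ ball x₀ R ×ˢ ball x₀ R, ENNReal.ofReal ((f (q.1, q.2.1) +
      f (q.1, q.2.2)) * (‖q.2.1 - q.2.2‖ ^ 2 * jumpKer s (q.2.1 - q.2.2))) ≤
      ENNReal.ofReal (2 * c * ∫ q in I ×ˢ ball x₀ R, f q) := by
    calc _ = ∫⁻ q in I ×ˢ ball x₀ R ×ˢ ball x₀ R,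
          (ENNReal.ofReal (f (q.1, q.2.1)) *
            ENNReal.ofReal (‖q.2.1 - q.2.2‖ ^ 2 * jumpKer s (q.2.1 - q.2.2)) +
          ENNReal.ofReal (f (q.1, q.2.2)) *
            ENNReal.ofReal (‖q.2.1 - q.2.2‖ ^ 2 * jumpKer s (q.2.1 - q.2.2))) := by
          congr with q
          rw [ENNReal.ofReal_mul (add_nonneg (hf0 _) (hf0 _)),
            ENNReal.ofReal_add (hf0 _) (hf0 _), add_mul]
      _ ≤ ENNReal.ofReal c * ENNReal.ofReal (∫ q in I ×ˢ ball x₀ R, f q) +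
          ENNReal.ofReal c * ENNReal.ofReal (∫ q in I ×ˢ ball x₀ R, f q) := by
          rw [lintegral_add_left (by fun_prop), ← hfI]
          refine add_le_add ?_ ?_
          · exact (lintegral_mul_kernel_le hFm hkm I x₀ R).trans (by gcongr)
          · exact (lintegral_mul_kernel_le' hFm hkm hkn I x₀ R).trans (by gcongr)
      _ = _ := by
          rw [← ENNReal.ofReal_mul hc, ← ENNReal.ofReal_add (by positivity) (by positivity)]
          congr 1; ring
  refine ⟨⟨hm.aestronglyMeasurable, ?_⟩, ?_⟩
  · rw [hasFiniteIntegral_iff_ofReal (.of_forall h0)]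
    exact hl.trans_lt ENNReal.ofReal_lt_top
  · rw [integral_eq_lintegral_of_nonneg_ae (.of_forall h0) hm.aestronglyMeasurable]
    exact ENNReal.toReal_le_of_le_ofReal (by positivity) hl

/-- Smooth space and time cutoffs with quantitative bounds. -/
structure IsCutoff (I : Set ℝ) (x₀ : Ed d) (r L M : ℝ) (ζ : Ed d → ℝ) (Θ : ℝ → ℝ) : Prop where
  smooth_x : ContDiff ℝ (⊤ : ℕ∞) ζ
  smooth_t : ContDiff ℝ (⊤ : ℕ∞) Θ
  compact_x : HasCompactSupport ζ
  compact_t : HasCompactSupport Θ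
  tsupport_x : tsupport ζ ⊆ ball x₀ r
  tsupport_t : tsupport Θ ⊆ I
  nonneg_x : ∀ x, 0 ≤ ζ x
  le_one_x : ∀ x, ζ x ≤ 1
  fderiv_le : ∀ x, ‖fderiv ℝ ζ x‖ ≤ L
  nonneg_t : ∀ t, 0 ≤ Θ t
  le_t : ∀ t, Θ t ≤ M

theorem IsCutoff.lipschitz {I : Set ℝ} {x₀ : Ed d} {r L M : ℝ} {ζ : Ed d → ℝ} {Θ : ℝ → ℝ}
    (h : IsCutoff I x₀ r L M ζ Θ) (x y : Ed d) : |ζ x - ζ y| ≤ L * ‖x - y‖ :=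
  convex_univ.norm_image_sub_le_of_norm_fderiv_le (𝕜 := ℝ)
    (fun z _ => h.smooth_x.differentiable (by simp) z) (fun z _ => h.fderiv_le z)
    (mem_univ y) (mem_univ x)

/-- Compatibility conditions relating a function, its weak gradient, the flux and the
renormalised jump density on a cylinder. -/
structure IsEnergyData (s Λ : ℝ) (I : Set ℝ) (x₀ : Ed d) (R : ℝ) (V : ℝ × Ed d → ℝ)
    (W a : ℝ × Ed d → Ed d) (b : ℝ × Ed d × Ed d → ℝ) : Prop where
  measV : Measurable V
  measW : Measurable W
  intV : Integrable V
  intW : Integrable W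
  memV : MemLp V 2
  memW : MemLp W 2
  mema : MemLp a 2
  memb : MemLp b 2
  growth : ∀ q ∈ I ×ˢ ball x₀ R, ‖a q‖ ≤ Λ * ‖W q‖
  coercive : ∀ q ∈ I ×ˢ ball x₀ R, Λ⁻¹ * ‖W q‖ ^ 2 ≤ ⟪a q, W q⟫
  a_zero : ∀ q ∉ I ×ˢ ball x₀ R, a q = 0
  b_eq : ∀ q ∈ I ×ˢ ball x₀ R ×ˢ ball x₀ R, ∃ k, 0 ≤ k ∧ k ≤ Λ ∧ b q = k * gag s V q
  b_zero : ∀ q ∉ I ×ˢ ball x₀ R ×ˢ ball x₀ R, b q = 0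
  grad : ∀ t, ∀ φ : Ed d → ℝ, ContDiff ℝ (⊤ : ℕ∞) φ → HasCompactSupport φ →
    tsupport φ ⊆ ball x₀ (2 * R) → ∀ e : Ed d,
      ∫ x, V (t, x) * (fderiv ℝ φ x) e = -∫ x, φ x * ⟪W (t, x), e⟫

section energyStep

variable {s Λ : ℝ} {I : Set ℝ} {x₀ : Ed d} {R r L M δ : ℝ} {V v : ℝ × Ed d → ℝ}
  {W D a : ℝ × Ed d → Ed d} {b : ℝ × Ed d × Ed d → ℝ} {ζ : Ed d → ℝ} {Θ : ℝ → ℝ}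

theorem integrable_dx_apply {ψ : ℝ × Ed d → ℝ} (hψ : MemLp (dx ψ) 2) {c : ℝ × Ed d → Ed d}
    (hc : MemLp c 2) : Integrable fun q => dx ψ q (c q) := by
  refine (integrable_mul_of_memLp hψ.norm hc.norm).mono' ?_ (.of_forall fun q => ?_)
  · exact (ContinuousLinearMap.apply ℝ ℝ |>.flip |>.aestronglyMeasurable_comp₂ hψ.1 hc.1)
  · exact (dx ψ q).le_opNorm _

theorem eLpNorm_gag_ball_le (s : ℝ) {ψ : ℝ × Ed d → ℝ} (hψ : ContDiff ℝ 1 ψ) (x₀ : Ed d) (r : ℝ) :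
    eLpNorm (gag s ψ) 2 (volume.restrict (univ ×ˢ ball x₀ r ×ˢ ball x₀ r)) ≤
      gagConst d s r * eLpNorm (dx ψ) 2 := by
  have h := eLpNorm_gag_le s (U := ψ) (W := fun q => ‖dx ψ q‖) hψ.continuous.measurable
    (continuous_dx hψ).norm.measurable MeasurableSet.univ x₀ r
    (fun t _ => hψ.comp (by fun_prop)) (fun t _ x _ => by rw [norm_norm]; rfl)
  refine h.trans ?_
  gcongr
  rw [eLpNorm_norm]
  exact eLpNorm_mono_measure _ Measure.restrict_le_self

theorem reg_le_abs_add (hδ : 0 < δ) (x : ℝ) : reg δ x ≤ |x| + δ := by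
  have h := abs_reg_sub_le hδ x 0
  have h2 := le_abs_self (reg δ x - max 0 0)
  rw [max_self, sub_zero] at h h2
  rw [sub_zero] at h
  linarith

theorem memLp_reg (hδ : 0 < δ) (hv : MemLp v 2) (hvc : Measurable v) (hI : volume I ≠ ∞) :
    MemLp (fun q => reg δ (v q)) 2 (volume.restrict (I ×ˢ ball x₀ R)) := by
  have hN : volume (I ×ˢ ball x₀ R) ≠ ∞ := by
    rw [Measure.volume_eq_prod, Measure.prod_prod]
    exact ENNReal.mul_ne_top hI measure_ball_lt_top.ne
  have : IsFiniteMeasure (volume.restrict (I ×ˢ ball x₀ R)) :=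
    ⟨by rw [Measure.restrict_apply_univ]; exact hN.lt_top⟩
  refine MemLp.mono' (g := fun q => ‖v q‖ + δ) ?_ ?_ (.of_forall fun q => ?_)
  · exact (hv.restrict _).norm.add (memLp_const δ)
  · exact ((contDiff_reg hδ (n := 0)).continuous.measurable.comp hvc).aestronglyMeasurable
  · rw [Real.norm_of_nonneg (reg_pos hδ _).le]
    exact reg_le_abs_add hδ _

theorem integrableOn_reg_sq (hc : IsCutoff I x₀ r L M ζ Θ)
    (hr : MemLp (fun q => reg δ (v q)) 2 (volume.restrict (I ×ˢ ball x₀ R))) :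
    IntegrableOn (fun q => reg δ (v q) ^ 2 * Θ q.1) (I ×ˢ ball x₀ R) := by
  refine Integrable.mul_bdd (c := M) hr.integrable_sq ?_ (.of_forall fun q => ?_)
  · exact (hc.smooth_t.continuous.comp continuous_fst).aestronglyMeasurable
  · rw [Real.norm_of_nonneg (hc.nonneg_t _)]; exact hc.le_t _

theorem le_integral_dx_enTest (hI : MeasurableSet I) (hδ : 0 < δ) (hΛ : 1 ≤ Λ)
    (hE : IsEnergyData s Λ I x₀ R V W a b) (hc : IsCutoff I x₀ r L M ζ Θ)
    (hv : ContDiff ℝ (⊤ : ℕ∞) v) (hD2 : MemLp D 2)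
    (hD : ∀ q : ℝ × Ed d, q.2 ∈ ball x₀ R → dx v q = innerSL ℝ (D q))
    (hr : MemLp (fun q => reg δ (v q)) 2 (volume.restrict (I ×ˢ ball x₀ R))) :
    -(Λ ^ 3 * L ^ 2 * ∫ q in I ×ˢ ball x₀ R, reg δ (v q) ^ 2 * Θ q.1) -
      M * ((eLpNorm a 2).toReal * (eLpNorm (D - W) 2).toReal) ≤
      ∫ q, dx (enTest δ v ζ Θ) q (a q) := by
  have hN : MeasurableSet (I ×ˢ ball x₀ R) := hI.prod measurableSet_ball
  have hψ := contDiff_enTest hδ hv hc.smooth_x hc.smooth_t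
  have hψ1 : ContDiff ℝ 1 (enTest δ v ζ Θ) := hψ.of_le (by exact_mod_cast le_top)
  have hψc : HasCompactSupport (enTest δ v ζ Θ) :=
    hasCompactSupport_of_prod hc.compact_x hc.compact_t tsupport_enTest_subset
  have hdx : MemLp (dx (enTest δ v ζ Θ)) 2 := memLp_of_continuous_compact (continuous_dx hψ1)
    (hasCompactSupport_dx (hψ1.differentiable one_ne_zero) hψc)
  have hri := integrableOn_reg_sq hc hr
  have hDW := hD2.sub hE.memW
  have h1 := integral_abs_mul_le_eLpNorm hE.mema.norm hDW.norm
  have hi1 := integrable_mul_of_memLp hE.mema.norm hDW.norm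
  simp only [abs_mul, abs_norm, eLpNorm_norm] at h1
  have hM : 0 ≤ M := (hc.nonneg_t 0).trans (hc.le_t 0)
  calc _ ≤ ∫ q, (-(Λ ^ 3 * L ^ 2 * (I ×ˢ ball x₀ R).indicator
          (fun q => reg δ (v q) ^ 2 * Θ q.1) q) - M * (‖a q‖ * ‖(D - W) q‖)) := by
        rw [integral_sub ((hri.integrable_indicator hN).const_mul _).fun_neg (hi1.const_mul M),
          integral_neg, integral_const_mul, integral_indicator hN, integral_const_mul]
        gcongr
    _ ≤ _ := by
        refine integral_mono (((hri.integrable_indicator hN).const_mul _).fun_neg.sub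
          (hi1.const_mul M)) (integrable_dx_apply hdx hE.mema) fun q => ?_
        by_cases hq : q ∈ I ×ˢ ball x₀ R
        · simp only [indicator_of_mem hq]
          refine le_trans ?_ (le_dx_enTest_apply hδ (hv.differentiable (by simp))
            (hc.smooth_x.differentiable (by simp)) hΛ (hD q hq.2) (hE.growth q hq)
            (hE.coercive q hq) (hc.nonneg_x _) (hc.le_one_x _) (hc.fderiv_le _) (hc.nonneg_t _))
          gcongr
          · exact hc.le_t _
          · rfl
        · simp [indicator_of_notMem hq, hE.a_zero q hq]

theorem le_integral_gag_enTest (hI : MeasurableSet I) (hδ : 0 < δ) (hΛ : 1 ≤ Λ) {c : ℝ}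
    (hc0 : 0 ≤ c) (hE : IsEnergyData s Λ I x₀ R V W a b) (hc : IsCutoff I x₀ r L M ζ Θ)
    (hk : ∫⁻ z in ball (0 : Ed d) (2 * R), ENNReal.ofReal (‖z‖ ^ 2 * jumpKer s z) ≤
      ENNReal.ofReal c) (hv : ContDiff ℝ (⊤ : ℕ∞) v)
    (hr : MemLp (fun q => reg δ (v q)) 2 (volume.restrict (I ×ˢ ball x₀ R)))
    (hg : MemLp (gag s (enTest δ v ζ Θ)) 2 (volume.restrict (univ ×ˢ ball x₀ R ×ˢ ball x₀ R)))
    (hVv : MemLp (gag s V - gag s v) 2 (volume.restrict (univ ×ˢ ball x₀ R ×ˢ ball x₀ R))) :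
    -(6 * Λ * L ^ 2 * c * ∫ q in I ×ˢ ball x₀ R, reg δ (v q) ^ 2 * Θ q.1) -
      Λ * ((eLpNorm (gag s V - gag s v) 2
          (volume.restrict (univ ×ˢ ball x₀ R ×ˢ ball x₀ R))).toReal *
        (eLpNorm (gag s (enTest δ v ζ Θ)) 2
          (volume.restrict (univ ×ˢ ball x₀ R ×ˢ ball x₀ R))).toReal) ≤
      ∫ q, b q * gag s (enTest δ v ζ Θ) q := by
  set N2 := I ×ˢ ball x₀ R ×ˢ ball x₀ R with hN2
  set S2 := (univ : Set ℝ) ×ˢ ball x₀ R ×ˢ ball x₀ R with hS2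
  have hsub : N2 ⊆ S2 := prod_mono (subset_univ _) subset_rfl
  have hN2m : MeasurableSet N2 := hI.prod (measurableSet_ball.prod measurableSet_ball)
  have hri := integrableOn_reg_sq hc hr
  have hfm : Measurable fun q : ℝ × Ed d => reg δ (v q) ^ 2 * Θ q.1 :=
    (((contDiff_reg hδ (n := 0)).continuous.comp hv.continuous).pow 2 |>.mul
      (hc.smooth_t.continuous.comp continuous_fst)).measurable
  have hX := integrableOn_mul_kernel (s := s) hc0 hfm
    (fun q => mul_nonneg (sq_nonneg _) (hc.nonneg_t _)) hri hk
  have hX0 : ∀ q : ℝ × Ed d × Ed d, 0 ≤ (reg δ (v (q.1, q.2.1)) ^ 2 * Θ q.1 +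
      reg δ (v (q.1, q.2.2)) ^ 2 * Θ q.1) * (‖q.2.1 - q.2.2‖ ^ 2 * jumpKer s (q.2.1 - q.2.2)) :=
    fun q => mul_nonneg (add_nonneg (mul_nonneg (sq_nonneg _) (hc.nonneg_t _))
      (mul_nonneg (sq_nonneg _) (hc.nonneg_t _)))
      (mul_nonneg (by positivity) (jumpKer_nonneg _ _))
  have hle : volume.restrict N2 ≤ volume.restrict S2 := Measure.restrict_mono_set _ hsub
  have hgN := hg.mono_measure hle
  have hY := integral_abs_mul_le_eLpNorm hVv hg
  have hYi := (integrable_mul_of_memLp hVv hg).abs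
  have hYN : ∫ q in N2, |(gag s V - gag s v) q * gag s (enTest δ v ζ Θ) q| ≤
      ∫ q in S2, |(gag s V - gag s v) q * gag s (enTest δ v ζ Θ) q| :=
    integral_mono_measure hle (.of_forall fun q => abs_nonneg _) hYi
  have hYiN := hYi.mono_measure hle
  have e : ∫ q, b q * gag s (enTest δ v ζ Θ) q = ∫ q in N2, b q * gag s (enTest δ v ζ Θ) q :=
    (setIntegral_eq_integral_of_forall_compl_eq_zero fun q h => by simp [hE.b_zero q h]).symm
  rw [e]
  have hΛ0 : 0 ≤ Λ := by linarith
  calc _ ≤ ∫ q in N2, (-(3 * Λ * L ^ 2 * ((reg δ (v (q.1, q.2.1)) ^ 2 * Θ q.1 +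
      reg δ (v (q.1, q.2.2)) ^ 2 * Θ q.1) * (‖q.2.1 - q.2.2‖ ^ 2 * jumpKer s (q.2.1 - q.2.2)))) -
      Λ * |(gag s V - gag s v) q * gag s (enTest δ v ζ Θ) q|) := by
        rw [integral_sub (hX.1.const_mul _).fun_neg (hYiN.const_mul Λ),
          integral_neg, integral_const_mul, integral_const_mul]
        have h1 := mul_le_mul_of_nonneg_left hX.2 (by positivity : 0 ≤ 3 * Λ * L ^ 2)
        have h2 := mul_le_mul_of_nonneg_left (hYN.trans hY) hΛ0
        linear_combination h1 + h2
    _ ≤ _ := by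
        refine setIntegral_mono_on ((hX.1.const_mul _).fun_neg.sub (hYiN.const_mul Λ))
          (integrable_mul_of_memLp (hE.memb.restrict N2) hgN) hN2m fun q hq => ?_
        obtain ⟨k, hk0, hkΛ, hbq⟩ := hE.b_eq q hq
        have h1 := le_gag_mul_gag_enTest (s := s) (v := v) hδ hc.nonneg_x hc.lipschitz
          (hc.nonneg_t q.1) (q := q)
        have h0 := hX0 q
        rw [hbq]
        simp only [Pi.sub_apply]
        have h2 := neg_abs_le ((gag s V q - gag s v q) * gag s (enTest δ v ζ Θ) q)
        have h3 := abs_nonneg ((gag s V q - gag s v q) * gag s (enTest δ v ζ Θ) q)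
        generalize |(gag s V q - gag s v q) * gag s (enTest δ v ζ Θ) q| = Y at *
        generalize ((reg δ (v (q.1, q.2.1)) ^ 2 * Θ q.1 +
          reg δ (v (q.1, q.2.2)) ^ 2 * Θ q.1) *
          (‖q.2.1 - q.2.2‖ ^ 2 * jumpKer s (q.2.1 - q.2.2))) = X at *
        have h4 := mul_le_mul_of_nonneg_left h1 hk0
        have h5 := mul_le_mul_of_nonneg_left h2 hk0
        have h6 : k * (3 * L ^ 2 * X) ≤ Λ * (3 * L ^ 2 * X) := by gcongr
        have h7 : k * Y ≤ Λ * Y := by gcongr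
        linear_combination h4 + h5 + h6 + h7

theorem eLpNorm_enTest_le (hI : MeasurableSet I) (hδ : 0 < δ) (hc : IsCutoff I x₀ r L M ζ Θ)
    (hrR : r ≤ R) :
    eLpNorm (enTest δ v ζ Θ) 2 ≤
      ENNReal.ofReal M * eLpNorm (fun q => reg δ (v q)) 2 (volume.restrict (I ×ˢ ball x₀ R)) := by
  have hN : MeasurableSet (I ×ˢ ball x₀ R) := hI.prod measurableSet_ball
  rw [← eLpNorm_indicator_eq_eLpNorm_restrict hN]
  refine eLpNorm_le_mul_eLpNorm_of_ae_le_mul (.of_forall fun q => ?_) 2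
  have hM : 0 ≤ M := (hc.nonneg_t 0).trans (hc.le_t 0)
  by_cases hq : q ∈ I ×ˢ ball x₀ R
  · rw [indicator_of_mem hq, Real.norm_of_nonneg (reg_pos hδ _).le, enTest,
      Real.norm_of_nonneg (mul_nonneg (mul_nonneg (regF_pos hδ _).le (sq_nonneg _))
        (hc.nonneg_t _))]
    have h1 : ζ q.2 ^ 2 ≤ 1 := pow_le_one₀ (hc.nonneg_x _) (hc.le_one_x _)
    have h2 := hc.le_t q.1
    have h3 := hc.nonneg_t q.1
    have h4 := regF_le_reg hδ (v q)
    have h5 := (regF_pos hδ (v q)).le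
    have h6 := (reg_pos hδ (v q)).le
    calc regF δ (v q) * ζ q.2 ^ 2 * Θ q.1 ≤ reg δ (v q) * 1 * M := by gcongr
      _ = _ := by ring
  · have : enTest δ v ζ Θ q = 0 := by
      by_contra h
      have := tsupport_enTest_subset (subset_tsupport _ h)
      exact hq ⟨hc.tsupport_t this.1, ball_subset_ball hrR (hc.tsupport_x this.2)⟩
    rw [this, norm_zero]; positivity

theorem eLpNorm_dx_enTest_le (hI : MeasurableSet I) (hδ : 0 < δ) (hc : IsCutoff I x₀ r L M ζ Θ)
    (hrR : r ≤ R) (hv : ContDiff ℝ (⊤ : ℕ∞) v) (hDm : AEStronglyMeasurable D)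
    (hD : ∀ q : ℝ × Ed d, q.2 ∈ ball x₀ R → dx v q = innerSL ℝ (D q)) :
    eLpNorm (dx (enTest δ v ζ Θ)) 2 ≤ ENNReal.ofReal M * (eLpNorm D 2 +
      ENNReal.ofReal (2 * L) *
        eLpNorm (fun q => reg δ (v q)) 2 (volume.restrict (I ×ˢ ball x₀ R))) := by
  have hN : MeasurableSet (I ×ˢ ball x₀ R) := hI.prod measurableSet_ball
  have hM : 0 ≤ M := (hc.nonneg_t 0).trans (hc.le_t 0)
  have hL : 0 ≤ L := (norm_nonneg _).trans (hc.fderiv_le 0)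
  have hvd : Differentiable ℝ v := hv.differentiable (by simp)
  have hζd : Differentiable ℝ ζ := hc.smooth_x.differentiable (by simp)
  have hψ := contDiff_enTest hδ hv hc.smooth_x hc.smooth_t
  have hrm : AEStronglyMeasurable
      ((I ×ˢ ball x₀ R).indicator fun q => 2 * L * reg δ (v q)) :=
    ((((contDiff_reg hδ (n := 0)).continuous.comp hv.continuous).const_mul
      (2 * L)).aestronglyMeasurable).indicator hN
  have h1 : eLpNorm (dx (enTest δ v ζ Θ)) 2 ≤ ENNReal.ofReal M * eLpNorm (fun q => ‖D q‖ +
      (I ×ˢ ball x₀ R).indicator (fun q => 2 * L * reg δ (v q)) q) 2 := by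
    refine eLpNorm_le_mul_eLpNorm_of_ae_le_mul (.of_forall fun q => ?_) 2
    by_cases hq : q ∈ I ×ˢ ball x₀ R
    · rw [indicator_of_mem hq, Real.norm_of_nonneg (add_nonneg (norm_nonneg _)
        (mul_nonneg (by positivity) (reg_pos hδ _).le)), dx_enTest hδ hvd hζd]
      refine (norm_add_le _ _).trans ?_
      rw [norm_smul, norm_smul, hD q hq.2, innerSL_apply_norm]
      have z0 := hc.nonneg_x q.2
      have z1 := hc.le_one_x q.2
      have t0 := hc.nonneg_t q.1
      have t1 := hc.le_t q.1
      have l1 := hc.fderiv_le q.2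
      have F0 := regF_pos hδ (v q)
      have F1 := regF_le_reg hδ (v q)
      have f0 := reg_pos hδ (v q)
      have G0 := regF'_pos hδ (v q)
      have G1 := regF'_le_one hδ (v q)
      rw [Real.norm_of_nonneg (by positivity), Real.norm_of_nonneg (by positivity)]
      calc _ ≤ 1 * 1 ^ 2 * M * ‖D q‖ + 2 * reg δ (v q) * 1 * M * L := by gcongr
        _ = _ := by ring
    · have : dx (enTest δ v ζ Θ) q = 0 := by
        refine dx_eq_zero (hψ.differentiable (by simp)) fun h => ?_
        have := tsupport_enTest_subset h
        exact hq ⟨hc.tsupport_t this.1, ball_subset_ball hrR (hc.tsupport_x this.2)⟩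
      rw [this, norm_zero]; positivity
  refine h1.trans ?_
  gcongr
  refine (eLpNorm_add_le hDm.norm hrm (by norm_num)).trans ?_
  rw [eLpNorm_norm, eLpNorm_indicator_eq_eLpNorm_restrict hN]
  gcongr
  refine eLpNorm_le_mul_eLpNorm_of_ae_le_mul (.of_forall fun q => ?_) 2
  rw [norm_mul, Real.norm_of_nonneg (by positivity : 0 ≤ 2 * L)]

end energyStep

theorem tendsto_integral_mul_of_tendsto_eLpNorm {X : Type*} [MeasurableSpace X] {μ : Measure X}
    {f g : ℕ → X → ℝ} {f' g' : X → ℝ} (hf : ∀ n, MemLp (f n) 2 μ) (hf' : MemLp f' 2 μ)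
    (hg : ∀ n, MemLp (g n) 2 μ) (hg' : MemLp g' 2 μ)
    (hft : Tendsto (fun n => eLpNorm (f n - f') 2 μ) atTop (𝓝 0))
    (hgt : Tendsto (fun n => eLpNorm (g n - g') 2 μ) atTop (𝓝 0)) :
    Tendsto (fun n => ∫ x, f n x * g n x ∂μ) atTop (𝓝 (∫ x, f' x * g' x ∂μ)) := by
  have : Fact ((1 : ℝ≥0∞) ≤ 2) := ⟨by norm_num⟩
  have h1 := (Lp.tendsto_Lp_iff_tendsto_eLpNorm'' f hf f' hf').2 hft
  have h2 := (Lp.tendsto_Lp_iff_tendsto_eLpNorm'' g hg g' hg').2 hgt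
  have key : ∀ {u w : X → ℝ} (hu : MemLp u 2 μ) (hw : MemLp w 2 μ),
      inner ℝ (hu.toLp u) (hw.toLp w) = ∫ x, u x * w x ∂μ := by
    intro u w hu hw
    rw [L2.inner_def]
    refine integral_congr_ae ?_
    filter_upwards [hu.coeFn_toLp, hw.coeFn_toLp] with x h1 h2
    rw [h1, h2]; simp [mul_comm]
  simpa only [key] using Filter.Tendsto.inner (𝕜 := ℝ) h1 h2

theorem tendsto_integral_mul_mul_of_tendsto_eLpNorm {X : Type*} [MeasurableSpace X]
    {μ : Measure X} {f g : ℕ → X → ℝ} {f' g' h : X → ℝ} (hf : ∀ n, MemLp (f n) 2 μ)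
    (hf' : MemLp f' 2 μ) (hg : ∀ n, MemLp (g n) 2 μ) (hg' : MemLp g' 2 μ)
    (hft : Tendsto (fun n => eLpNorm (f n - f') 2 μ) atTop (𝓝 0))
    (hgt : Tendsto (fun n => eLpNorm (g n - g') 2 μ) atTop (𝓝 0))
    (hh : AEStronglyMeasurable h μ) {H : ℝ} (hH : ∀ x, ‖h x‖ ≤ H) :
    Tendsto (fun n => ∫ x, f n x * (g n x * h x) ∂μ) atTop (𝓝 (∫ x, f' x * (g' x * h x) ∂μ)) := by
  have hm : ∀ {u : X → ℝ}, MemLp u 2 μ → MemLp (fun x => u x * h x) 2 μ := fun hu =>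
    MemLp.of_le_mul (c := H) hu (hu.1.mul hh) (.of_forall fun x => by
      rw [norm_mul, mul_comm]; gcongr; exact hH x)
  refine tendsto_integral_mul_of_tendsto_eLpNorm hf hf' (fun n => hm (hg n)) (hm hg') hft ?_
  have h0 : Tendsto (fun n => ENNReal.ofReal H * eLpNorm (g n - g') 2 μ) atTop (𝓝 0) := by
    simpa using ENNReal.Tendsto.const_mul hgt (Or.inr ENNReal.ofReal_ne_top)
  refine tendsto_of_tendsto_of_tendsto_of_le_of_le tendsto_const_nhds h0
    (fun _ => zero_le) fun n => ?_
  refine eLpNorm_le_mul_eLpNorm_of_ae_le_mul (.of_forall fun x => ?_) 2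
  simp only [Pi.sub_apply, ← sub_mul, norm_mul]
  rw [mul_comm]; gcongr; exact hH x

theorem eLpNorm_le_add_sub {X E : Type*} [MeasurableSpace X] {μ : Measure X}
    [NormedAddCommGroup E] {u v : X → E} (hu : AEStronglyMeasurable u μ)
    (hv : AEStronglyMeasurable v μ) :
    eLpNorm v 2 μ ≤ eLpNorm u 2 μ + eLpNorm (v - u) 2 μ := by
  simpa using eLpNorm_add_le hu (hv.sub hu) (p := 2) (by norm_num)

theorem tendsto_eLpNorm_of_le_add {X : Type*} [MeasurableSpace X] {μ : Measure X}
    [IsFiniteMeasure μ] {f u : ℕ → X → ℝ} {δ : ℕ → ℝ} (hu : ∀ n, MemLp (u n) 2 μ)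
    (hut : Tendsto (fun n => eLpNorm (u n) 2 μ) atTop (𝓝 0)) (hδ : ∀ n, 0 ≤ δ n)
    (hδt : Tendsto δ atTop (𝓝 0)) (hf : ∀ n x, |f n x| ≤ |u n x| + δ n) :
    Tendsto (fun n => eLpNorm (f n) 2 μ) atTop (𝓝 0) := by
  have hC : eLpNorm (fun _ : X => (1 : ℝ)) 2 μ ≠ ∞ := (memLp_const (1 : ℝ)).2.ne
  have hδt' : Tendsto (fun n => ENNReal.ofReal (δ n)) atTop (𝓝 0) := by
    simpa using ENNReal.tendsto_ofReal hδt
  have h0 : Tendsto (fun n => eLpNorm (u n) 2 μ +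
      ENNReal.ofReal (δ n) * eLpNorm (fun _ : X => (1 : ℝ)) 2 μ) atTop (𝓝 0) := by
    simpa using hut.add (ENNReal.Tendsto.mul_const hδt' (Or.inr hC))
  refine tendsto_of_tendsto_of_tendsto_of_le_of_le tendsto_const_nhds h0
    (fun _ => zero_le) fun n => ?_
  calc eLpNorm (f n) 2 μ ≤ eLpNorm (fun x => ‖u n x‖ + δ n) 2 μ :=
        eLpNorm_mono_real fun x => hf n x
    _ ≤ eLpNorm (fun x => ‖u n x‖) 2 μ + eLpNorm (fun _ : X => δ n) 2 μ :=
        eLpNorm_add_le (hu n).1.norm aestronglyMeasurable_const (by norm_num)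
    _ ≤ _ := by
        rw [eLpNorm_norm]
        gcongr
        refine eLpNorm_le_mul_eLpNorm_of_ae_le_mul (.of_forall fun x => ?_) 2
        simp [abs_of_nonneg (hδ n)]

set_option maxHeartbeats 800000 in
theorem energy_inequality {s Λ : ℝ} {I : Set ℝ} {x₀ : Ed d} {R r L M c : ℝ} {V : ℝ × Ed d → ℝ}
    {W a : ℝ × Ed d → Ed d} {b : ℝ × Ed d × Ed d → ℝ} {g : ℝ × Ed d → ℝ} {ζ : Ed d → ℝ}
    {Θ : ℝ → ℝ} (hI : IsOpen I) (hIf : volume I ≠ ∞) (hΛ : 1 ≤ Λ) (hR : 0 < R) (hrR : r ≤ R)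
    (hE : IsEnergyData s Λ I x₀ R V W a b) (hg : MemLp g 2) (hc : IsCutoff I x₀ r L M ζ Θ)
    (hc0 : 0 ≤ c) (hk : ∫⁻ z in ball (0 : Ed d) (2 * R), ENNReal.ofReal (‖z‖ ^ 2 * jumpKer s z) ≤
      ENNReal.ofReal c) (hC : ∀ ρ, gagConst d s ρ ≠ ∞)
    (hineq : ∀ φ : ℝ × Ed d → ℝ, ContDiff ℝ (⊤ : ℕ∞) φ → HasCompactSupport φ →
      tsupport φ ⊆ I ×ˢ ball x₀ r → (∀ q, 0 ≤ φ q) → testForm s V a b g φ ≤ 0) :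
    -(∫ q in I ×ˢ ball x₀ R, max (V q) 0 * (max (V q) 0 * (ζ q.2 ^ 2 * deriv Θ q.1 / 2))) ≤
      (Λ ^ 3 * L ^ 2 + 6 * Λ * L ^ 2 * c) *
        (∫ q in I ×ˢ ball x₀ R, max (V q) 0 * (max (V q) 0 * Θ q.1)) -
      2 * ∫ q in I ×ˢ ball x₀ R, g q * (max (V q) 0 * (ζ q.2 ^ 2 * Θ q.1)) := by
  set N := I ×ˢ ball x₀ R with hN
  have hNm : MeasurableSet N := hI.measurableSet.prod measurableSet_ball
  have hNf : volume N ≠ ∞ := by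
    rw [hN, Measure.volume_eq_prod, Measure.prod_prod]
    exact ENNReal.mul_ne_top hIf measure_ball_lt_top.ne
  have : IsFiniteMeasure (volume.restrict N) :=
    ⟨by rw [Measure.restrict_apply_univ]; exact hNf.lt_top⟩
  have hM : 0 ≤ M := (hc.nonneg_t 0).trans (hc.le_t 0)
  obtain ⟨ε₀, hε₀, hthick⟩ := (hc.compact_t.isCompact.prod
    hc.compact_x.isCompact).exists_thickening_subset_open (hI.prod isOpen_ball)
    (prod_mono hc.tsupport_t hc.tsupport_x)
  set δ : ℕ → ℝ := fun n => 1 / ((n : ℝ) + 1) with hδdef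
  have hδ : ∀ n, 0 < δ n := fun n => Nat.one_div_pos_of_nat
  have hδt : Tendsto δ atTop (𝓝 0) := tendsto_one_div_add_atTop_nhds_zero_nat
  have hδt' : Tendsto (fun n => ENNReal.ofReal (δ n)) atTop (𝓝 0) := by
    simpa using ENNReal.tendsto_ofReal hδt
  choose ρ hρη hρω using fun n => exists_mollifier hE.memV hE.memW hE.mema hE.memb hg (hδ n)
    (lt_min hε₀ hR)
  set vn : ℕ → ℝ × Ed d → ℝ := fun n => moll (ρ n) V with hvn
  set Dn : ℕ → ℝ × Ed d → Ed d := fun n => moll (ρ n) W with hDn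
  set ψn : ℕ → ℝ × Ed d → ℝ := fun n => enTest (δ n) (vn n) ζ Θ with hψn
  have hv : ∀ n, ContDiff ℝ (⊤ : ℕ∞) (vn n) := fun n => contDiff_moll (ρ n) hE.intV
  have hvm : ∀ n, Measurable (vn n) := fun n => (hv n).continuous.measurable
  have hDm : ∀ n, Measurable (Dn n) := fun n => measurable_moll (ρ n) hE.measW
  have hvV : ∀ n, eLpNorm (vn n - V) 2 ≤ ENNReal.ofReal (δ n) := fun n =>
    eLpNorm_moll_sub_le (ρ n) hE.measV hE.intV fun p hp => (hρω n p hp).1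
  have hDW : ∀ n, eLpNorm (Dn n - W) 2 ≤ ENNReal.ofReal (δ n) := fun n =>
    eLpNorm_moll_sub_le (ρ n) hE.measW hE.intW fun p hp => (hρω n p hp).2.1
  have hvV2 : ∀ n, MemLp (vn n - V) 2 := fun n =>
    ⟨((hvm n).sub hE.measV).aestronglyMeasurable, (hvV n).trans_lt ENNReal.ofReal_lt_top⟩
  have hDW2 : ∀ n, MemLp (Dn n - W) 2 := fun n =>
    ⟨((hDm n).sub hE.measW).aestronglyMeasurable, (hDW n).trans_lt ENNReal.ofReal_lt_top⟩
  have hv2 : ∀ n, MemLp (vn n) 2 := fun n => by simpa using (hvV2 n).add hE.memV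
  have hD2 : ∀ n, MemLp (Dn n) 2 := fun n => by simpa using (hDW2 n).add hE.memW
  have hD : ∀ n, ∀ q : ℝ × Ed d, q.2 ∈ ball x₀ R → dx (vn n) q = innerSL ℝ (Dn n q) := by
    intro n q hq
    refine dx_moll (ρ n) hE.intV hE.intW hE.grad fun y hy => ?_
    have h1 := (hρη n).trans_le (min_le_right _ _)
    rw [mem_closedBall] at hy
    rw [mem_ball] at hq ⊢
    linarith [dist_triangle y q.2 x₀]
  have hDWt : Tendsto (fun n => eLpNorm (Dn n - W) 2) atTop (𝓝 0) :=
    tendsto_of_tendsto_of_tendsto_of_le_of_le tendsto_const_nhds hδt' (fun _ => zero_le) hDW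
  have hvVt : Tendsto (fun n => eLpNorm (vn n - V) 2) atTop (𝓝 0) :=
    tendsto_of_tendsto_of_tendsto_of_le_of_le tendsto_const_nhds hδt' (fun _ => zero_le) hvV
  have restr : ∀ {E : Type _} [NormedAddCommGroup E] {u : ℕ → ℝ × Ed d → E}
      (S : Set (ℝ × Ed d)), Tendsto (fun n => eLpNorm (u n) 2) atTop (𝓝 0) →
      Tendsto (fun n => eLpNorm (u n) 2 (volume.restrict S)) atTop (𝓝 0) := fun S h =>
    tendsto_of_tendsto_of_tendsto_of_le_of_le tendsto_const_nhds h (fun _ => zero_le)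
      fun n => eLpNorm_mono_measure _ Measure.restrict_le_self
  set S2 := (univ : Set ℝ) ×ˢ ball x₀ R ×ˢ ball x₀ R with hS2
  set S := (univ : Set ℝ) ×ˢ ball x₀ (2 * R) ×ˢ ball x₀ (2 * R) with hS
  have hS2S : S2 ⊆ S := prod_mono subset_rfl
    (prod_mono (ball_subset_ball (by linarith)) (ball_subset_ball (by linarith)))
  have hgV : ∀ n, eLpNorm (gag s V - gag s (vn n)) 2 (volume.restrict S2) ≤
      gagConst d s R * eLpNorm (Dn n - W) 2 := by
    intro n
    rw [eLpNorm_sub_comm]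
    refine (eLpNorm_gag_sub_le_of_tendsto s hvm hE.measV hDm hE.measW MeasurableSet.univ x₀ R (hC R)
      (fun n t => ((hv n).of_le (by exact_mod_cast le_top)).comp (by fun_prop))
      (fun n t _ x hx => hD n (t, x) hx) (restr _ hvVt) (restr _ hDWt) n).trans ?_
    gcongr
    exact Measure.restrict_le_self
  have hgVt : Tendsto (fun n => eLpNorm (gag s V - gag s (vn n)) 2 (volume.restrict S2))
      atTop (𝓝 0) := by
    have h0 : Tendsto (fun n => gagConst d s R * eLpNorm (Dn n - W) 2) atTop (𝓝 0) := by
      simpa using ENNReal.Tendsto.const_mul hDWt (Or.inr (hC R))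
    exact tendsto_of_tendsto_of_tendsto_of_le_of_le tendsto_const_nhds h0 (fun _ => zero_le) hgV
  have hgV2 : ∀ n, MemLp (gag s V - gag s (vn n)) 2 (volume.restrict S2) := fun n =>
    ⟨((measurable_gag s hE.measV).sub (measurable_gag s (hvm n))).aestronglyMeasurable,
      (hgV n).trans_lt (ENNReal.mul_lt_top (hC R).lt_top (hDW2 n).2)⟩
  have hr2 : ∀ n, MemLp (fun q => reg (δ n) (vn n q)) 2 (volume.restrict N) := fun n =>
    memLp_reg (hδ n) (hv2 n) (hvm n) hIf
  have hF2 : ∀ n, MemLp (fun q => regF (δ n) (vn n q)) 2 (volume.restrict N) := fun n =>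
    (hr2 n).mono' ((contDiff_regF (hδ n) (n := 0)).continuous.measurable.comp
      (hvm n)).aestronglyMeasurable (.of_forall fun q => by
        rw [Real.norm_of_nonneg (regF_pos (hδ n) _).le]; exact regF_le_reg (hδ n) _)
  have hw2 : MemLp (fun q => max (V q) 0) 2 (volume.restrict N) :=
    (hE.memV.restrict N).mono (hE.measV.max measurable_const).aestronglyMeasurable
      (.of_forall fun q => by
        rw [Real.norm_of_nonneg (le_max_right _ _)]
        exact max_le (le_abs_self _) (abs_nonneg _))
  have hrt : Tendsto (fun n => eLpNorm ((fun q => reg (δ n) (vn n q)) - fun q => max (V q) 0) 2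
      (volume.restrict N)) atTop (𝓝 0) :=
    tendsto_eLpNorm_of_le_add (fun n => (hvV2 n).restrict N) (restr _ hvVt) (fun n => (hδ n).le)
      hδt fun n q => abs_reg_sub_le (hδ n) _ _
  have hFt : Tendsto (fun n => eLpNorm ((fun q => regF (δ n) (vn n q)) - fun q => max (V q) 0) 2
      (volume.restrict N)) atTop (𝓝 0) :=
    tendsto_eLpNorm_of_le_add (δ := fun n => 2 * δ n) (fun n => (hvV2 n).restrict N)
      (restr _ hvVt) (fun n => by have := hδ n; positivity) (by simpa using hδt.const_mul 2)
      fun n q => abs_regF_sub_le (hδ n) _ _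
  have hψs : ∀ n, ContDiff ℝ (⊤ : ℕ∞) (ψn n) := fun n =>
    contDiff_enTest (hδ n) (hv n) hc.smooth_x hc.smooth_t
  have hψ1 : ∀ n, ContDiff ℝ 1 (ψn n) := fun n => (hψs n).of_le (by exact_mod_cast le_top)
  have hψc : ∀ n, HasCompactSupport (ψn n) := fun n =>
    hasCompactSupport_of_prod hc.compact_x hc.compact_t tsupport_enTest_subset
  have hdxψ : ∀ n, MemLp (dx (ψn n)) 2 := fun n => memLp_of_continuous_compact
    (continuous_dx (hψ1 n)) (hasCompactSupport_dx ((hψ1 n).differentiable one_ne_zero) (hψc n))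
  have hgψ : ∀ n, eLpNorm (gag s (ψn n)) 2 (volume.restrict S) ≤
      gagConst d s (2 * R) * eLpNorm (dx (ψn n)) 2 := fun n =>
    eLpNorm_gag_ball_le s (hψ1 n) x₀ (2 * R)
  have hgψ2 : ∀ n, MemLp (gag s (ψn n)) 2 (volume.restrict S) := fun n =>
    ⟨(measurable_gag s (hψs n).continuous.measurable).aestronglyMeasurable,
      (hgψ n).trans_lt (ENNReal.mul_lt_top (hC _).lt_top (hdxψ n).2)⟩
  have hgψS2 : ∀ n, eLpNorm (gag s (ψn n)) 2 (volume.restrict S2) ≤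
      eLpNorm (gag s (ψn n)) 2 (volume.restrict S) := fun n =>
    eLpNorm_mono_measure _ (Measure.restrict_mono_set _ hS2S)
  have hgψ2' : ∀ n, MemLp (gag s (ψn n)) 2 (volume.restrict S2) := fun n =>
    (hgψ2 n).mono_measure (Measure.restrict_mono_set _ hS2S)
  obtain ⟨B, hB0, hBr, hBdx, hBg, hBψ⟩ : ∃ B : ℝ≥0∞, B ≠ ∞ ∧
      (∀ n, eLpNorm (fun q => reg (δ n) (vn n q)) 2 (volume.restrict N) ≤ B) ∧
      (∀ n, eLpNorm (dx (ψn n)) 2 ≤ B) ∧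
      (∀ n, eLpNorm (gag s (ψn n)) 2 (volume.restrict S) ≤ B) ∧
      (∀ n, eLpNorm (ψn n) 2 ≤ B) := by
    set B₁ : ℝ≥0∞ := eLpNorm V 2 + 1 + eLpNorm (fun _ : ℝ × Ed d => (1 : ℝ)) 2 (volume.restrict N)
      with hB₁
    set B₂ : ℝ≥0∞ := ENNReal.ofReal M * (eLpNorm W 2 + 1 + ENNReal.ofReal (2 * L) * B₁) with hB₂
    have hδ1 : ∀ n, ENNReal.ofReal (δ n) ≤ 1 := fun n => by
      rw [← ENNReal.ofReal_one]
      refine ENNReal.ofReal_le_ofReal ((div_le_one (by positivity)).2 ?_)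
      linarith [(Nat.cast_nonneg n : (0 : ℝ) ≤ n)]
    have hB₁f : B₁ ≠ ∞ := ENNReal.add_ne_top.2
      ⟨ENNReal.add_ne_top.2 ⟨hE.memV.2.ne, ENNReal.one_ne_top⟩, (memLp_const (1 : ℝ)).2.ne⟩
    have hB₂f : B₂ ≠ ∞ := ENNReal.mul_ne_top ENNReal.ofReal_ne_top (ENNReal.add_ne_top.2
      ⟨ENNReal.add_ne_top.2 ⟨hE.memW.2.ne, ENNReal.one_ne_top⟩,
        ENNReal.mul_ne_top ENNReal.ofReal_ne_top hB₁f⟩)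
    have hr : ∀ n, eLpNorm (fun q => reg (δ n) (vn n q)) 2 (volume.restrict N) ≤ B₁ := fun n => by
      have hx : ∀ q, ‖reg (δ n) (vn n q)‖ ≤ ‖vn n q‖ + ‖δ n‖ := fun q => by
        rw [Real.norm_of_nonneg (reg_pos (hδ n) _).le, Real.norm_of_nonneg (hδ n).le]
        exact reg_le_abs_add (hδ n) _
      calc eLpNorm (fun q => reg (δ n) (vn n q)) 2 (volume.restrict N)
          ≤ eLpNorm (fun q => ‖vn n q‖ + ‖δ n‖) 2 (volume.restrict N) := eLpNorm_mono_real hx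
        _ ≤ eLpNorm (fun q => ‖vn n q‖) 2 (volume.restrict N) +
            eLpNorm (fun _ => ‖δ n‖) 2 (volume.restrict N) :=
          eLpNorm_add_le (hvm n).aestronglyMeasurable.norm aestronglyMeasurable_const (by norm_num)
        _ ≤ eLpNorm (vn n) 2 + ENNReal.ofReal (δ n) *
            eLpNorm (fun _ : ℝ × Ed d => (1 : ℝ)) 2 (volume.restrict N) := by
          gcongr
          · rw [eLpNorm_norm]; exact eLpNorm_mono_measure _ Measure.restrict_le_self
          · refine eLpNorm_le_mul_eLpNorm_of_ae_le_mul (.of_forall fun x => ?_) 2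
            simp [abs_of_nonneg (hδ n).le]
        _ ≤ B₁ := by
          rw [hB₁]
          gcongr ?_ + ?_
          · exact (eLpNorm_le_add_sub hE.memV.1 (hv2 n).1).trans
              (add_le_add_right ((hvV n).trans (hδ1 n)) _)
          · exact mul_le_of_le_one_left' (hδ1 n)
    have hdxB : ∀ n, eLpNorm (dx (ψn n)) 2 ≤ B₂ := fun n => by
      refine (eLpNorm_dx_enTest_le hI.measurableSet (hδ n) hc hrR (hv n)
        (hDm n).aestronglyMeasurable (hD n)).trans ?_
      rw [hB₂]
      exact mul_le_mul' le_rfl (add_le_add ((eLpNorm_le_add_sub hE.memW.1 (hD2 n).1).trans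
        (add_le_add_right ((hDW n).trans (hδ1 n)) _)) (mul_le_mul' le_rfl (hr n)))
    refine ⟨B₁ + B₂ + gagConst d s (2 * R) * B₂ + ENNReal.ofReal M * B₁, ?_, fun n => ?_,
      fun n => ?_,
      fun n => ?_, fun n => ?_⟩
    · exact ENNReal.add_ne_top.2 ⟨ENNReal.add_ne_top.2 ⟨ENNReal.add_ne_top.2 ⟨hB₁f, hB₂f⟩,
        ENNReal.mul_ne_top (hC _) hB₂f⟩, ENNReal.mul_ne_top ENNReal.ofReal_ne_top hB₁f⟩
    · exact (hr n).trans ((le_self_add.trans le_self_add).trans le_self_add)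
    · exact (hdxB n).trans ((le_add_self.trans le_self_add).trans le_self_add)
    · exact ((hgψ n).trans (by gcongr; exact hdxB n)).trans (le_add_self.trans le_self_add)
    · exact ((eLpNorm_enTest_le hI.measurableSet (hδ n) hc hrR).trans
        (by gcongr; exact hr n)).trans le_add_self
  have step : ∀ n, -(∫ q in N, reg (δ n) (vn n q) * (reg (δ n) (vn n q) *
        (ζ q.2 ^ 2 * deriv Θ q.1 / 2))) ≤
      (Λ ^ 3 * L ^ 2 + 6 * Λ * L ^ 2 * c) *
        (∫ q in N, reg (δ n) (vn n q) * (reg (δ n) (vn n q) * Θ q.1)) -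
      2 * (∫ q in N, g q * (regF (δ n) (vn n q) * (ζ q.2 ^ 2 * Θ q.1))) +
      (M * ((eLpNorm a 2).toReal * (eLpNorm (Dn n - W) 2).toReal) +
        Λ * ((eLpNorm (gag s V - gag s (vn n)) 2 (volume.restrict S2)).toReal * B.toReal) +
        δ n * (B.toReal + B.toReal + 2 * B.toReal)) := by
    intro n
    have hrO := hρη n
    have havg := testForm_average_le s hE.intV hE.mema hE.memb hg hineq (S := S)
      (ε := (ρ n).rOut) (fun p hp q hq => hE.b_zero _ fun hmem => hq ?_) (hδ n).le
      (fun p hp => (hρω n p hp).2.2.1) (fun p hp => (hρω n p hp).2.2.2.1)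
      (fun p hp => (hρω n p hp).2.2.2.2) (ρ n) le_rfl (hψs n) (hψc n)
      (((thickening_mono (hrO.le.trans (min_le_left _ _)) _).trans
        (thickening_subset_of_subset _ tsupport_enTest_subset)).trans hthick)
      (fun q => mul_nonneg (mul_nonneg (regF_pos (hδ n) _).le (sq_nonneg _)) (hc.nonneg_t _))
      (hgψ2 n)
    swap
    · have hpR : ‖p.2‖ < R := (norm_snd_le p).trans_lt (hp.trans (hrO.trans_le (min_le_right _ _)))
      obtain ⟨-, h1, h2⟩ := hmem
      have aux : ∀ x : Ed d, x - p.2 ∈ ball x₀ R → x ∈ ball x₀ (2 * R) := fun x hx => by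
        rw [mem_ball, dist_eq_norm] at hx ⊢
        calc ‖x - x₀‖ = ‖(x - p.2 - x₀) + p.2‖ := by congr 1; abel
          _ ≤ ‖x - p.2 - x₀‖ + ‖p.2‖ := norm_add_le _ _
          _ < 2 * R := by linarith
      exact ⟨mem_univ _, aux _ h1, aux _ h2⟩
    have e1 : ∫ q, vn n q * dt (ψn n) q = ∫ q in N, reg (δ n) (vn n q) * (reg (δ n) (vn n q) *
        (ζ q.2 ^ 2 * deriv Θ q.1 / 2)) := by
      rw [integral_mul_dt_enTest (hδ n) (hv n) hc.smooth_x hc.smooth_t hc.compact_x hc.compact_t,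
        ← setIntegral_eq_integral_of_forall_compl_eq_zero (s := N)]
      · congr 1; ext q; ring
      · intro q hq
        by_cases ht : q.1 ∈ I
        · have : ζ q.2 = 0 := by
            refine image_eq_zero_of_notMem_tsupport fun h => hq ⟨ht, ?_⟩
            exact ball_subset_ball hrR (hc.tsupport_x h)
          simp [this]
        · have : deriv Θ q.1 = 0 := by
            by_contra h
            exact ht (hc.tsupport_t (support_deriv_subset h))
          simp [this]
    have e2 : ∫ q, g q * ψn n q =
        ∫ q in N, g q * (regF (δ n) (vn n q) * (ζ q.2 ^ 2 * Θ q.1)) := by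
      rw [← setIntegral_eq_integral_of_forall_compl_eq_zero (s := N)]
      · congr 1; ext q; simp only [hψn, enTest]; ring
      · intro q hq
        have : ψn n q = 0 := by
          refine image_eq_zero_of_notMem_tsupport fun h => hq ?_
          have := tsupport_enTest_subset h
          exact ⟨hc.tsupport_t this.1, ball_subset_ball hrR (hc.tsupport_x this.2)⟩
        simp [this]
    have e3 := le_integral_dx_enTest hI.measurableSet (hδ n) hΛ hE hc (hv n) (hD2 n) (hD n) (hr2 n)
    have e4 := le_integral_gag_enTest hI.measurableSet (hδ n) hΛ hc0 hE hc hk (hv n) (hr2 n)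
      (hgψ2' n) (hgV2 n)
    have e5 : ∫ q in N, reg (δ n) (vn n q) * (reg (δ n) (vn n q) * Θ q.1) =
        ∫ q in N, reg (δ n) (vn n q) ^ 2 * Θ q.1 := by congr 1; ext q; ring
    have b1 := ENNReal.toReal_mono hB0 (hBdx n)
    have b2 := ENNReal.toReal_mono hB0 (hBg n)
    have b3 := ENNReal.toReal_mono hB0 (hBψ n)
    have b4 := ENNReal.toReal_mono hB0 ((hgψS2 n).trans (hBg n))
    have b5 : δ n * ((eLpNorm (dx (ψn n)) 2).toReal +
        (eLpNorm (gag s (ψn n)) 2 (volume.restrict S)).toReal +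
        2 * (eLpNorm (ψn n) 2).toReal) ≤ δ n * (B.toReal + B.toReal + 2 * B.toReal) := by
      have := (hδ n).le
      gcongr
    have b6 : Λ * ((eLpNorm (gag s V - gag s (vn n)) 2 (volume.restrict S2)).toReal *
        (eLpNorm (gag s (ψn n)) 2 (volume.restrict S2)).toReal) ≤
        Λ * ((eLpNorm (gag s V - gag s (vn n)) 2 (volume.restrict S2)).toReal * B.toReal) := by
      gcongr
    have havg' : -(∫ q, vn n q * dt (ψn n) q) + ((∫ q, dx (ψn n) q (a q)) +
        (∫ q, b q * gag s (ψn n) q) + 2 * ∫ q, g q * ψn n q) ≤ _ := havg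
    rw [e1, e2] at havg'
    rw [e5]
    linarith [havg', e3, e4, b5, b6]
  have hΘ1 : Continuous (deriv Θ) := hc.smooth_t.continuous_deriv (by exact_mod_cast le_top)
  obtain ⟨M', hM'⟩ := hc.compact_t.deriv.exists_bound_of_continuous hΘ1
  have hζ2 : ∀ x, ζ x ^ 2 ≤ 1 := fun x => pow_le_one₀ (hc.nonneg_x x) (hc.le_one_x x)
  have hζcont : Continuous fun q : ℝ × Ed d => ζ q.2 := hc.smooth_x.continuous.comp continuous_snd
  have hΘcont : Continuous fun q : ℝ × Ed d => Θ q.1 := hc.smooth_t.continuous.comp continuous_fst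
  have hΘ1cont : Continuous fun q : ℝ × Ed d => deriv Θ q.1 := hΘ1.comp continuous_fst
  have lim1 := tendsto_integral_mul_mul_of_tendsto_eLpNorm hr2 hw2 hr2 hw2 hrt hrt
    (h := fun q => ζ q.2 ^ 2 * deriv Θ q.1 / 2) (H := 1 * M' / 2)
    (((hζcont.pow 2).mul hΘ1cont).div_const 2).aestronglyMeasurable (fun q => by
      rw [norm_div, norm_mul, Real.norm_of_nonneg (sq_nonneg (ζ q.2)), Real.norm_ofNat]
      gcongr
      · exact hζ2 _
      · exact hM' _)
  have lim2 := tendsto_integral_mul_mul_of_tendsto_eLpNorm hr2 hw2 hr2 hw2 hrt hrt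
    (h := fun q => Θ q.1) (H := M) hΘcont.aestronglyMeasurable
    (fun q => by rw [Real.norm_of_nonneg (hc.nonneg_t _)]; exact hc.le_t _)
  have lim3 := tendsto_integral_mul_mul_of_tendsto_eLpNorm (f := fun _ => g) (f' := g)
    (fun _ => hg.restrict N) (hg.restrict N) hF2 hw2 (by simp) hFt
    (h := fun q => ζ q.2 ^ 2 * Θ q.1) (H := 1 * M)
    ((hζcont.pow 2).mul hΘcont).aestronglyMeasurable (fun q => by
      rw [norm_mul, Real.norm_of_nonneg (sq_nonneg (ζ q.2)), Real.norm_of_nonneg (hc.nonneg_t _)]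
      gcongr
      · exact hc.nonneg_t _
      · exact hζ2 _
      · exact hc.le_t _)
  have toR : ∀ {u : ℕ → ℝ≥0∞}, Tendsto u atTop (𝓝 0) →
      Tendsto (fun n => (u n).toReal) atTop (𝓝 0) := fun h =>
    ENNReal.toReal_zero ▸ (ENNReal.tendsto_toReal ENNReal.zero_ne_top).comp h
  have lim0 : ∀ (x y z : ℕ → ℝ) (A B : ℝ), Tendsto x atTop (𝓝 0) → Tendsto y atTop (𝓝 0) →
      Tendsto z atTop (𝓝 0) →
      Tendsto (fun n => M * (A * x n) + Λ * (y n * B) + z n * (B + B + 2 * B)) atTop (𝓝 0) := by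
    intro x y z A B hx hy hz
    simpa using (((hx.const_mul A).const_mul M).add ((hy.mul_const B).const_mul Λ)).add
      (hz.mul_const (B + B + 2 * B))
  have lim4 : Tendsto (fun n => M * ((eLpNorm a 2).toReal * (eLpNorm (Dn n - W) 2).toReal) +
        Λ * ((eLpNorm (gag s V - gag s (vn n)) 2 (volume.restrict S2)).toReal * B.toReal) +
        δ n * (B.toReal + B.toReal + 2 * B.toReal)) atTop (𝓝 0) := by
    exact lim0 _ _ _ _ _ (toR hDWt) (toR hgVt) hδt
  have := le_of_tendsto_of_tendsto' lim1.neg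
    (((lim2.const_mul (Λ ^ 3 * L ^ 2 + 6 * Λ * L ^ 2 * c)).sub (lim3.const_mul 2)).add lim4) step
  simpa using this

theorem memLp_indicator_of_integrableOn_sq {X E : Type*} [MeasurableSpace X] {μ : Measure X}
    [NormedAddCommGroup E] {u : X → E} {S : Set X} (hS : MeasurableSet S) (hSf : μ S ≠ ∞)
    (hu : AEStronglyMeasurable u μ) (hi : IntegrableOn (fun x => ‖u x‖ ^ 2) S μ) :
    MemLp (S.indicator u) 2 μ ∧ Integrable (S.indicator u) μ := by
  have : IsFiniteMeasure (μ.restrict S) := ⟨by rwa [Measure.restrict_apply_univ, lt_top_iff_ne_top]⟩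
  have h2 : MemLp u 2 (μ.restrict S) := (memLp_two_iff_integrable_sq_norm hu.restrict).2 hi
  exact ⟨(memLp_indicator_iff_restrict hS).2 h2,
    (integrable_indicator_iff hS).2 (h2.integrable (by norm_num))⟩

/-- The kernel `K` relative to the fractional kernel `jumpKer`. -/
def relKer (s : ℝ) (K : ℝ → Ed d → Ed d → ℝ) (q : ℝ × Ed d × Ed d) : ℝ :=
  K q.1 q.2.1 q.2.2 / jumpKer s (q.2.1 - q.2.2)

section relKer

variable {s Λ : ℝ} {K : ℝ → Ed d → Ed d → ℝ}

theorem measurable_relKer (hK : KernelHyp d s Λ K) : Measurable (relKer s K) :=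
  hK.meas.div ((measurable_jumpKer s).comp (by fun_prop))

theorem jumpKer_pos {z : Ed d} (hz : z ≠ 0) : 0 < jumpKer s z :=
  inv_pos.2 (Real.rpow_pos_of_pos (norm_pos_iff.2 hz) _)

theorem jumpKer_zero (hd : 2 ≤ d) (hs : 0 < s) : jumpKer s (0 : Ed d) = 0 := by
  have : (d : ℝ) + 2 * s ≠ 0 := by positivity
  simp [jumpKer, Real.zero_rpow this]

theorem relKer_mem_Icc (hd : 2 ≤ d) (hs : 0 < s) (hΛ : 1 ≤ Λ) (hK : KernelHyp d s Λ K)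
    (q : ℝ × Ed d × Ed d) : relKer s K q ∈ Icc 0 Λ := by
  by_cases h : q.2.1 = q.2.2
  · simp only [relKer, h, sub_self, jumpKer_zero hd hs, div_zero, mem_Icc, le_rfl, true_and]
    linarith
  · have hp := jumpKer_pos (s := s) (sub_ne_zero.2 h)
    have h1 := hK.lower q.1 _ _ h
    have h2 := hK.upper q.1 _ _ h
    have h0 : 0 ≤ Λ⁻¹ / ‖q.2.1 - q.2.2‖ ^ ((d : ℝ) + 2 * s) := by positivity
    exact ⟨div_nonneg (h0.trans h1) hp.le, (div_le_iff₀ hp).2 (by rwa [jumpKer, ← div_eq_mul_inv])⟩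

theorem relKer_mul_jumpKer (q : ℝ × Ed d × Ed d) (h : q.2.1 ≠ q.2.2) :
    relKer s K q * jumpKer s (q.2.1 - q.2.2) = K q.1 q.2.1 q.2.2 :=
  div_mul_cancel₀ _ (jumpKer_pos (sub_ne_zero.2 h)).ne'

theorem relKer_mul_gag_mul_gag (U φ : ℝ × Ed d → ℝ) (q : ℝ × Ed d × Ed d) :
    relKer s K q * gag s U q * gag s φ q = (U (q.1, q.2.1) - U (q.1, q.2.2)) *
      (φ (q.1, q.2.1) - φ (q.1, q.2.2)) * K q.1 q.2.1 q.2.2 := by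
  by_cases h : q.2.1 = q.2.2
  · simp [gag, h]
  · rw [← relKer_mul_jumpKer (s := s) (K := K) q h]
    simp only [gag]
    linear_combination relKer s K q * (U (q.1, q.2.1) - U (q.1, q.2.2)) *
      (φ (q.1, q.2.1) - φ (q.1, q.2.2)) *
      Real.mul_self_sqrt (jumpKer_nonneg s (q.2.1 - q.2.2))

end relKer

theorem memLp_gag_of_memLp {s : ℝ} {V : ℝ × Ed d → ℝ} {W : ℝ × Ed d → Ed d} {x₀ : Ed d} {R : ℝ}
    (hR : 0 < R) (hC : gagConst d s R ≠ ∞) (hVm : Measurable V) (hWm : Measurable W)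
    (hVi : Integrable V) (hWi : Integrable W) (hV : MemLp V 2) (hW : MemLp W 2)
    (hgrad : ∀ t, ∀ φ : Ed d → ℝ, ContDiff ℝ (⊤ : ℕ∞) φ → HasCompactSupport φ →
      tsupport φ ⊆ ball x₀ (2 * R) → ∀ e : Ed d,
      ∫ x, V (t, x) * (fderiv ℝ φ x) e = -∫ x, φ x * ⟪W (t, x), e⟫) :
    MemLp (gag s V) 2 (volume.restrict (univ ×ˢ ball x₀ R ×ˢ ball x₀ R)) := by
  set δ : ℕ → ℝ := fun n => 1 / ((n : ℝ) + 1) with hδdef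
  have hδ : ∀ n, 0 < δ n := fun n => Nat.one_div_pos_of_nat
  have hδt : Tendsto (fun n => ENNReal.ofReal (δ n)) atTop (𝓝 0) := by
    have h : Tendsto δ atTop (𝓝 0) := tendsto_one_div_add_atTop_nhds_zero_nat
    simpa using ENNReal.tendsto_ofReal h
  choose ρ hρη hρω using fun n => exists_mollifier hV hW (MemLp.zero (ε := Ed d))
    (MemLp.zero (ε := ℝ)) (MemLp.zero (ε := ℝ)) (hδ n) hR
  have hVn : ∀ n, eLpNorm (moll (ρ n) V - V) 2 ≤ ENNReal.ofReal (δ n) := fun n =>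
    eLpNorm_moll_sub_le (ρ n) hVm hVi fun p hp => (hρω n p hp).1
  have hWn : ∀ n, eLpNorm (moll (ρ n) W - W) 2 ≤ ENNReal.ofReal (δ n) := fun n =>
    eLpNorm_moll_sub_le (ρ n) hWm hWi fun p hp => (hρω n p hp).2.1
  have hD : ∀ n, ∀ t ∈ (univ : Set ℝ), ∀ x ∈ ball x₀ R,
      fderiv ℝ (fun x => moll (ρ n) V (t, x)) x = innerSL ℝ (moll (ρ n) W (t, x)) := by
    intro n t _ x hx
    refine dx_moll (ρ n) hVi hWi hgrad (q := (t, x)) fun y hy => ?_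
    have h1 := hρη n
    rw [mem_closedBall] at hy
    rw [mem_ball] at hx ⊢
    linarith [dist_triangle y x x₀]
  have hs : ∀ n t, ContDiff ℝ 1 fun x => moll (ρ n) V (t, x) := fun n t =>
    ((contDiff_moll (ρ n) hVi).of_le (by exact_mod_cast le_top)).comp (by fun_prop)
  have hWL : MemLp (moll (ρ 0) W - W) 2 :=
    ⟨((measurable_moll (ρ 0) hWm).sub hWm).aestronglyMeasurable,
      (hWn 0).trans_lt ENNReal.ofReal_lt_top⟩
  have hWL' : MemLp (moll (ρ 0) W) 2 := by simpa using hWL.add hW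
  have hVmn : ∀ n, Measurable (moll (ρ n) V) := fun n => measurable_moll (ρ n) hVm
  have h1 : MemLp (gag s (moll (ρ 0) V)) 2 (volume.restrict (univ ×ˢ ball x₀ R ×ˢ ball x₀ R)) :=
    ⟨(measurable_gag s (hVmn 0)).aestronglyMeasurable,
      (eLpNorm_gag_le s (hVmn 0) (measurable_moll (ρ 0) hWm) MeasurableSet.univ x₀ R
        (fun t _ => hs 0 t) fun t ht x hx => by
          rw [hD 0 t ht x hx, innerSL_apply_norm]).trans_lt
        (ENNReal.mul_lt_top hC.lt_top (hWL'.restrict _).2)⟩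
  have h2 : MemLp (gag s (moll (ρ 0) V) - gag s V) 2
      (volume.restrict (univ ×ˢ ball x₀ R ×ˢ ball x₀ R)) :=
    ⟨((measurable_gag s (hVmn 0)).sub (measurable_gag s hVm)).aestronglyMeasurable,
      (eLpNorm_gag_sub_le_of_tendsto s hVmn hVm (fun n => measurable_moll (ρ n) hWm) hWm
        MeasurableSet.univ x₀ R hC hs hD
        (tendsto_of_tendsto_of_tendsto_of_le_of_le tendsto_const_nhds hδt (fun _ => zero_le)
          fun n => (eLpNorm_mono_measure _ Measure.restrict_le_self).trans (hVn n))
        (tendsto_of_tendsto_of_tendsto_of_le_of_le tendsto_const_nhds hδt (fun _ => zero_le)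
          fun n => (eLpNorm_mono_measure _ Measure.restrict_le_self).trans (hWn n)) 0).trans_lt
        (ENNReal.mul_lt_top hC.lt_top (hWL.restrict _).2)⟩
  simpa using h1.sub h2

section localized

variable (s : ℝ) (A : ℝ → Ed d → Ed d → Ed d) (K : ℝ → Ed d → Ed d → ℝ) (v : ℝ → Ed d → ℝ)
  (Dv : ℝ → Ed d → Ed d) (I : Set ℝ) (x₀ : Ed d) (R : ℝ)

/-- The function `v` localized to a cylinder. -/
def locFun : ℝ × Ed d → ℝ := (I ×ˢ ball x₀ (2 * R)).indicator (Function.uncurry v)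

/-- The gradient `Dv` localized to a cylinder. -/
def locGrad : ℝ × Ed d → Ed d := (I ×ˢ ball x₀ (2 * R)).indicator (Function.uncurry Dv)

/-- The flux `𝒜(t, x, Dv)` localized to a cylinder. -/
def locFlux : ℝ × Ed d → Ed d :=
  (I ×ˢ ball x₀ R).indicator fun q => A q.1 q.2 (Dv q.1 q.2)

/-- The nonlocal flux localized to a cylinder. -/
def locJump : ℝ × Ed d × Ed d → ℝ :=
  (I ×ˢ ball x₀ R ×ˢ ball x₀ R).indicator fun q =>
    relKer s K q * gag s (locFun v I x₀ R) q

/-- The interaction of `v` with the complement of the ball `B_R(x₀)`. -/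
def farJump : ℝ × Ed d → ℝ :=
  (I ×ˢ ball x₀ (23 * R / 24)).indicator fun q =>
    ∫ y in (ball x₀ R)ᶜ, (v q.1 q.2 - v q.1 y) * K q.1 q.2 y

end localized

theorem isEnergyData_localized (hd : 2 ≤ d) {s Λ T : ℝ} (hs : s ∈ Ioo (0 : ℝ) 1) (hΛ : 1 ≤ Λ)
    {Ω : Set (Ed d)} {A : ℝ → Ed d → Ed d → Ed d} (hA : VectorFieldHyp d Λ A)
    {K : ℝ → Ed d → Ed d → ℝ} (hK : KernelHyp d s Λ K) {v : ℝ → Ed d → ℝ} {Dv : ℝ → Ed d → Ed d}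
    (hv : LocalWeakReg d s (Ioo 0 T) Ω v Dv) {t₀ R : ℝ} {x₀ : Ed d} (hR : 0 < R)
    (hI : Icc (t₀ - R ^ 2) t₀ ⊆ Ioo 0 T) (hB : closedBall x₀ (2 * R) ⊆ Ω)
    (hC : gagConst d s R ≠ ∞) :
    IsEnergyData s Λ (Iminus t₀ R) x₀ R (locFun v (Iminus t₀ R) x₀ R)
      (locGrad Dv (Iminus t₀ R) x₀ R) (locFlux A Dv (Iminus t₀ R) x₀ R)
      (locJump s K v (Iminus t₀ R) x₀ R) := by
  set I := Iminus t₀ R with hIdef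
  have hIm : MeasurableSet I := measurableSet_Ioo
  have hSm : MeasurableSet (I ×ˢ ball x₀ (2 * R)) := hIm.prod measurableSet_ball
  have hNm : MeasurableSet (I ×ˢ ball x₀ R) := hIm.prod measurableSet_ball
  have hSf : volume (I ×ˢ ball x₀ (2 * R)) ≠ ∞ := by
    rw [Measure.volume_eq_prod, Measure.prod_prod]
    exact ENNReal.mul_ne_top measure_Ioo_lt_top.ne measure_ball_lt_top.ne
  have hInt : IntegrableOn (fun p : ℝ × Ed d => (v p.1 p.2) ^ 2 + ‖Dv p.1 p.2‖ ^ 2)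
      (I ×ˢ ball x₀ (2 * R)) :=
    (hv.l2w12 _ _ hI _ (isCompact_closedBall x₀ (2 * R)) hB).mono_set
      (prod_mono subset_rfl ball_subset_closedBall)
  have hiv : IntegrableOn (fun p : ℝ × Ed d => ‖Function.uncurry v p‖ ^ 2)
      (I ×ˢ ball x₀ (2 * R)) := by
    refine Integrable.mono' hInt (hv.meas.norm.pow_const 2).aestronglyMeasurable
      (.of_forall fun p => ?_)
    rw [Real.norm_of_nonneg (by positivity), Real.norm_eq_abs, sq_abs]
    exact le_add_of_nonneg_right (by positivity)
  have hiD : IntegrableOn (fun p : ℝ × Ed d => ‖Function.uncurry Dv p‖ ^ 2)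
      (I ×ˢ ball x₀ (2 * R)) := by
    refine Integrable.mono' hInt (hv.measD.norm.pow_const 2).aestronglyMeasurable
      (.of_forall fun p => ?_)
    rw [Real.norm_of_nonneg (by positivity)]
    exact le_add_of_nonneg_left (sq_nonneg _)
  obtain ⟨hV2, hVi⟩ := memLp_indicator_of_integrableOn_sq hSm hSf hv.meas.aestronglyMeasurable hiv
  obtain ⟨hW2, hWi⟩ := memLp_indicator_of_integrableOn_sq hSm hSf hv.measD.aestronglyMeasurable hiD
  have hVm : Measurable (locFun v I x₀ R) := hv.meas.indicator hSm
  have hWm : Measurable (locGrad Dv I x₀ R) := hv.measD.indicator hSm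
  have hNS : I ×ˢ ball x₀ R ⊆ I ×ˢ ball x₀ (2 * R) :=
    prod_mono subset_rfl (ball_subset_ball (by linarith))
  have hWeq : ∀ q ∈ I ×ˢ ball x₀ R, locGrad Dv I x₀ R q = Dv q.1 q.2 := fun q hq =>
    indicator_of_mem (hNS hq) _
  have hA0 : ∀ t x, A t x 0 = 0 := fun t x => by simpa using hA.growth t x 0
  have hgrowth : ∀ q ∈ I ×ˢ ball x₀ R,
      ‖locFlux A Dv I x₀ R q‖ ≤ Λ * ‖locGrad Dv I x₀ R q‖ := fun q hq => by
    rw [hWeq q hq, locFlux, indicator_of_mem hq]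
    exact hA.growth _ _ _
  have hazero : ∀ q ∉ I ×ˢ ball x₀ R, locFlux A Dv I x₀ R q = 0 := fun q hq =>
    indicator_of_notMem hq _
  have hgrad : ∀ t, ∀ φ : Ed d → ℝ, ContDiff ℝ (⊤ : ℕ∞) φ → HasCompactSupport φ →
      tsupport φ ⊆ ball x₀ (2 * R) → ∀ e : Ed d,
      ∫ x, locFun v I x₀ R (t, x) * (fderiv ℝ φ x) e =
        -∫ x, φ x * ⟪locGrad Dv I x₀ R (t, x), e⟫ := by
    intro t φ hφ hφc hφs e
    by_cases ht : t ∈ I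
    · rw [← sub_eq_zero]
      have h0 := hv.grad t (hI (Ioo_subset_Icc_self ht)) φ hφ hφc
        (hφs.trans (ball_subset_closedBall.trans hB)) e
      have e1 : ∀ x, locFun v I x₀ R (t, x) * (fderiv ℝ φ x) e = v t x * (fderiv ℝ φ x) e := by
        intro x
        by_cases hx : x ∈ ball x₀ (2 * R)
        · rw [locFun, indicator_of_mem (mk_mem_prod ht hx)]; rfl
        · have : fderiv ℝ φ x = 0 := by
            by_contra h
            exact hx (hφs (support_fderiv_subset ℝ h))
          simp [this]
      have e2 : ∀ x, φ x * ⟪locGrad Dv I x₀ R (t, x), e⟫ = φ x * ⟪Dv t x, e⟫ := by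
        intro x
        by_cases hx : x ∈ ball x₀ (2 * R)
        · rw [locGrad, indicator_of_mem (mk_mem_prod ht hx)]; rfl
        · have : φ x = 0 := image_eq_zero_of_notMem_tsupport fun h => hx (hφs h)
          simp [this]
      simp only [e1, e2, h0, sub_self]
    · have e1 : ∀ x, locFun v I x₀ R (t, x) = 0 := fun x =>
        indicator_of_notMem (fun h => ht h.1) _
      have e2 : ∀ x, locGrad Dv I x₀ R (t, x) = 0 := fun x =>
        indicator_of_notMem (fun h => ht h.1) _
      simp [e1, e2]
  have hAm : Measurable fun q : ℝ × Ed d => A q.1 q.2 (Dv q.1 q.2) := by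
    have h : Measurable (Function.uncurry fun (ξ : Ed d) (p : ℝ × Ed d) => A p.1 p.2 ξ) :=
      measurable_uncurry_of_continuous_of_measurable (fun p => hA.cont p.1 p.2) hA.meas
    exact h.comp (hv.measD.prodMk measurable_id)
  have hSb : MeasurableSet (I ×ˢ ball x₀ R ×ˢ ball x₀ R) :=
    hIm.prod (measurableSet_ball.prod measurableSet_ball)
  refine ⟨hVm, hWm, hVi, hWi, hV2, hW2, ?_, ?_, hgrowth, ?_, hazero, ?_, ?_, hgrad⟩
  · refine hW2.of_le_mul (c := Λ) (hAm.indicator hNm).aestronglyMeasurable (.of_forall fun q => ?_)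
    by_cases hq : q ∈ I ×ˢ ball x₀ R
    · exact hgrowth q hq
    · rw [hazero q hq, norm_zero]; positivity
  · refine (memLp_indicator_iff_restrict hSb).2 ?_
    have h := memLp_gag_of_memLp hR hC hVm hWm hVi hWi hV2 hW2 hgrad
    refine MemLp.of_le_mul (c := Λ) (h.mono_measure (Measure.restrict_mono_set _
      (prod_mono (subset_univ I) subset_rfl)))
      ((measurable_relKer hK).mul (measurable_gag s hVm)).aestronglyMeasurable
      (.of_forall fun q => ?_)
    have := relKer_mem_Icc hd hs.1 hΛ hK q
    rw [norm_mul, Real.norm_of_nonneg this.1]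
    gcongr
    exact this.2
  · intro q hq
    rw [hWeq q hq, locFlux, indicator_of_mem hq]
    simpa [hA0] using hA.monotone q.1 q.2 0 (Dv q.1 q.2)
  · intro q hq
    have := relKer_mem_Icc hd hs.1 hΛ hK q
    exact ⟨relKer s K q, this.1, this.2, indicator_of_mem hq _⟩
  · exact fun q hq => indicator_of_notMem hq _

theorem jumpKer_le_of_mem_ball {s R : ℝ} (hs : 0 < s) {x₀ x y : Ed d}
    (hx : x ∈ ball x₀ (23 * R / 24)) (hy : y ∈ (ball x₀ R)ᶜ) (hR : 0 < R) :
    jumpKer s (x - y) ≤ 24 ^ ((d : ℝ) + 2 * s) * jumpKer s (x₀ - y) := by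
  rw [mem_compl_iff, mem_ball, not_lt, dist_eq_norm, norm_sub_rev] at hy
  rw [mem_ball, dist_eq_norm, norm_sub_rev] at hx
  have h1 : ‖x₀ - y‖ ≤ ‖x₀ - x‖ + ‖x - y‖ := norm_sub_le_norm_sub_add_norm_sub _ _ _
  have h0 : 0 < ‖x₀ - y‖ := hR.trans_le hy
  have h2 : ‖x₀ - y‖ / 24 ≤ ‖x - y‖ := by linarith
  have hp : 0 ≤ (d : ℝ) + 2 * s := by positivity
  have h3 := Real.rpow_le_rpow (by positivity) h2 hp
  rw [Real.div_rpow h0.le (by norm_num)] at h3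
  have h4 : 0 < ‖x₀ - y‖ ^ ((d : ℝ) + 2 * s) := Real.rpow_pos_of_pos h0 _
  calc jumpKer s (x - y) ≤ (‖x₀ - y‖ ^ ((d : ℝ) + 2 * s) / 24 ^ ((d : ℝ) + 2 * s))⁻¹ :=
        inv_anti₀ (by positivity) h3
    _ = _ := by rw [inv_div, div_eq_mul_inv]; rfl

theorem exists_jumpKer_le_weight {s R : ℝ} (hs : 0 < s) (x₀ : Ed d) (hR : 0 < R) :
    ∃ C : ℝ, ∀ y ∈ (ball x₀ R)ᶜ, jumpKer s (x₀ - y) ≤ C / (1 + ‖y‖ ^ ((d : ℝ) + 2 * s)) := by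
  set p := (d : ℝ) + 2 * s with hp
  have hp0 : 0 ≤ p := by positivity
  refine ⟨R⁻¹ ^ p + (‖x₀‖ / R + 1) ^ p, fun y hy => ?_⟩
  rw [mem_compl_iff, mem_ball, not_lt, dist_eq_norm, norm_sub_rev] at hy
  have h0 : 0 < ‖x₀ - y‖ := hR.trans_le hy
  have h4 : 0 < ‖x₀ - y‖ ^ p := Real.rpow_pos_of_pos h0 _
  have h1 : (1 : ℝ) ≤ (R⁻¹ * ‖x₀ - y‖) ^ p :=
    Real.one_le_rpow (by rwa [← div_eq_inv_mul, one_le_div hR]) hp0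
  have h2 : ‖y‖ ^ p ≤ ((‖x₀‖ / R + 1) * ‖x₀ - y‖) ^ p := by
    refine Real.rpow_le_rpow (norm_nonneg _) ?_ hp0
    have h3 : ‖y‖ ≤ ‖x₀‖ + ‖x₀ - y‖ := by
      simpa using norm_sub_le x₀ (x₀ - y)
    have h5 : ‖x₀‖ ≤ ‖x₀‖ / R * ‖x₀ - y‖ := by
      rw [div_mul_eq_mul_div, le_div_iff₀ hR]; gcongr
    linarith
  rw [Real.mul_rpow (by positivity) h0.le] at h1 h2
  have h6 : 0 < 1 + ‖y‖ ^ p := by positivity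
  rw [le_div_iff₀ h6, jumpKer, inv_mul_le_iff₀ h4]
  nlinarith

section far

variable {s Λ T t₀ R : ℝ} {Ω : Set (Ed d)} {K : ℝ → Ed d → Ed d → ℝ} {v : ℝ → Ed d → ℝ}
  {Dv : ℝ → Ed d → Ed d} {x₀ : Ed d}

theorem abs_kernel_le (hs : 0 < s) (hΛ : 1 ≤ Λ) (hK : KernelHyp d s Λ K) (hR : 0 < R) {x y : Ed d}
    (hx : x ∈ ball x₀ (23 * R / 24)) (hy : y ∈ (ball x₀ R)ᶜ) (t : ℝ) :
    0 ≤ K t x y ∧ K t x y ≤ Λ * 24 ^ ((d : ℝ) + 2 * s) * jumpKer s (x₀ - y) := by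
  have hxy : x ≠ y := fun h => hy (by
    rw [← h]; exact ball_subset_ball (by linarith) hx)
  have h1 := hK.lower t _ _ hxy
  have h2 := hK.upper t _ _ hxy
  refine ⟨le_trans (by positivity) h1, h2.trans ?_⟩
  rw [div_eq_mul_inv, mul_assoc]
  exact mul_le_mul_of_nonneg_left (jumpKer_le_of_mem_ball hs hx hy hR) (by linarith)

theorem integrableOn_jumpKer_compl_ball (hd : 2 ≤ d) (hs : s ∈ Ioo (0 : ℝ) 1) (hR : 0 < R) :
    IntegrableOn (fun y => jumpKer s (x₀ - y)) (ball x₀ R)ᶜ := by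
  obtain ⟨C, -, hC⟩ := exists_lintegral_compl_ball_jumpKer_le (s := s) hd hs
  have hm : Measurable fun y => jumpKer s (x₀ - y) := (measurable_jumpKer s).comp (by fun_prop)
  refine ⟨hm.aestronglyMeasurable, ?_⟩
  rw [hasFiniteIntegral_iff_ofReal (.of_forall fun y => jumpKer_nonneg s _),
    ← lintegral_indicator measurableSet_ball.compl]
  refine lt_of_le_of_lt (le_of_eq ?_) ((hC R hR).trans_lt ENNReal.ofReal_lt_top)
  rw [← lintegral_indicator measurableSet_ball.compl,
    ← lintegral_sub_left_eq_self _ x₀]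
  congr 1
  ext y
  simp only [indicator, mem_compl_iff, mem_ball, dist_eq_norm, sub_zero, sub_sub_cancel,
    sub_sub_cancel_left, norm_neg]

/-- The interaction of `|v(t)|` with the centre of the ball `B_R(x₀)`. -/
def farMass (s : ℝ) (v : ℝ → Ed d → ℝ) (x₀ : Ed d) (R t : ℝ) : ℝ :=
  ∫ y in (ball x₀ R)ᶜ, |v t y| * jumpKer s (x₀ - y)

theorem measurable_farMass (hv : Measurable (Function.uncurry v)) :
    Measurable (farMass s v x₀ R) := by
  have : Measurable (Function.uncurry fun t y => |v t y| * jumpKer s (x₀ - y)) :=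
    hv.abs.mul ((measurable_jumpKer s).comp (by fun_prop))
  exact (this.stronglyMeasurable.integral_prod_right
    (ν := volume.restrict (ball x₀ R)ᶜ)).measurable

theorem integrableOn_mul_jumpKer (hs : 0 < s) (hv : Measurable (Function.uncurry v)) (hR : 0 < R)
    {t : ℝ} (ht : Integrable fun y : Ed d => |v t y| / (1 + ‖y‖ ^ ((d : ℝ) + 2 * s))) :
    IntegrableOn (fun y => |v t y| * jumpKer s (x₀ - y)) (ball x₀ R)ᶜ := by
  obtain ⟨C, hC⟩ := exists_jumpKer_le_weight hs x₀ hR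
  have hm : Measurable fun y => |v t y| * jumpKer s (x₀ - y) :=
    (hv.comp measurable_prodMk_left).abs.mul ((measurable_jumpKer s).comp (by fun_prop))
  refine Integrable.mono' (ht.const_mul C).integrableOn hm.aestronglyMeasurable ?_
  filter_upwards [ae_restrict_mem measurableSet_ball.compl] with y hy
  rw [Real.norm_of_nonneg (mul_nonneg (abs_nonneg _) (jumpKer_nonneg s _))]
  calc _ ≤ |v t y| * (C / (1 + ‖y‖ ^ ((d : ℝ) + 2 * s))) := by gcongr; exact hC y hy
    _ = _ := by ring

theorem ae_integrableOn_mul_jumpKer (hs : 0 < s) (hv : LocalWeakReg d s (Ioo 0 T) Ω v Dv)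
    (hR : 0 < R) (hI : Icc (t₀ - R ^ 2) t₀ ⊆ Ioo 0 T) :
    ∀ᵐ t, t ∈ Iminus t₀ R →
      IntegrableOn (fun y => |v t y| * jumpKer s (x₀ - y)) (ball x₀ R)ᶜ := by
  filter_upwards [hv.tail_ae] with t ht htI
  exact integrableOn_mul_jumpKer hs hv.meas hR (ht (hI (Ioo_subset_Icc_self htI)))

theorem memLp_farMass (hs : 0 < s) (hv : LocalWeakReg d s (Ioo 0 T) Ω v Dv)
    (hR : 0 < R) (hI : Icc (t₀ - R ^ 2) t₀ ⊆ Ioo 0 T) :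
    MemLp (farMass s v x₀ R) 2 (volume.restrict (Iminus t₀ R)) := by
  obtain ⟨C, hC⟩ := exists_jumpKer_le_weight hs x₀ hR
  have hw : ∀ y : Ed d, 0 ≤ 1 / (1 + ‖y‖ ^ ((d : ℝ) + 2 * s)) := fun y => by positivity
  refine (memLp_two_iff_integrable_sq (measurable_farMass hv.meas).aestronglyMeasurable).2 ?_
  refine Integrable.mono' ((hv.tail_l2 _ _ hI).const_mul (C ^ 2))
    ((measurable_farMass hv.meas).pow_const 2).aestronglyMeasurable ?_
  filter_upwards [ae_restrict_mem measurableSet_Ioo, ae_restrict_of_ae hv.tail_ae,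
    ae_restrict_of_ae (ae_integrableOn_mul_jumpKer (x₀ := x₀) hs hv hR hI)] with t htI h1 h2
  have h3 := h1 (hI (Ioo_subset_Icc_self htI))
  have h0 : 0 ≤ farMass s v x₀ R t :=
    integral_nonneg fun y => mul_nonneg (abs_nonneg _) (jumpKer_nonneg s _)
  have h4 : farMass s v x₀ R t ≤
      |C| * ∫ y : Ed d, |v t y| / (1 + ‖y‖ ^ ((d : ℝ) + 2 * s)) := by
    calc farMass s v x₀ R t
        ≤ ∫ y in (ball x₀ R)ᶜ, |C| * (|v t y| / (1 + ‖y‖ ^ ((d : ℝ) + 2 * s))) := by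
          refine setIntegral_mono_on (h2 htI) (h3.const_mul _).integrableOn
            measurableSet_ball.compl fun y hy => ?_
          calc _ ≤ |v t y| * (C / (1 + ‖y‖ ^ ((d : ℝ) + 2 * s))) := by gcongr; exact hC y hy
            _ ≤ |v t y| * (|C| / (1 + ‖y‖ ^ ((d : ℝ) + 2 * s))) := by
                gcongr; exact le_abs_self C
            _ = _ := by ring
      _ ≤ ∫ y, |C| * (|v t y| / (1 + ‖y‖ ^ ((d : ℝ) + 2 * s))) :=
          setIntegral_le_integral (h3.const_mul _) (.of_forall fun y => by positivity)
      _ = _ := integral_const_mul _ _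
  rw [Real.norm_of_nonneg (sq_nonneg _), ← sq_abs C, ← mul_pow]
  gcongr

theorem integrableOn_far (hd : 2 ≤ d) (hs : s ∈ Ioo (0 : ℝ) 1) (hΛ : 1 ≤ Λ)
    (hK : KernelHyp d s Λ K) (hv : Measurable (Function.uncurry v)) (hR : 0 < R) {t : ℝ} {x : Ed d}
    (hx : x ∈ ball x₀ (23 * R / 24))
    (ht : IntegrableOn (fun y => |v t y| * jumpKer s (x₀ - y)) (ball x₀ R)ᶜ) :
    IntegrableOn (fun y => (v t x - v t y) * K t x y) (ball x₀ R)ᶜ ∧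
      ∫ y in (ball x₀ R)ᶜ, |(v t x - v t y) * K t x y| ≤ Λ * 24 ^ ((d : ℝ) + 2 * s) *
        (|v t x| * (∫ y in (ball x₀ R)ᶜ, jumpKer s (x₀ - y)) + farMass s v x₀ R t) := by
  have hm : Measurable fun y => (v t x - v t y) * K t x y :=
    (measurable_const.sub (hv.comp measurable_prodMk_left)).mul
      (hK.meas.comp (measurable_prodMk_left.comp measurable_prodMk_left))
  have hk := integrableOn_jumpKer_compl_ball (x₀ := x₀) hd hs hR
  have hi : IntegrableOn (fun y => Λ * 24 ^ ((d : ℝ) + 2 * s) *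
      (|v t x| * jumpKer s (x₀ - y) + |v t y| * jumpKer s (x₀ - y))) (ball x₀ R)ᶜ :=
    ((hk.const_mul _).add ht).const_mul _
  have hle : ∀ y ∈ (ball x₀ R)ᶜ, |(v t x - v t y) * K t x y| ≤ Λ * 24 ^ ((d : ℝ) + 2 * s) *
      (|v t x| * jumpKer s (x₀ - y) + |v t y| * jumpKer s (x₀ - y)) := fun y hy => by
    obtain ⟨h1, h2⟩ := abs_kernel_le hs.1 hΛ hK hR hx hy t
    rw [abs_mul, abs_of_nonneg h1]
    calc _ ≤ (|v t x| + |v t y|) * (Λ * 24 ^ ((d : ℝ) + 2 * s) * jumpKer s (x₀ - y)) := by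
          gcongr
          exact abs_sub _ _
      _ = _ := by ring
  have hi2 : IntegrableOn (fun y => (v t x - v t y) * K t x y) (ball x₀ R)ᶜ := by
    refine Integrable.mono' hi hm.aestronglyMeasurable ?_
    filter_upwards [ae_restrict_mem measurableSet_ball.compl] with y hy using hle y hy
  refine ⟨hi2, (setIntegral_mono_on hi2.abs hi measurableSet_ball.compl hle).trans (le_of_eq ?_)⟩
  rw [integral_const_mul, integral_add (hk.const_mul _) ht, integral_const_mul]
  rfl

/-- A square integrable majorant of the far interaction. -/
def farBound (s Λ : ℝ) (v : ℝ → Ed d → ℝ) (t₀ : ℝ) (x₀ : Ed d) (R : ℝ) : ℝ × Ed d → ℝ :=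
  (Iminus t₀ R ×ˢ ball x₀ (23 * R / 24)).indicator fun q => Λ * 24 ^ ((d : ℝ) + 2 * s) *
    (|v q.1 q.2| * (∫ y in (ball x₀ R)ᶜ, jumpKer s (x₀ - y)) + farMass s v x₀ R q.1)

theorem memLp_farBound (hs : 0 < s) (hv : LocalWeakReg d s (Ioo 0 T) Ω v Dv)
    (hR : 0 < R) (hI : Icc (t₀ - R ^ 2) t₀ ⊆ Ioo 0 T)
    (hV : MemLp (locFun v (Iminus t₀ R) x₀ R) 2) : MemLp (farBound s Λ v t₀ x₀ R) 2 := by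
  have hSm : MeasurableSet (Iminus t₀ R ×ˢ ball x₀ (23 * R / 24)) :=
    measurableSet_Ioo.prod measurableSet_ball
  have hA : MemLp (Function.uncurry v) 2
      (volume.restrict (Iminus t₀ R ×ˢ ball x₀ (23 * R / 24))) :=
    ((memLp_indicator_iff_restrict (measurableSet_Ioo.prod measurableSet_ball)).1
      hV).mono_measure (Measure.restrict_mono_set _
        (prod_mono subset_rfl (ball_subset_ball (by linarith))))
  have hB : MemLp (fun q : ℝ × Ed d => farMass s v x₀ R q.1) 2
      (volume.restrict (Iminus t₀ R ×ˢ ball x₀ (23 * R / 24))) := by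
    rw [volume_restrict_prod_two]
    have : IsFiniteMeasure ((volume : Measure (Ed d)).restrict (ball x₀ (23 * R / 24))) :=
      ⟨by rw [Measure.restrict_apply_univ]; exact measure_ball_lt_top⟩
    exact (memLp_farMass hs hv hR hI).comp_fst _
  have hA' : MemLp (fun q : ℝ × Ed d => |v q.1 q.2| * (∫ y in (ball x₀ R)ᶜ, jumpKer s (x₀ - y))) 2
      (volume.restrict (Iminus t₀ R ×ˢ ball x₀ (23 * R / 24))) :=
    hA.norm.mul_const _
  have hAB := (hA'.add hB).const_mul (Λ * 24 ^ ((d : ℝ) + 2 * s))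
  unfold farBound
  rw [memLp_indicator_iff_restrict hSm]
  exact hAB

theorem measurable_farJump (hK : KernelHyp d s Λ K) (hv : Measurable (Function.uncurry v)) :
    Measurable (farJump K v (Iminus t₀ R) x₀ R) := by
  refine Measurable.indicator ?_ (measurableSet_Ioo.prod measurableSet_ball)
  have : Measurable (Function.uncurry fun (q : ℝ × Ed d) y =>
      (v q.1 q.2 - v q.1 y) * K q.1 q.2 y) := by
    refine Measurable.mul ?_ (hK.meas.comp (f := fun p : (ℝ × Ed d) × Ed d =>
      (p.1.1, p.1.2, p.2)) (by fun_prop))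
    exact (hv.comp (f := fun p : (ℝ × Ed d) × Ed d => p.1) measurable_fst).sub
      (hv.comp (f := fun p : (ℝ × Ed d) × Ed d => (p.1.1, p.2)) (by fun_prop))
  exact (this.stronglyMeasurable.integral_prod_right
    (ν := volume.restrict (ball x₀ R)ᶜ)).measurable

theorem ae_prod_of_ae_fst {P : ℝ → Prop} (h : ∀ᵐ t, P t) : ∀ᵐ q : ℝ × Ed d, P q.1 :=
  Measure.quasiMeasurePreserving_fst.ae h

theorem memLp_farJump (hd : 2 ≤ d) (hs : s ∈ Ioo (0 : ℝ) 1) (hΛ : 1 ≤ Λ)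
    (hK : KernelHyp d s Λ K) (hv : LocalWeakReg d s (Ioo 0 T) Ω v Dv)
    (hR : 0 < R) (hI : Icc (t₀ - R ^ 2) t₀ ⊆ Ioo 0 T)
    (hV : MemLp (locFun v (Iminus t₀ R) x₀ R) 2) :
    MemLp (farJump K v (Iminus t₀ R) x₀ R) 2 := by
  refine (memLp_farBound (Λ := Λ) hs.1 hv hR hI hV).mono'
    (measurable_farJump hK hv.meas).aestronglyMeasurable ?_
  filter_upwards [ae_prod_of_ae_fst (ae_integrableOn_mul_jumpKer (x₀ := x₀) hs.1 hv hR hI)]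
    with q hq
  by_cases hqS : q ∈ Iminus t₀ R ×ˢ ball x₀ (23 * R / 24)
  · rw [farJump, farBound, indicator_of_mem hqS, indicator_of_mem hqS]
    exact (norm_integral_le_integral_norm _).trans
      (integrableOn_far hd hs hΛ hK hv.meas hR hqS.2 (hq hqS.1)).2
  · rw [farJump, farBound, indicator_of_notMem hqS, indicator_of_notMem hqS, norm_zero]

theorem neg_tail_mul_le_farJump_mul (hd : 2 ≤ d) (hs : s ∈ Ioo (0 : ℝ) 1) (hΛ : 1 ≤ Λ)
    (hK : KernelHyp d s Λ K) (hv : Measurable (Function.uncurry v)) (hR : 0 < R) {q : ℝ × Ed d}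
    (hq : q ∈ Iminus t₀ R ×ˢ ball x₀ (23 * R / 24))
    (ht : IntegrableOn (fun y => |v q.1 y| * jumpKer s (x₀ - y)) (ball x₀ R)ᶜ) :
    -(Λ * 24 ^ ((d : ℝ) + 2 * s) / R ^ 2 * Tail s (fun y => max (v q.1 y) 0) x₀ R *
      max (v q.1 q.2) 0) ≤ farJump K v (Iminus t₀ R) x₀ R q * max (v q.1 q.2) 0 := by
  rcases le_or_gt (v q.1 q.2) 0 with h0 | h0
  · simp [max_eq_right h0]
  rw [← neg_mul]
  refine mul_le_mul_of_nonneg_right ?_ (le_max_right _ _)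
  have hT : Λ * 24 ^ ((d : ℝ) + 2 * s) / R ^ 2 * Tail s (fun y => max (v q.1 y) 0) x₀ R =
      ∫ y in (ball x₀ R)ᶜ, Λ * 24 ^ ((d : ℝ) + 2 * s) *
        (max (v q.1 y) 0 * jumpKer s (x₀ - y)) := by
    rw [integral_const_mul, Tail, ← mul_assoc, div_mul_cancel₀ _ (by positivity)]
    congr 2
    ext y
    rw [abs_of_nonneg (le_max_right _ _), div_eq_mul_inv]; rfl
  have hm : IntegrableOn (fun y => max (v q.1 y) 0 * jumpKer s (x₀ - y)) (ball x₀ R)ᶜ := by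
    refine Integrable.mono' ht (((hv.comp measurable_prodMk_left).max measurable_const).mul
      ((measurable_jumpKer s).comp (by fun_prop))).aestronglyMeasurable (.of_forall fun y => ?_)
    have := jumpKer_nonneg s (x₀ - y)
    rw [Real.norm_of_nonneg (mul_nonneg (le_max_right _ _) this)]
    gcongr
    exact max_le (le_abs_self _) (abs_nonneg _)
  rw [hT, farJump, indicator_of_mem hq, ← integral_neg]
  refine setIntegral_mono_on (hm.const_mul _).neg
    (integrableOn_far hd hs hΛ hK hv hR hq.2 ht).1 measurableSet_ball.compl fun y hy => ?_
  obtain ⟨h1, h2⟩ := abs_kernel_le hs.1 hΛ hK hR hq.2 hy q.1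
  have h3 : max (v q.1 y) 0 * K q.1 q.2 y ≤ max (v q.1 y) 0 *
      (Λ * 24 ^ ((d : ℝ) + 2 * s) * jumpKer s (x₀ - y)) :=
    mul_le_mul_of_nonneg_left h2 (le_max_right _ _)
  have h4 : (-max (v q.1 y) 0) * K q.1 q.2 y ≤ (v q.1 q.2 - v q.1 y) * K q.1 q.2 y :=
    mul_le_mul_of_nonneg_right (by linarith [le_max_left (v q.1 y) 0]) h1
  linarith

end far

theorem integral_integral_integral {X Y Z : Type*} [MeasurableSpace X] [MeasurableSpace Y]
    [MeasurableSpace Z] {μ : Measure X} {ν : Measure Y} {κ : Measure Z} [SFinite μ] [SFinite ν]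
    [SFinite κ] {G : X × Y × Z → ℝ} (hG : Integrable G (μ.prod (ν.prod κ))) :
    ∫ t, ∫ x, ∫ y, G (t, x, y) ∂κ ∂ν ∂μ = ∫ q, G q ∂μ.prod (ν.prod κ) := by
  rw [integral_prod _ hG]
  refine integral_congr_ae ?_
  filter_upwards [hG.prod_right_ae] with t ht
  exact (integral_prod _ ht).symm

theorem setIntegral_setIntegral_eq_integral {X Y : Type*} [MeasurableSpace X] [MeasurableSpace Y]
    {μ : Measure X} {ν : Measure Y} [SFinite μ] [SFinite ν] {S : Set X} {U : Set Y}
    {f : X → Y → ℝ} {G : X × Y → ℝ} (hG : Integrable G (μ.prod ν))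
    (hS : ∀ t ∉ S, ∀ x, G (t, x) = 0) (hU : ∀ t, ∀ x ∉ U, G (t, x) = 0)
    (hf : ∀ t x, f t x = G (t, x)) :
    ∫ t in S, ∫ x in U, f t x ∂ν ∂μ = ∫ q, G q ∂μ.prod ν := by
  rw [integral_prod _ hG, setIntegral_eq_integral_of_forall_compl_eq_zero]
  · refine integral_congr_ae (.of_forall fun t => ?_)
    simp only [hf]
    exact setIntegral_eq_integral_of_forall_compl_eq_zero (hU t)
  · intro t ht
    simp [hf, hS t ht]

section weak

variable {s Λ T t₀ R : ℝ} {Ω : Set (Ed d)} {A : ℝ → Ed d → Ed d → Ed d} {K : ℝ → Ed d → Ed d → ℝ}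
  {v : ℝ → Ed d → ℝ} {Dv : ℝ → Ed d → Ed d} {x₀ : Ed d}

/-- The interaction between a point of a ball and a point outside, weighted by a test function. -/
def farPair (K : ℝ → Ed d → Ed d → ℝ) (v : ℝ → Ed d → ℝ) (x₀ : Ed d) (R : ℝ) (φ : ℝ × Ed d → ℝ)
    (p : (ℝ × Ed d) × Ed d) : ℝ :=
  (ball x₀ R)ᶜ.indicator (fun y => (v p.1.1 p.1.2 - v p.1.1 y) * K p.1.1 p.1.2 y) p.2 * φ p.1

theorem measurable_farPair (hK : KernelHyp d s Λ K) (hv : Measurable (Function.uncurry v))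
    {φ : ℝ × Ed d → ℝ} (hφ : Measurable φ) : Measurable (farPair K v x₀ R φ) := by
  have h1 : Measurable fun p : (ℝ × Ed d) × Ed d =>
      (v p.1.1 p.1.2 - v p.1.1 p.2) * K p.1.1 p.1.2 p.2 := by
    refine Measurable.mul ?_ (hK.meas.comp (f := fun p : (ℝ × Ed d) × Ed d =>
      (p.1.1, p.1.2, p.2)) (by fun_prop))
    exact (hv.comp (f := fun p : (ℝ × Ed d) × Ed d => p.1) measurable_fst).sub
      (hv.comp (f := fun p : (ℝ × Ed d) × Ed d => (p.1.1, p.2)) (by fun_prop))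
  have h2 := (h1.indicator (measurableSet_ball (x := x₀) (ε := R).compl.preimage
    (measurable_snd : Measurable fun p : (ℝ × Ed d) × Ed d => p.2))).mul (hφ.comp measurable_fst)
  exact h2

theorem integrable_farPair (hd : 2 ≤ d) (hs : s ∈ Ioo (0 : ℝ) 1) (hΛ : 1 ≤ Λ)
    (hK : KernelHyp d s Λ K) (hv : LocalWeakReg d s (Ioo 0 T) Ω v Dv)
    (hR : 0 < R) (hI : Icc (t₀ - R ^ 2) t₀ ⊆ Ioo 0 T)
    (hV : MemLp (locFun v (Iminus t₀ R) x₀ R) 2) {φ : ℝ × Ed d → ℝ} (hφ : Continuous φ)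
    (hc : HasCompactSupport φ) (hsupp : tsupport φ ⊆ Iminus t₀ R ×ˢ ball x₀ (23 * R / 24)) :
    Integrable (farPair K v x₀ R φ) (volume.prod volume) ∧
      ∫ p, farPair K v x₀ R φ p ∂volume.prod volume =
        ∫ q, farJump K v (Iminus t₀ R) x₀ R q * φ q := by
  have hz : ∀ q ∉ Iminus t₀ R ×ˢ ball x₀ (23 * R / 24), φ q = 0 := fun q hq =>
    image_eq_zero_of_notMem_tsupport fun h => hq (hsupp h)
  have hae := ae_prod_of_ae_fst (d := d)
    (ae_integrableOn_mul_jumpKer (x₀ := x₀) hs.1 hv hR hI)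
  have hm := measurable_farPair (x₀ := x₀) (R := R) hK hv.meas hφ.measurable
  have hnorm : ∀ q y, ‖farPair K v x₀ R φ (q, y)‖ = (ball x₀ R)ᶜ.indicator
      (fun y => |(v q.1 q.2 - v q.1 y) * K q.1 q.2 y|) y * |φ q| := fun q y => by
    rw [farPair, norm_mul, norm_indicator_eq_indicator_norm]; rfl
  have hInt : Integrable (farPair K v x₀ R φ) (volume.prod volume) := by
    refine (integrable_prod_iff hm.aestronglyMeasurable).2 ⟨?_, ?_⟩
    · filter_upwards [hae] with q hq
      by_cases hqS : q ∈ Iminus t₀ R ×ˢ ball x₀ (23 * R / 24)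
      · exact ((integrable_indicator_iff measurableSet_ball.compl).2
          (integrableOn_far hd hs hΛ hK hv.meas hR hqS.2 (hq hqS.1)).1).mul_const (φ q)
      · simp [farPair, hz q hqS]
    · have hb := integrable_mul_of_memLp (memLp_farBound (Λ := Λ) hs.1 hv hR hI hV)
        (memLp_of_continuous_compact hφ hc).norm
      refine hb.mono' hm.norm.stronglyMeasurable.integral_prod_right.aestronglyMeasurable ?_
      filter_upwards [hae] with q hq
      simp only [hnorm]
      by_cases hqS : q ∈ Iminus t₀ R ×ˢ ball x₀ (23 * R / 24)
      · rw [integral_mul_const, integral_indicator measurableSet_ball.compl,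
          Real.norm_of_nonneg (mul_nonneg (integral_nonneg fun _ => abs_nonneg _) (abs_nonneg _)),
          farBound, indicator_of_mem hqS]
        exact mul_le_mul_of_nonneg_right
          (integrableOn_far hd hs hΛ hK hv.meas hR hqS.2 (hq hqS.1)).2 (abs_nonneg _)
      · simp [hz q hqS]
  refine ⟨hInt, ?_⟩
  rw [integral_prod _ hInt]
  refine integral_congr_ae (.of_forall fun q => ?_)
  simp only [farPair]
  rw [integral_mul_const, integral_indicator measurableSet_ball.compl]
  by_cases hqS : q ∈ Iminus t₀ R ×ˢ ball x₀ (23 * R / 24)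
  · rw [farJump, indicator_of_mem hqS]
  · rw [hz q hqS, mul_zero, mul_zero]

theorem nonlocal_term_eq (hd : 2 ≤ d) (hs : s ∈ Ioo (0 : ℝ) 1) (hΛ : 1 ≤ Λ)
    (hK : KernelHyp d s Λ K) (hv : LocalWeakReg d s (Ioo 0 T) Ω v Dv)
    (hR : 0 < R) (hI : Icc (t₀ - R ^ 2) t₀ ⊆ Ioo 0 T)
    (hV : MemLp (locFun v (Iminus t₀ R) x₀ R) 2)
    (hb : MemLp (locJump s K v (Iminus t₀ R) x₀ R) 2)
    (hC : gagConst d s R ≠ ∞) {φ : ℝ × Ed d → ℝ}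
    (hφ : ContDiff ℝ (⊤ : ℕ∞) φ) (hc : HasCompactSupport φ)
    (hsupp : tsupport φ ⊆ Iminus t₀ R ×ˢ ball x₀ (23 * R / 24)) :
    ∫ t in Ioc (t₀ - R ^ 2) t₀, ∫ x : Ed d, ∫ y : Ed d,
        (v t x - v t y) * (φ (t, x) - φ (t, y)) * K t x y =
      (∫ q, locJump s K v (Iminus t₀ R) x₀ R q * gag s φ q) +
        2 * ∫ q, farJump K v (Iminus t₀ R) x₀ R q * φ q := by
  have hφ1 : ContDiff ℝ 1 φ := hφ.of_le (by exact_mod_cast le_top)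
  obtain ⟨h2, e2⟩ := integrable_farPair hd hs hΛ hK hv hR hI hV hφ.continuous hc hsupp
  have hz : ∀ q ∉ Iminus t₀ R ×ˢ ball x₀ (23 * R / 24), φ q = 0 := fun q hq =>
    image_eq_zero_of_notMem_tsupport fun h => hq (hsupp h)
  have hzt : ∀ t ∉ Iminus t₀ R, ∀ x, φ (t, x) = 0 := fun t ht x => hz _ fun h => ht h.1
  have hzx : ∀ t, ∀ x ∉ ball x₀ R, φ (t, x) = 0 := fun t x hx =>
    hz _ fun h => hx (ball_subset_ball (by linarith) h.2)
  have h1 : Integrable (fun q => locJump s K v (Iminus t₀ R) x₀ R q * gag s φ q) := by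
    have hg : MemLp ((univ ×ˢ ball x₀ R ×ˢ ball x₀ R).indicator (gag s φ)) 2 := by
      rw [memLp_indicator_iff_restrict
        (MeasurableSet.univ.prod (measurableSet_ball.prod measurableSet_ball))]
      exact ⟨(measurable_gag s hφ.continuous.measurable).aestronglyMeasurable,
        (eLpNorm_gag_ball_le s hφ1 x₀ R).trans_lt (ENNReal.mul_lt_top hC.lt_top
          (memLp_of_continuous_compact (continuous_dx hφ1)
            (hasCompactSupport_dx (hφ1.differentiable one_ne_zero) hc)).2)⟩
    refine (integrable_mul_of_memLp hb hg).congr (.of_forall fun q => ?_)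
    by_cases hq : q ∈ univ ×ˢ ball x₀ R ×ˢ ball x₀ R
    · simp only [indicator_of_mem hq]
    · have hq' : q ∉ Iminus t₀ R ×ˢ ball x₀ R ×ˢ ball x₀ R := fun h => hq ⟨mem_univ _, h.2⟩
      simp only [locJump, indicator_of_notMem hq', zero_mul]
  have mp2 : MeasurePreserving (fun q : ℝ × Ed d × Ed d => ((q.1, q.2.1), q.2.2)) volume
      ((volume : Measure (ℝ × Ed d)).prod (volume : Measure (Ed d))) :=
    (measurePreserving_prodAssoc (volume : Measure ℝ) (volume : Measure (Ed d))
      (volume : Measure (Ed d))).symm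
  have mp3 : MeasurePreserving (fun q : ℝ × Ed d × Ed d => ((q.1, q.2.2), q.2.1)) volume
      ((volume : Measure (ℝ × Ed d)).prod (volume : Measure (Ed d))) :=
    mp2.comp ((MeasurePreserving.id (volume : Measure ℝ)).prod
      (Measure.measurePreserving_swap (μ := (volume : Measure (Ed d)))
        (ν := (volume : Measure (Ed d)))))
  have h2' : Integrable fun q : ℝ × Ed d × Ed d => farPair K v x₀ R φ ((q.1, q.2.1), q.2.2) :=
    mp2.integrable_comp_of_integrable h2
  have h3' : Integrable fun q : ℝ × Ed d × Ed d => farPair K v x₀ R φ ((q.1, q.2.2), q.2.1) :=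
    mp3.integrable_comp_of_integrable h2
  have hsm := (measurable_farPair (x₀ := x₀) (R := R) hK hv.meas
    hφ.continuous.measurable).aestronglyMeasurable (μ := volume.prod volume)
  have e2' : ∫ q : ℝ × Ed d × Ed d, farPair K v x₀ R φ ((q.1, q.2.1), q.2.2) =
      ∫ q, farJump K v (Iminus t₀ R) x₀ R q * φ q := by
    rw [← e2, ← mp2.map_eq, integral_map mp2.aemeasurable (by rwa [mp2.map_eq])]
  have e3' : ∫ q : ℝ × Ed d × Ed d, farPair K v x₀ R φ ((q.1, q.2.2), q.2.1) =
      ∫ q, farJump K v (Iminus t₀ R) x₀ R q * φ q := by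
    rw [← e2, ← mp3.map_eq, integral_map mp3.aemeasurable (by rwa [mp3.map_eq])]
  have hF : ∀ q : ℝ × Ed d × Ed d, (v q.1 q.2.1 - v q.1 q.2.2) *
      (φ (q.1, q.2.1) - φ (q.1, q.2.2)) * K q.1 q.2.1 q.2.2 =
      locJump s K v (Iminus t₀ R) x₀ R q * gag s φ q +
        farPair K v x₀ R φ ((q.1, q.2.1), q.2.2) + farPair K v x₀ R φ ((q.1, q.2.2), q.2.1) := by
    rintro ⟨t, x, y⟩
    simp only [farPair]
    by_cases ht : t ∈ Iminus t₀ R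
    swap
    · simp [hzt t ht, gag]
    by_cases hx : x ∈ ball x₀ R <;> by_cases hy : y ∈ ball x₀ R
    · have hm : (t, x, y) ∈ Iminus t₀ R ×ˢ ball x₀ R ×ˢ ball x₀ R := ⟨ht, hx, hy⟩
      rw [indicator_of_notMem (by simpa using hy), indicator_of_notMem (by simpa using hx),
        zero_mul, zero_mul, add_zero, add_zero, locJump, indicator_of_mem hm,
        relKer_mul_gag_mul_gag, locFun]
      have hb : ball x₀ R ⊆ ball x₀ (2 * R) := ball_subset_ball (by linarith)
      rw [indicator_of_mem (mk_mem_prod ht (hb hx)), indicator_of_mem (mk_mem_prod ht (hb hy))]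
      rfl
    all_goals
      have hm : (t, x, y) ∉ Iminus t₀ R ×ˢ ball x₀ R ×ˢ ball x₀ R := fun h => by
        first | exact hx h.2.1 | exact hy h.2.2
      rw [locJump, indicator_of_notMem hm, zero_mul, zero_add]
    · rw [hzx t y hy, indicator_of_mem (by simpa using hy)]; ring
    · rw [hzx t x hx, indicator_of_mem (s := (ball x₀ R)ᶜ) (a := x) (by simpa using hx),
        hK.symm t y x]; ring
    · rw [hzx t x hx, hzx t y hy]; ring
  have hFi : Integrable fun q : ℝ × Ed d × Ed d => (v q.1 q.2.1 - v q.1 q.2.2) *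
      (φ (q.1, q.2.1) - φ (q.1, q.2.2)) * K q.1 q.2.1 q.2.2 := by
    simp only [hF]
    exact (h1.add h2').add h3'
  rw [setIntegral_eq_integral_of_forall_compl_eq_zero,
    integral_integral_integral (G := fun q : ℝ × Ed d × Ed d => (v q.1 q.2.1 - v q.1 q.2.2) *
      (φ (q.1, q.2.1) - φ (q.1, q.2.2)) * K q.1 q.2.1 q.2.2) hFi]
  · change ∫ q : ℝ × Ed d × Ed d, _ = _
    simp only [hF]
    rw [integral_add (h1.fun_add h2') h3', integral_add h1 h2', e2', e3']
    ring
  · intro t ht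
    have : t ∉ Iminus t₀ R := fun h => ht (Ioo_subset_Ioc_self h)
    simp [hzt t this]

theorem testForm_nonpos_of_subsolution (hd : 2 ≤ d) (hs : s ∈ Ioo (0 : ℝ) 1) (hΛ : 1 ≤ Λ)
    (hA : VectorFieldHyp d Λ A) (hK : KernelHyp d s Λ K)
    (hv : LocalWeakReg d s (Ioo 0 T) Ω v Dv) (hR : 0 < R)
    (hI : Icc (t₀ - R ^ 2) t₀ ⊆ Ioo 0 T) (hB : closedBall x₀ (2 * R) ⊆ Ω)
    (hC : gagConst d s R ≠ ∞) (hsub : IsLocalWeakSubsolutionHom A K (Ioo 0 T) Ω v Dv)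
    {φ : ℝ × Ed d → ℝ} (hφ : ContDiff ℝ (⊤ : ℕ∞) φ) (hc : HasCompactSupport φ)
    (hsupp : tsupport φ ⊆ Iminus t₀ R ×ˢ ball x₀ (23 * R / 24)) (hφ0 : ∀ q, 0 ≤ φ q) :
    testForm s (locFun v (Iminus t₀ R) x₀ R) (locFlux A Dv (Iminus t₀ R) x₀ R)
      (locJump s K v (Iminus t₀ R) x₀ R) (farJump K v (Iminus t₀ R) x₀ R) φ ≤ 0 := by
  have hE := isEnergyData_localized hd hs hΛ hA hK hv hR hI hB hC
  have hφ1 : ContDiff ℝ 1 φ := hφ.of_le (by exact_mod_cast le_top)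
  have hφd : Differentiable ℝ φ := hφ1.differentiable one_ne_zero
  have hBΩ : ball x₀ (23 * R / 24) ⊆ Ω :=
    ((ball_subset_ball (by linarith)).trans ball_subset_closedBall).trans hB
  have htest : IsTestFunction Ω fun t x => φ (t, x) := by
    refine ⟨hφ, Prod.snd '' tsupport φ, hc.isCompact.image continuous_snd, ?_, fun t => ?_⟩
    · rintro _ ⟨q, hq, rfl⟩
      exact hBΩ (hsupp hq).2
    · refine closure_minimal (fun x hx => ⟨(t, x), subset_tsupport _ hx, rfl⟩)
        (hc.isCompact.image continuous_snd).isClosed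
  have h := hsub (t₀ - R ^ 2) t₀ (by nlinarith) hI (fun t x => φ (t, x)) htest
    fun t x => hφ0 _
  have hz : ∀ q ∉ Iminus t₀ R ×ˢ ball x₀ (23 * R / 24), q ∉ tsupport φ := fun q hq h => hq (hsupp h)
  have hzt : ∀ t ∉ Ioc (t₀ - R ^ 2) t₀, ∀ x, (t, x) ∉ tsupport φ := fun t ht x =>
    hz _ fun h => ht (Ioo_subset_Ioc_self h.1)
  have hzx : ∀ t, ∀ x ∉ Ω, (t, x) ∉ tsupport φ := fun t x hx => hz _ fun h => hx (hBΩ h.2)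
  have e1 : ∫ t in Ioc (t₀ - R ^ 2) t₀, ∫ x in Ω, v t x * deriv (fun τ => φ (τ, x)) t =
      ∫ q, locFun v (Iminus t₀ R) x₀ R q * dt φ q := by
    refine setIntegral_setIntegral_eq_integral
      (G := fun q => locFun v (Iminus t₀ R) x₀ R q * dt φ q)
      (integrable_mul_of_memLp hE.memV
        (memLp_of_continuous_compact (continuous_dt hφ1) (hasCompactSupport_dt hφd hc)))
      (fun t ht x => by simp only [dt_eq_zero hφd (hzt t ht x), mul_zero])
      (fun t x hx => by simp only [dt_eq_zero hφd (hzx t x hx), mul_zero]) fun t x => ?_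
    by_cases hq : (t, x) ∈ Iminus t₀ R ×ˢ ball x₀ (23 * R / 24)
    · rw [locFun, indicator_of_mem (mk_mem_prod hq.1
        (ball_subset_ball (by linarith) hq.2))]
      rfl
    · change v t x * dt φ (t, x) = _
      rw [dt_eq_zero hφd (hz _ hq), mul_zero, mul_zero]
  have e2 : ∫ t in Ioc (t₀ - R ^ 2) t₀, ∫ x in Ω,
      ⟪A t x (Dv t x), gradient (fun x => φ (t, x)) x⟫ =
      ∫ q, dx φ q (locFlux A Dv (Iminus t₀ R) x₀ R q) := by
    refine setIntegral_setIntegral_eq_integral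
      (G := fun q => dx φ q (locFlux A Dv (Iminus t₀ R) x₀ R q))
      (integrable_dx_apply (memLp_of_continuous_compact (continuous_dx hφ1)
        (hasCompactSupport_dx hφd hc)) hE.mema)
      (fun t ht x => by simp only [dx_eq_zero hφd (hzt t ht x), _root_.zero_apply])
      (fun t x hx => by simp only [dx_eq_zero hφd (hzx t x hx), _root_.zero_apply]) fun t x => ?_
    rw [real_inner_comm, inner_gradient_left]
    change dx φ (t, x) _ = _
    by_cases hq : (t, x) ∈ Iminus t₀ R ×ˢ ball x₀ (23 * R / 24)
    · rw [locFlux, indicator_of_mem (mk_mem_prod hq.1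
        (ball_subset_ball (by linarith) hq.2))]
    · rw [dx_eq_zero hφd (hz _ hq)]; rfl
  have e3 := nonlocal_term_eq hd hs hΛ hK hv hR hI hE.memV hE.memb hC hφ hc hsupp
  have b1 : ∀ x, φ (t₀, x) = 0 := fun x =>
    image_eq_zero_of_notMem_tsupport (hz _ fun h => lt_irrefl _ h.1.2)
  have b2 : ∀ x, φ (t₀ - R ^ 2, x) = 0 := fun x =>
    image_eq_zero_of_notMem_tsupport (hz _ fun h => lt_irrefl _ h.1.1)
  simp only [mixedLHS] at h
  rw [e1, e2, e3] at h
  simp only [b1, b2, mul_zero, integral_zero] at h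
  rw [testForm]
  linarith

end weak

theorem exists_scaled_bump (E : Type*) [NormedAddCommGroup E] [InnerProductSpace ℝ E]
    [FiniteDimensional ℝ E] {a b : ℝ} (ha : 0 < a) (hab : a < b) :
    ∃ C : ℝ, 0 < C ∧ ∀ (c : E) (r : ℝ), 0 < r → ∃ ζ : E → ℝ, ContDiff ℝ (⊤ : ℕ∞) ζ ∧
      tsupport ζ ⊆ closedBall c (b * r) ∧ (∀ x, 0 ≤ ζ x) ∧ (∀ x, ζ x ≤ 1) ∧
      (∀ x ∈ closedBall c (a * r), ζ x = 1) ∧ ∀ x, ‖fderiv ℝ ζ x‖ ≤ C / r := by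
  let η : ContDiffBump (0 : E) := ⟨a, b, ha, hab⟩
  have hη : ContDiff ℝ (⊤ : ℕ∞) η := η.contDiff
  obtain ⟨C, hC⟩ := (η.hasCompactSupport.fderiv (𝕜 := ℝ)).exists_bound_of_continuous
    (hη.continuous_fderiv (by simp))
  refine ⟨max C 1, by positivity, fun c r hr => ⟨fun x => η (r⁻¹ • (x - c)),
    ?_, ?_, ?_, ?_, ?_, ?_⟩⟩
  · exact hη.comp (by fun_prop)
  · refine closure_minimal (fun x hx => ?_) isClosed_closedBall
    have h1 : r⁻¹ • (x - c) ∈ Function.support η := hx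
    rw [η.support_eq, mem_ball_zero_iff, norm_smul, norm_inv, Real.norm_of_nonneg hr.le,
      inv_mul_lt_iff₀ hr] at h1
    rw [mem_closedBall, dist_eq_norm, mul_comm]
    exact h1.le
  · exact fun x => η.nonneg
  · exact fun x => η.le_one
  · intro x hx
    refine η.one_of_mem_closedBall ?_
    rw [mem_closedBall, dist_eq_norm] at hx
    rw [mem_closedBall_zero_iff, norm_smul, norm_inv, Real.norm_of_nonneg hr.le,
      inv_mul_le_iff₀ hr, mul_comm]
    exact hx
  · intro x
    have h1 : HasFDerivAt (fun x => r⁻¹ • (x - c)) (r⁻¹ • ContinuousLinearMap.id ℝ E) x :=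
      ((hasFDerivAt_id x).sub_const c).const_smul r⁻¹
    have h2 := ((hη.differentiable (by simp) _).hasFDerivAt.comp x h1).fderiv
    change fderiv ℝ (fun x => η (r⁻¹ • (x - c))) x = _ at h2
    rw [h2, ContinuousLinearMap.comp_smul, ContinuousLinearMap.comp_id, norm_smul, norm_inv,
      Real.norm_of_nonneg hr.le, div_eq_inv_mul]
    gcongr
    exact (hC _).trans (le_max_left _ _)

theorem exists_antideriv_cutoff {ψ : ℝ → ℝ} (hψ : ContDiff ℝ (⊤ : ℕ∞) ψ) (hψ0 : ∀ t, 0 ≤ ψ t)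
    {r : ℝ} (hr : ∀ t, r < t → ψ t = 0) (hi : Integrable ψ) (h1 : ∫ t, ψ t = 1) :
    ∃ χ : ℝ → ℝ, ContDiff ℝ (⊤ : ℕ∞) χ ∧ (∀ t, HasDerivAt χ (-ψ t) t) ∧ (∀ t, 0 ≤ χ t) ∧
      (∀ t, χ t ≤ 1) ∧ ∀ t, r ≤ t → χ t = 0 := by
  have hz : ∀ t, r ≤ t → ∫ u in t..r, ψ u = 0 := fun t ht => by
    rw [intervalIntegral.integral_of_ge ht,
      setIntegral_eq_zero_of_forall_eq_zero fun u hu => hr u hu.1, neg_zero]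
  have hd : ∀ t, HasDerivAt (fun t => ∫ u in t..r, ψ u) (-ψ t) t := fun t =>
    intervalIntegral.integral_hasDerivAt_left (hψ.continuous.intervalIntegrable _ _)
      (hψ.continuous.stronglyMeasurableAtFilter _ _) hψ.continuous.continuousAt
  refine ⟨fun t => ∫ u in t..r, ψ u, ?_, hd, fun t => ?_, fun t => ?_, hz⟩
  · rw [contDiff_infty_iff_deriv]
    refine ⟨fun t => (hd t).differentiableAt, ?_⟩
    rw [funext fun t => (hd t).deriv]
    exact hψ.neg
  · rcases le_total t r with h | h
    · exact intervalIntegral.integral_nonneg h fun u _ => hψ0 u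
    · exact (hz t h).ge
  · rcases le_total t r with h | h
    · rw [← h1]
      simp only [intervalIntegral.integral_of_le h]
      exact setIntegral_le_integral hi (.of_forall hψ0)
    · exact (hz t h).trans_le zero_le_one

section time

variable {α α' β D : ℝ} {G H₀ H₁ θ : ℝ → ℝ}

theorem integral_mul_bump_le (hα : α < α') (hG : IntegrableOn G (Ioo α β)) (hG0 : ∀ t, 0 ≤ G t)
    (hH₀ : IntegrableOn H₀ (Ioo α β)) (hH₀0 : ∀ t, 0 ≤ H₀ t)
    (hH₁ : IntegrableOn H₁ (Ioo α β)) (hH₁0 : ∀ t, 0 ≤ H₁ t)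
    (hHG : IntegrableOn (fun t => H₁ t * √(G t)) (Ioo α β))
    (hθ : ContDiff ℝ (⊤ : ℕ∞) θ) (hθ0 : ∀ t, 0 ≤ θ t) (hθ1 : ∀ t, θ t ≤ 1)
    (hθα : ∀ t, t ≤ α' → θ t = 0) (hθD : ∀ t, |deriv θ t| ≤ D)
    (hineq : ∀ Θ : ℝ → ℝ, ContDiff ℝ (⊤ : ℕ∞) Θ → HasCompactSupport Θ → tsupport Θ ⊆ Ioo α β →
      (∀ t, 0 ≤ Θ t) →
      -(∫ t in Ioo α β, G t * (deriv Θ t / 2)) ≤ ∫ t in Ioo α β, (H₀ t + H₁ t * √(G t)) * Θ t)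
    {N : ℝ} (hN : ∀ᵐ t ∂volume.restrict (Ioo α β), θ t ^ 2 * G t ≤ N)
    {ψ : ℝ → ℝ} (hψ : ContDiff ℝ (⊤ : ℕ∞) ψ) (hψ0 : ∀ t, 0 ≤ ψ t) (hψc : HasCompactSupport ψ)
    {r : ℝ} (hrβ : r < β) (hr : ∀ t, r < t → ψ t = 0) (h1 : ∫ t, ψ t = 1) :
    ∫ t in Ioo α β, θ t ^ 2 * G t * ψ t ≤ 2 * D * (∫ t in Ioo α β, G t) +
      2 * (∫ t in Ioo α β, H₀ t) + 2 * √N * ∫ t in Ioo α β, H₁ t := by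
  obtain ⟨χ, hχ, hχd, hχ0, hχ1, hχr⟩ := exists_antideriv_cutoff hψ hψ0 hr
    (hψ.continuous.integrable_of_hasCompactSupport hψc) h1
  have hz : ∀ t ∉ Icc α' r, θ t ^ 2 * χ t = 0 := fun t ht => by
    rcases lt_or_ge t α' with h | h
    · rw [hθα t h.le]; ring
    · rw [hχr t (le_of_lt (not_le.1 fun h' => ht ⟨h, h'⟩)), mul_zero]
  have hs : Function.support (fun t => θ t ^ 2 * χ t) ⊆ Icc α' r := fun t ht =>
    by_contra fun h => ht (hz t h)
  have hts : tsupport (fun t => θ t ^ 2 * χ t) ⊆ Icc α' r := closure_minimal hs isClosed_Icc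
  have key := hineq (fun t => θ t ^ 2 * χ t) ((hθ.pow 2).mul hχ)
    (isCompact_Icc.of_isClosed_subset (isClosed_tsupport _) hts)
    (hts.trans fun t ht => ⟨hα.trans_le ht.1, ht.2.trans_lt hrβ⟩)
    (fun t => mul_nonneg (sq_nonneg _) (hχ0 t))
  have hder : ∀ t, deriv (fun t => θ t ^ 2 * χ t) t =
      2 * (θ t * deriv θ t * χ t) - θ t ^ 2 * ψ t := fun t => by
    have h2 := (((hθ.differentiable (by simp) t).hasDerivAt.pow 2).mul (hχd t)).deriv
    refine Eq.trans h2 ?_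
    simp only [Nat.cast_ofNat, Nat.add_one_sub_one, pow_one, Pi.pow_apply]
    ring
  have hcθ' : Continuous (deriv θ) := hθ.continuous_deriv (by simp)
  have ha : ∀ t, |θ t * deriv θ t * χ t| ≤ D := fun t => by
    have hD0 : 0 ≤ D := (abs_nonneg _).trans (hθD t)
    rw [abs_mul, abs_mul, abs_of_nonneg (hθ0 t), abs_of_nonneg (hχ0 t)]
    calc _ ≤ 1 * D * 1 := by
          gcongr
          exacts [hχ0 t, hθ1 t, hθD t, hχ1 t]
      _ = D := by ring
  have hb : ∀ t, ‖θ t ^ 2 * χ t‖ ≤ 1 := fun t => by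
    rw [Real.norm_of_nonneg (mul_nonneg (sq_nonneg _) (hχ0 t))]
    exact mul_le_one₀ (pow_le_one₀ (hθ0 t) (hθ1 t)) (hχ0 t) (hχ1 t)
  have hb2 : ∀ t, θ t ^ 2 * χ t ≤ 1 := fun t => (le_abs_self _).trans (hb t)
  obtain ⟨P, hP⟩ := hψc.exists_bound_of_continuous hψ.continuous
  have hc0 := hθ.continuous
  have hc1 := hχ.continuous
  have hc2 := hψ.continuous
  have i1 : IntegrableOn (fun t => G t * (θ t * deriv θ t * χ t)) (Ioo α β) :=
    Integrable.mul_bdd (c := D) hG (by fun_prop) (.of_forall ha)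
  have i2 : IntegrableOn (fun t => G t * (θ t ^ 2 * ψ t)) (Ioo α β) := by
    refine Integrable.mul_bdd (c := P) hG (by fun_prop) (.of_forall fun t => ?_)
    rw [norm_mul, Real.norm_of_nonneg (sq_nonneg (θ t))]
    calc _ ≤ 1 * P := mul_le_mul (pow_le_one₀ (hθ0 t) (hθ1 t)) (hP t) (norm_nonneg _) zero_le_one
      _ = P := one_mul P
  have i3 : IntegrableOn (fun t => (H₀ t + H₁ t * √(G t)) * (θ t ^ 2 * χ t)) (Ioo α β) :=
    Integrable.mul_bdd (c := 1) (hH₀.add hHG) (by fun_prop) (.of_forall hb)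
  have e1 : ∫ t in Ioo α β, G t * (deriv (fun t => θ t ^ 2 * χ t) t / 2) =
      (∫ t in Ioo α β, G t * (θ t * deriv θ t * χ t)) -
        (∫ t in Ioo α β, θ t ^ 2 * G t * ψ t) / 2 := by
    rw [← integral_div, ← integral_sub i1]
    · refine integral_congr_ae (.of_forall fun t => ?_)
      simp only [hder]
      ring
    · exact (i2.div_const 2).congr (.of_forall fun t => by ring)
  have e2 : ∫ t in Ioo α β, G t * (θ t * deriv θ t * χ t) ≤ D * ∫ t in Ioo α β, G t := by
    rw [← integral_const_mul]
    refine integral_mono i1 (hG.const_mul D) fun t => ?_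
    change G t * (θ t * deriv θ t * χ t) ≤ D * G t
    rw [mul_comm D]
    exact mul_le_mul_of_nonneg_left ((le_abs_self _).trans (ha t)) (hG0 t)
  have e3 : ∫ t in Ioo α β, (H₀ t + H₁ t * √(G t)) * (θ t ^ 2 * χ t) ≤
      (∫ t in Ioo α β, H₀ t) + √N * ∫ t in Ioo α β, H₁ t := by
    rw [← integral_const_mul, ← integral_add hH₀ (hH₁.const_mul _)]
    refine integral_mono_ae i3 (hH₀.add (hH₁.const_mul _)) ?_
    filter_upwards [hN] with t ht
    have h2 : √(G t) * (θ t ^ 2 * χ t) ≤ √N := by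
      have h3 : √(G t) * θ t ≤ √N := by
        refine Real.le_sqrt_of_sq_le ?_
        rw [mul_pow, Real.sq_sqrt (hG0 t), mul_comm]
        exact ht
      calc _ = √(G t) * θ t * (θ t * χ t) := by ring
        _ ≤ √N * 1 := by
          refine mul_le_mul h3 (mul_le_one₀ (hθ1 t) (hχ0 t) (hχ1 t))
            (mul_nonneg (hθ0 t) (hχ0 t)) (Real.sqrt_nonneg _)
        _ = √N := mul_one _
    change (H₀ t + H₁ t * √(G t)) * (θ t ^ 2 * χ t) ≤ H₀ t + √N * H₁ t
    calc _ = H₀ t * (θ t ^ 2 * χ t) + H₁ t * (√(G t) * (θ t ^ 2 * χ t)) := by ring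
      _ ≤ H₀ t * 1 + H₁ t * √N := add_le_add (mul_le_mul_of_nonneg_left (hb2 t) (hH₀0 t))
          (mul_le_mul_of_nonneg_left h2 (hH₁0 t))
      _ = _ := by ring
  rw [e1] at key
  linarith

theorem ae_sq_mul_le_of_bound (hα : α < α') (hG : IntegrableOn G (Ioo α β)) (hG0 : ∀ t, 0 ≤ G t)
    (hH₀ : IntegrableOn H₀ (Ioo α β)) (hH₀0 : ∀ t, 0 ≤ H₀ t)
    (hH₁ : IntegrableOn H₁ (Ioo α β)) (hH₁0 : ∀ t, 0 ≤ H₁ t)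
    (hHG : IntegrableOn (fun t => H₁ t * √(G t)) (Ioo α β))
    (hθ : ContDiff ℝ (⊤ : ℕ∞) θ) (hθ0 : ∀ t, 0 ≤ θ t) (hθ1 : ∀ t, θ t ≤ 1)
    (hθα : ∀ t, t ≤ α' → θ t = 0) (hθD : ∀ t, |deriv θ t| ≤ D)
    (hineq : ∀ Θ : ℝ → ℝ, ContDiff ℝ (⊤ : ℕ∞) Θ → HasCompactSupport Θ → tsupport Θ ⊆ Ioo α β →
      (∀ t, 0 ≤ Θ t) →
      -(∫ t in Ioo α β, G t * (deriv Θ t / 2)) ≤ ∫ t in Ioo α β, (H₀ t + H₁ t * √(G t)) * Θ t)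
    {N : ℝ} (hN : ∀ᵐ t ∂volume.restrict (Ioo α β), θ t ^ 2 * G t ≤ N) :
    ∀ᵐ t ∂volume.restrict (Ioo α β), θ t ^ 2 * G t ≤ 2 * D * (∫ t in Ioo α β, G t) +
      2 * (∫ t in Ioo α β, H₀ t) + 2 * √N * ∫ t in Ioo α β, H₁ t := by
  have hc0 := hθ.continuous
  have hg : Integrable ((Ioo α β).indicator fun t => θ t ^ 2 * G t) := by
    rw [integrable_indicator_iff measurableSet_Ioo]
    refine Integrable.bdd_mul (c := 1) hG (by fun_prop) (.of_forall fun t => ?_)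
    rw [Real.norm_of_nonneg (sq_nonneg _)]
    exact pow_le_one₀ (hθ0 t) (hθ1 t)
  let φ : ℕ → ContDiffBump (0 : ℝ) := fun n =>
    ⟨1 / (n + 1) / 2, 1 / (n + 1), by positivity, half_lt_self (by positivity)⟩
  have hφ : Tendsto (fun n => (φ n).rOut) atTop (𝓝 0) := tendsto_one_div_add_atTop_nhds_zero_nat
  have hae := ContDiffBump.ae_convolution_tendsto_right_of_locallyIntegrable (K := 2) (μ := volume)
    hφ (.of_forall fun n => by simp only [φ]; linarith) hg.locallyIntegrable
  rw [ae_restrict_iff' measurableSet_Ioo]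
  filter_upwards [hae] with τ hτ hτI
  rw [indicator_of_mem hτI] at hτ
  refine le_of_tendsto hτ ?_
  have h2 : ∀ᶠ n in atTop, (φ n).rOut < β - τ := hφ.eventually_lt_const (sub_pos.2 hτI.2)
  filter_upwards [h2] with n hn
  have hsm : ContDiff ℝ (⊤ : ℕ∞) fun t => (φ n).normed volume (τ - t) :=
    (φ n).contDiff_normed.comp (by fun_prop)
  have hcs : HasCompactSupport fun t => (φ n).normed volume (τ - t) :=
    (φ n).hasCompactSupport_normed.comp_homeomorph (Homeomorph.subLeft τ)
  have key := integral_mul_bump_le hα hG hG0 hH₀ hH₀0 hH₁ hH₁0 hHG hθ hθ0 hθ1 hθα hθD hineq hN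
    (ψ := fun t => (φ n).normed volume (τ - t)) hsm
    (fun t => (φ n).nonneg_normed _) hcs (r := τ + (φ n).rOut) (by linarith) (fun t ht => ?_) ?_
  · refine le_of_eq_of_le ?_ key
    rw [convolution_eq_swap, ← integral_indicator measurableSet_Ioo]
    refine integral_congr_ae (.of_forall fun t => ?_)
    simp only [ContinuousLinearMap.lsmul_apply, smul_eq_mul, indicator]
    split_ifs <;> ring
  · refine Function.notMem_support.1 fun h => ?_
    rw [(φ n).support_normed_eq, mem_ball_zero_iff, Real.norm_eq_abs, abs_lt] at h
    linarith [h.1]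
  · rw [integral_sub_left_eq_self fun t => (φ n).normed volume t]
    exact (φ n).integral_normed

theorem ae_sq_mul_le (hα : α < α') (hG : IntegrableOn G (Ioo α β)) (hG0 : ∀ t, 0 ≤ G t)
    {N₀ : ℝ} (hN : ∀ᵐ t ∂volume.restrict (Ioo α β), G t ≤ N₀)
    (hH₀ : IntegrableOn H₀ (Ioo α β)) (hH₀0 : ∀ t, 0 ≤ H₀ t)
    (hH₁ : IntegrableOn H₁ (Ioo α β)) (hH₁0 : ∀ t, 0 ≤ H₁ t)
    (hθ : ContDiff ℝ (⊤ : ℕ∞) θ) (hθ0 : ∀ t, 0 ≤ θ t) (hθ1 : ∀ t, θ t ≤ 1)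
    (hθα : ∀ t, t ≤ α' → θ t = 0) (hθD : ∀ t, |deriv θ t| ≤ D)
    (hineq : ∀ Θ : ℝ → ℝ, ContDiff ℝ (⊤ : ℕ∞) Θ → HasCompactSupport Θ → tsupport Θ ⊆ Ioo α β →
      (∀ t, 0 ≤ Θ t) →
      -(∫ t in Ioo α β, G t * (deriv Θ t / 2)) ≤ ∫ t in Ioo α β, (H₀ t + H₁ t * √(G t)) * Θ t) :
    ∀ᵐ t ∂volume.restrict (Ioo α β), θ t ^ 2 * G t ≤ 4 * D * (∫ t in Ioo α β, G t) +
      4 * (∫ t in Ioo α β, H₀ t) + 4 * (∫ t in Ioo α β, H₁ t) ^ 2 := by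
  have hHG : IntegrableOn (fun t => H₁ t * √(G t)) (Ioo α β) := by
    refine Integrable.mul_bdd (c := √N₀) hH₁
      (Real.continuous_sqrt.comp_aestronglyMeasurable hG.aestronglyMeasurable) ?_
    filter_upwards [hN] with t ht
    rw [Real.norm_of_nonneg (Real.sqrt_nonneg _)]
    exact Real.sqrt_le_sqrt ht
  set X := 4 * D * (∫ t in Ioo α β, G t) +
      4 * (∫ t in Ioo α β, H₀ t) + 4 * (∫ t in Ioo α β, H₁ t) ^ 2 with hX
  have hX0 : 0 ≤ X := by
    have := integral_nonneg (μ := volume.restrict (Ioo α β)) (f := G) hG0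
    have := integral_nonneg (μ := volume.restrict (Ioo α β)) (f := H₀) hH₀0
    have : 0 ≤ D := (abs_nonneg _).trans (hθD 0)
    positivity
  have hstep : ∀ n : ℕ, ∀ᵐ t ∂volume.restrict (Ioo α β),
      θ t ^ 2 * G t ≤ X + |N₀| * (1 / 2) ^ n := by
    intro n
    induction n with
    | zero =>
      filter_upwards [hN] with t ht
      have : θ t ^ 2 * G t ≤ 1 * G t :=
        mul_le_mul_of_nonneg_right (pow_le_one₀ (hθ0 t) (hθ1 t)) (hG0 t)
      have := le_abs_self N₀
      simp only [pow_zero, mul_one]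
      linarith
    | succ n ih =>
      filter_upwards [ae_sq_mul_le_of_bound hα hG hG0 hH₀ hH₀0 hH₁ hH₁0 hHG hθ hθ0 hθ1 hθα hθD
        hineq ih] with t ht
      refine ht.trans ?_
      have h0 : 0 ≤ X + |N₀| * (1 / 2) ^ n := by positivity
      have h3 := Real.sq_sqrt h0
      rw [pow_succ]
      nlinarith [sq_nonneg (√(X + |N₀| * (1 / 2) ^ n) - 2 * ∫ t in Ioo α β, H₁ t)]
  filter_upwards [ae_all_iff.2 hstep] with t ht
  have hlim : Tendsto (fun n : ℕ => X + |N₀| * (1 / 2) ^ n) atTop (𝓝 (X + |N₀| * 0)) :=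
    ((tendsto_pow_atTop_nhds_zero_of_lt_one (by norm_num) (by norm_num)).const_mul _).const_add _
  rw [mul_zero, add_zero] at hlim
  exact ge_of_tendsto' hlim ht

end time

theorem integral_le_sqrt_mul_sqrt {X : Type*} [MeasurableSpace X] {μ : Measure X}
    [IsFiniteMeasure μ] {f : X → ℝ} (hf : MemLp f 2 μ) (h0 : ∀ x, 0 ≤ f x) :
    ∫ x, f x ∂μ ≤ √(μ.real univ) * √(∫ x, f x ^ 2 ∂μ) := by
  have h := integral_mul_le_Lp_mul_Lq_of_nonneg (μ := μ) Real.HolderConjugate.two_two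
    (f := fun _ => 1) (g := f) (.of_forall fun _ => zero_le_one) (.of_forall h0)
    (memLp_const 1) (by simpa using hf)
  simpa [Real.sqrt_eq_rpow] using h

section positive

variable {s Λ T t₀ R : ℝ} {Ω : Set (Ed d)} {v : ℝ → Ed d → ℝ} {Dv : ℝ → Ed d → Ed d} {x₀ : Ed d}

theorem tail_eq_mul_farMass (s : ℝ) (v : ℝ → Ed d → ℝ) (x₀ : Ed d) (R t : ℝ) :
    Tail s (v t) x₀ R = R ^ 2 * farMass s v x₀ R t := rfl

theorem measurable_tail (hv : Measurable (Function.uncurry v)) :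
    Measurable fun t => Tail s (v t) x₀ R :=
  (measurable_farMass (s := s) hv).const_mul _

theorem measurable_uncurry_pos (hv : Measurable (Function.uncurry v)) :
    Measurable (Function.uncurry fun t y => max (v t y) 0) :=
  hv.max measurable_const

theorem tail_nonneg (s : ℝ) (u : Ed d → ℝ) (x₀ : Ed d) (R : ℝ) : 0 ≤ Tail s u x₀ R :=
  mul_nonneg (sq_nonneg _) (integral_nonneg fun _ => by positivity)

theorem memLp_tail_pos (hs : 0 < s) (hv : LocalWeakReg d s (Ioo 0 T) Ω v Dv)
    (hR : 0 < R) (hI : Icc (t₀ - R ^ 2) t₀ ⊆ Ioo 0 T) :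
    MemLp (fun t => Tail s (fun y => max (v t y) 0) x₀ R) 2 (volume.restrict (Iminus t₀ R)) := by
  have hm := measurable_tail (s := s) (x₀ := x₀) (R := R) (measurable_uncurry_pos hv.meas)
  refine ((memLp_farMass (x₀ := x₀) hs hv hR hI).const_mul (R ^ 2)).mono'
    hm.aestronglyMeasurable ?_
  refine (ae_restrict_iff' measurableSet_Ioo).2 ?_
  filter_upwards [ae_integrableOn_mul_jumpKer (x₀ := x₀) hs hv hR hI] with t ht htI
  rw [Real.norm_of_nonneg (tail_nonneg _ _ _ _),
    tail_eq_mul_farMass s (fun t y => max (v t y) 0)]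
  refine mul_le_mul_of_nonneg_left ?_ (sq_nonneg _)
  refine integral_mono_of_nonneg (.of_forall fun y => mul_nonneg (abs_nonneg _)
    (jumpKer_nonneg s _)) (ht htI) (.of_forall fun y => ?_)
  refine mul_le_mul_of_nonneg_right ?_ (jumpKer_nonneg s _)
  rw [abs_of_nonneg (le_max_right _ _)]
  exact max_le (le_abs_self _) (abs_nonneg _)

theorem memLp_pos (hR : 0 < R) (hv : Measurable (Function.uncurry v)) {I : Set ℝ}
    (hI : MeasurableSet I) (hV : MemLp (locFun v I x₀ R) 2) :
    MemLp (fun q : ℝ × Ed d => max (v q.1 q.2) 0) 2 (volume.restrict (I ×ˢ ball x₀ R)) := by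
  have h1 : MemLp (Function.uncurry v) 2 (volume.restrict (I ×ˢ ball x₀ R)) :=
    ((memLp_indicator_iff_restrict (hI.prod measurableSet_ball)).1 hV).mono_measure
      (Measure.restrict_mono_set _ (prod_mono subset_rfl (ball_subset_ball (by linarith))))
  refine h1.mono (hv.max measurable_const).aestronglyMeasurable (.of_forall fun q => ?_)
  rw [Real.norm_of_nonneg (le_max_right _ _)]
  exact max_le (le_abs_self _) (abs_nonneg _)

theorem ae_memLp_slice {I : Set ℝ} {B : Set (Ed d)} {w : ℝ × Ed d → ℝ} (hwm : Measurable w)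
    (hw : MemLp w 2 (volume.restrict (I ×ˢ B))) :
    ∀ᵐ t ∂volume.restrict I, MemLp (fun x => w (t, x)) 2 (volume.restrict B) := by
  have h1 := hw.integrable_sq
  rw [volume_restrict_prod_two] at h1
  filter_upwards [h1.prod_right_ae] with t ht
  exact (memLp_two_iff_integrable_sq
    (hwm.comp measurable_prodMk_left).aestronglyMeasurable).2 ht

theorem exists_ae_integral_pos_sq_le (hv : LocalWeakReg d s (Ioo 0 T) Ω v Dv) (hR : 0 < R)
    (hI : Icc (t₀ - R ^ 2) t₀ ⊆ Ioo 0 T) (hB : closedBall x₀ (2 * R) ⊆ Ω) :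
    ∃ N, ∀ᵐ t ∂volume.restrict (Iminus t₀ R), ∫ x in ball x₀ R, max (v t x) 0 ^ 2 ≤ N := by
  have hB' : closedBall x₀ R ⊆ Ω := (closedBall_subset_closedBall (by linarith)).trans hB
  obtain ⟨N, hN⟩ := hv.linfl2 _ _ hI _ (isCompact_closedBall x₀ R) hB'
  have h2 : IntegrableOn (fun q : ℝ × Ed d => v q.1 q.2 ^ 2)
      (Iminus t₀ R ×ˢ closedBall x₀ R) := by
    refine (hv.l2w12 _ _ hI _ (isCompact_closedBall x₀ R) hB').mono'
      (hv.meas.pow_const 2).aestronglyMeasurable (.of_forall fun q => ?_)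
    rw [Real.norm_of_nonneg (sq_nonneg _)]
    exact le_add_of_nonneg_right (sq_nonneg _)
  rw [IntegrableOn, volume_restrict_prod_two] at h2
  refine ⟨N, ?_⟩
  filter_upwards [hN, h2.prod_right_ae] with t ht ht2
  refine le_trans ?_ ht
  have hle : ∀ x, max (v t x) 0 ^ 2 ≤ v t x ^ 2 := fun x => by
    rw [← sq_abs (v t x)]
    exact pow_le_pow_left₀ (le_max_right _ _) (max_le (le_abs_self _) (abs_nonneg _)) 2
  exact (setIntegral_mono_set ht2 (.of_forall fun x => sq_nonneg _)
    ball_subset_closedBall.eventuallyLE).trans' (integral_mono_of_nonneg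
      (.of_forall fun x => sq_nonneg _) (IntegrableOn.mono_set ht2 ball_subset_closedBall)
        (.of_forall hle))

end positive

theorem setIntegral_prod_mul_fst {I : Set ℝ} {B : Set (Ed d)} {F : ℝ × Ed d → ℝ} {k : ℝ → ℝ}
    (hFk : IntegrableOn (fun q => F q * k q.1) (I ×ˢ B)) :
    ∫ q in I ×ˢ B, F q * k q.1 = ∫ t in I, (∫ x in B, F (t, x)) * k t := by
  simp only [← integral_mul_const]
  exact setIntegral_prod _ hFk

theorem time_inequality {s Λ T t₀ R L c : ℝ} {Ω : Set (Ed d)} {A : ℝ → Ed d → Ed d → Ed d}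
    {K : ℝ → Ed d → Ed d → ℝ} {v : ℝ → Ed d → ℝ} {Dv : ℝ → Ed d → Ed d} {x₀ : Ed d} {ζ : Ed d → ℝ}
    (hd : 2 ≤ d) (hs : s ∈ Ioo (0 : ℝ) 1) (hΛ : 1 ≤ Λ)
    (hA : VectorFieldHyp d Λ A) (hK : KernelHyp d s Λ K)
    (hv : LocalWeakReg d s (Ioo 0 T) Ω v Dv) (hR : 0 < R)
    (hI : Icc (t₀ - R ^ 2) t₀ ⊆ Ioo 0 T) (hB : closedBall x₀ (2 * R) ⊆ Ω)
    (hsub : IsLocalWeakSubsolutionHom A K (Ioo 0 T) Ω v Dv)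
    (hζ : ContDiff ℝ (⊤ : ℕ∞) ζ) (hζs : tsupport ζ ⊆ ball x₀ (23 * R / 24))
    (hζc : HasCompactSupport ζ) (hζ0 : ∀ x, 0 ≤ ζ x) (hζ1 : ∀ x, ζ x ≤ 1)
    (hζL : ∀ x, ‖fderiv ℝ ζ x‖ ≤ L) (hc0 : 0 ≤ c)
    (hk : ∫⁻ z in ball (0 : Ed d) (2 * R), ENNReal.ofReal (‖z‖ ^ 2 * jumpKer s z) ≤
      ENNReal.ofReal c) (hC : ∀ ρ, gagConst d s ρ ≠ ∞)
    {Θ : ℝ → ℝ} (hΘ : ContDiff ℝ (⊤ : ℕ∞) Θ) (hΘc : HasCompactSupport Θ)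
    (hΘs : tsupport Θ ⊆ Iminus t₀ R) (hΘ0 : ∀ t, 0 ≤ Θ t) :
    -(∫ t in Iminus t₀ R, (∫ x in ball x₀ R, max (v t x) 0 ^ 2 * ζ x ^ 2) * (deriv Θ t / 2)) ≤
      ∫ t in Iminus t₀ R, ((Λ ^ 3 * L ^ 2 + 6 * Λ * L ^ 2 * c) *
          (∫ x in ball x₀ R, max (v t x) 0 ^ 2) +
        2 * (Λ * 24 ^ ((d : ℝ) + 2 * s) / R ^ 2) * √(volume.real (ball x₀ R)) *
          Tail s (fun y => max (v t y) 0) x₀ R *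
          √(∫ x in ball x₀ R, max (v t x) 0 ^ 2 * ζ x ^ 2)) * Θ t := by
  have hE := isEnergyData_localized hd hs hΛ hA hK hv hR hI hB (hC R)
  have hg := memLp_farJump hd hs hΛ hK hv hR hI hE.memV
  obtain ⟨M, hM⟩ := hΘc.exists_bound_of_continuous hΘ.continuous
  obtain ⟨M', hM'⟩ := hΘc.deriv.exists_bound_of_continuous (hΘ.continuous_deriv (by simp))
  have hcut : IsCutoff (Iminus t₀ R) x₀ (23 * R / 24) L M ζ Θ :=
    ⟨hζ, hΘ, hζc, hΘc, hζs, hΘs, hζ0, hζ1, hζL, hΘ0, fun t => (le_abs_self _).trans (hM t)⟩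
  have key := energy_inequality (I := Iminus t₀ R) (c := c) isOpen_Ioo measure_Ioo_lt_top.ne
    hΛ hR (by linarith) hE hg
    hcut hc0 hk hC fun φ h1 h2 h3 h4 => testForm_nonpos_of_subsolution hd hs hΛ hA hK hv hR hI hB
      (hC R) hsub h1 h2 h3 h4
  have hIm : MeasurableSet (Iminus t₀ R) := measurableSet_Ioo
  have hSm : MeasurableSet (Iminus t₀ R ×ˢ ball x₀ R) := hIm.prod measurableSet_ball
  have hVv : ∀ q ∈ Iminus t₀ R ×ˢ ball x₀ R, locFun v (Iminus t₀ R) x₀ R q = v q.1 q.2 :=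
    fun q hq => indicator_of_mem (mk_mem_prod hq.1 (ball_subset_ball (by linarith) hq.2)) _
  have hw := memLp_pos hR hv.meas hIm hE.memV
  have hwm : Measurable fun q : ℝ × Ed d => max (v q.1 q.2) 0 := hv.meas.max measurable_const
  have hcζ := hζ.continuous
  have hcΘ := hΘ.continuous
  have hcΘ' : Continuous (deriv Θ) := hΘ.continuous_deriv (by simp)
  have hζ2 : ∀ x, ‖ζ x ^ 2‖ ≤ 1 := fun x => by
    rw [Real.norm_of_nonneg (sq_nonneg _)]
    exact pow_le_one₀ (hζ0 x) (hζ1 x)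
  have i0 : IntegrableOn (fun q : ℝ × Ed d => max (v q.1 q.2) 0 ^ 2) (Iminus t₀ R ×ˢ ball x₀ R) :=
    hw.integrable_sq
  have i1 : IntegrableOn (fun q : ℝ × Ed d => max (v q.1 q.2) 0 ^ 2 * ζ q.2 ^ 2)
      (Iminus t₀ R ×ˢ ball x₀ R) :=
    Integrable.mul_bdd (c := 1) i0 ((hcζ.comp continuous_snd).pow 2).aestronglyMeasurable
      (.of_forall fun q => hζ2 q.2)
  have i2 : IntegrableOn (fun q : ℝ × Ed d => max (v q.1 q.2) 0 ^ 2 * ζ q.2 ^ 2 *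
      (deriv Θ q.1 / 2)) (Iminus t₀ R ×ˢ ball x₀ R) :=
    Integrable.mul_bdd (c := M' / 2) i1
      ((hcΘ'.comp continuous_fst).div_const 2).aestronglyMeasurable
      (.of_forall fun q => by
        rw [norm_div, Real.norm_of_nonneg (zero_le_two : (0 : ℝ) ≤ 2)]
        exact div_le_div_of_nonneg_right (hM' q.1) zero_le_two)
  have i3 : IntegrableOn (fun q : ℝ × Ed d => max (v q.1 q.2) 0 ^ 2 * Θ q.1)
      (Iminus t₀ R ×ˢ ball x₀ R) :=
    Integrable.mul_bdd (c := M) i0 (hcΘ.comp continuous_fst).aestronglyMeasurable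
      (.of_forall fun q => hM q.1)
  have hwζ : MemLp (fun q : ℝ × Ed d => max (v q.1 q.2) 0 * ζ q.2 ^ 2) 2
      (volume.restrict (Iminus t₀ R ×ˢ ball x₀ R)) := by
    refine hw.mono (hwm.mul ((hcζ.comp continuous_snd).pow 2).measurable).aestronglyMeasurable
      (.of_forall fun q => ?_)
    rw [norm_mul]
    exact mul_le_of_le_one_right (norm_nonneg _) (hζ2 q.2)
  have hwζΘ : MemLp (fun q : ℝ × Ed d => max (v q.1 q.2) 0 * (ζ q.2 ^ 2 * Θ q.1)) 2
      (volume.restrict (Iminus t₀ R ×ˢ ball x₀ R)) := by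
    refine (hwζ.const_mul M).mono (hwm.mul (((hcζ.comp continuous_snd).pow 2).mul
      (hcΘ.comp continuous_fst)).measurable).aestronglyMeasurable (.of_forall fun q => ?_)
    rw [← mul_assoc, norm_mul, norm_mul M, mul_comm]
    exact mul_le_mul_of_nonneg_right ((hM q.1).trans (le_abs_self _)) (norm_nonneg _)
  have hT : MemLp (fun q : ℝ × Ed d => Tail s (fun y => max (v q.1 y) 0) x₀ R) 2
      (volume.restrict (Iminus t₀ R ×ˢ ball x₀ R)) := by
    rw [volume_restrict_prod_two]
    have : IsFiniteMeasure ((volume : Measure (Ed d)).restrict (ball x₀ R)) :=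
      ⟨by rw [Measure.restrict_apply_univ]; exact measure_ball_lt_top⟩
    exact (memLp_tail_pos hs.1 hv hR hI).comp_fst _
  set P := Λ * 24 ^ ((d : ℝ) + 2 * s) / R ^ 2 with hP
  have hP0 : 0 ≤ P := by positivity
  have i4 : IntegrableOn (fun q : ℝ × Ed d => max (v q.1 q.2) 0 * ζ q.2 ^ 2 *
      (P * Tail s (fun y => max (v q.1 y) 0) x₀ R * Θ q.1)) (Iminus t₀ R ×ˢ ball x₀ R) := by
    refine ((integrable_mul_of_memLp hwζΘ hT).const_mul P).congr (.of_forall fun q => ?_)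
    ring
  have e1 : ∫ q in Iminus t₀ R ×ˢ ball x₀ R, max (locFun v (Iminus t₀ R) x₀ R q) 0 *
      (max (locFun v (Iminus t₀ R) x₀ R q) 0 * (ζ q.2 ^ 2 * deriv Θ q.1 / 2)) =
      ∫ t in Iminus t₀ R, (∫ x in ball x₀ R, max (v t x) 0 ^ 2 * ζ x ^ 2) * (deriv Θ t / 2) := by
    refine Eq.trans ?_ (setIntegral_prod_mul_fst
      (F := fun q : ℝ × Ed d => max (v q.1 q.2) 0 ^ 2 * ζ q.2 ^ 2) (k := fun t => deriv Θ t / 2) i2)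
    refine setIntegral_congr_fun hSm fun q hq => ?_
    simp only [hVv q hq]
    ring
  have e2 : ∫ q in Iminus t₀ R ×ˢ ball x₀ R, max (locFun v (Iminus t₀ R) x₀ R q) 0 *
      (max (locFun v (Iminus t₀ R) x₀ R q) 0 * Θ q.1) =
      ∫ t in Iminus t₀ R, (∫ x in ball x₀ R, max (v t x) 0 ^ 2) * Θ t := by
    refine Eq.trans ?_ (setIntegral_prod_mul_fst
      (F := fun q : ℝ × Ed d => max (v q.1 q.2) 0 ^ 2) (k := Θ) i3)
    refine setIntegral_congr_fun hSm fun q hq => ?_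
    simp only [hVv q hq]
    ring
  have e3 : -(∫ q in Iminus t₀ R ×ˢ ball x₀ R, farJump K v (Iminus t₀ R) x₀ R q *
      (max (locFun v (Iminus t₀ R) x₀ R q) 0 * (ζ q.2 ^ 2 * Θ q.1))) ≤
      ∫ t in Iminus t₀ R, (∫ x in ball x₀ R, max (v t x) 0 * ζ x ^ 2) *
        (P * Tail s (fun y => max (v t y) 0) x₀ R * Θ t) := by
    refine LE.le.trans_eq ?_ (setIntegral_prod_mul_fst
      (F := fun q : ℝ × Ed d => max (v q.1 q.2) 0 * ζ q.2 ^ 2)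
      (k := fun t => P * Tail s (fun y => max (v t y) 0) x₀ R * Θ t) i4)
    rw [setIntegral_congr_fun hSm (g := fun q => farJump K v (Iminus t₀ R) x₀ R q *
        (max (v q.1 q.2) 0 * (ζ q.2 ^ 2 * Θ q.1))) (fun q hq => by simp only [hVv q hq]),
      ← integral_neg]
    refine integral_mono_ae (integrable_mul_of_memLp (hg.restrict _) hwζΘ).neg i4 ?_
    filter_upwards [ae_restrict_mem hSm, ae_restrict_of_ae (ae_prod_of_ae_fst (d := d)
      (ae_integrableOn_mul_jumpKer (x₀ := x₀) hs.1 hv hR hI))] with q hq ht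
    change -(farJump K v (Iminus t₀ R) x₀ R q * (max (v q.1 q.2) 0 * (ζ q.2 ^ 2 * Θ q.1))) ≤ _
    by_cases hx : q.2 ∈ ball x₀ (23 * R / 24)
    · have h1 := neg_tail_mul_le_farJump_mul hd hs hΛ hK hv.meas hR (mk_mem_prod hq.1 hx)
        (ht hq.1)
      have h2 := mul_le_mul_of_nonneg_right h1 (mul_nonneg (sq_nonneg (ζ q.2)) (hΘ0 q.1))
      calc _ = -(farJump K v (Iminus t₀ R) x₀ R q * max (v q.1 q.2) 0 *
            (ζ q.2 ^ 2 * Θ q.1)) := by ring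
        _ ≤ -(-(P * Tail s (fun y => max (v q.1 y) 0) x₀ R * max (v q.1 q.2) 0) *
            (ζ q.2 ^ 2 * Θ q.1)) := neg_le_neg h2
        _ = _ := by ring
    · have : ζ q.2 = 0 := image_eq_zero_of_notMem_tsupport fun h => hx (hζs h)
      simp [this]
  rw [e1, e2] at key
  have hball : IsFiniteMeasure ((volume : Measure (Ed d)).restrict (ball x₀ R)) :=
    ⟨by rw [Measure.restrict_apply_univ]; exact measure_ball_lt_top⟩
  have hsl : ∀ᵐ t ∂volume.restrict (Iminus t₀ R), ∫ x in ball x₀ R, max (v t x) 0 * ζ x ^ 2 ≤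
      √(volume.real (ball x₀ R)) * √(∫ x in ball x₀ R, max (v t x) 0 ^ 2 * ζ x ^ 2) := by
    have i1' := i1
    rw [IntegrableOn, volume_restrict_prod_two] at i1'
    filter_upwards [ae_memLp_slice (hwm.mul ((hcζ.comp continuous_snd).pow 2).measurable) hwζ,
      i1'.prod_right_ae] with t ht ht1
    refine (integral_le_sqrt_mul_sqrt ht fun x =>
      mul_nonneg (le_max_right _ _) (sq_nonneg _)).trans ?_
    rw [measureReal_restrict_apply_univ]
    refine mul_le_mul_of_nonneg_left (Real.sqrt_le_sqrt ?_) (Real.sqrt_nonneg _)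
    refine integral_mono ht.integrable_sq ht1 fun x => ?_
    change (max (v t x) 0 * ζ x ^ 2) ^ 2 ≤ max (v t x) 0 ^ 2 * ζ x ^ 2
    rw [mul_pow]
    exact mul_le_mul_of_nonneg_left (pow_le_of_le_one (sq_nonneg _)
      (pow_le_one₀ (hζ0 x) (hζ1 x)) two_ne_zero) (sq_nonneg _)
  have j0 : IntegrableOn (fun t => ∫ x in ball x₀ R, max (v t x) 0 ^ 2 * ζ x ^ 2)
      (Iminus t₀ R) := by
    rw [IntegrableOn, volume_restrict_prod_two] at i1
    exact i1.integral_prod_left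
  have j1 : IntegrableOn (fun t => (∫ x in ball x₀ R, max (v t x) 0 ^ 2) * Θ t) (Iminus t₀ R) := by
    rw [IntegrableOn, volume_restrict_prod_two] at i0
    exact Integrable.mul_bdd (c := M) i0.integral_prod_left hcΘ.aestronglyMeasurable (.of_forall hM)
  have j2 : IntegrableOn (fun t => (∫ x in ball x₀ R, max (v t x) 0 * ζ x ^ 2) *
      (P * Tail s (fun y => max (v t y) 0) x₀ R * Θ t)) (Iminus t₀ R) := by
    simp only [← integral_mul_const]
    rw [IntegrableOn, volume_restrict_prod_two] at i4
    exact i4.integral_prod_left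
  have hsq : MemLp (fun t => √(∫ x in ball x₀ R, max (v t x) 0 ^ 2 * ζ x ^ 2)) 2
      (volume.restrict (Iminus t₀ R)) := by
    refine (memLp_two_iff_integrable_sq (Real.continuous_sqrt.comp_aestronglyMeasurable
      j0.aestronglyMeasurable)).2 (j0.congr (.of_forall fun t => ?_))
    exact (Real.sq_sqrt (integral_nonneg fun x => mul_nonneg (sq_nonneg _) (sq_nonneg _))).symm
  have j3 : IntegrableOn (fun t => √(volume.real (ball x₀ R)) *
      √(∫ x in ball x₀ R, max (v t x) 0 ^ 2 * ζ x ^ 2) *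
      (P * Tail s (fun y => max (v t y) 0) x₀ R * Θ t)) (Iminus t₀ R) := by
    have h1 := (Integrable.mul_bdd (c := M) (integrable_mul_of_memLp hsq
      (memLp_tail_pos (x₀ := x₀) hs.1 hv hR hI)) hcΘ.aestronglyMeasurable
        (.of_forall hM)).const_mul (√(volume.real (ball x₀ R)) * P)
    refine h1.congr (.of_forall fun t => ?_)
    ring
  have e4 := integral_mono_ae j2 j3 (by
    filter_upwards [hsl] with t ht
    exact mul_le_mul_of_nonneg_right ht (mul_nonneg (mul_nonneg hP0 (tail_nonneg _ _ _ _)) (hΘ0 t)))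
  have e5 : ∫ t in Iminus t₀ R, ((Λ ^ 3 * L ^ 2 + 6 * Λ * L ^ 2 * c) *
          (∫ x in ball x₀ R, max (v t x) 0 ^ 2) +
        2 * P * √(volume.real (ball x₀ R)) * Tail s (fun y => max (v t y) 0) x₀ R *
          √(∫ x in ball x₀ R, max (v t x) 0 ^ 2 * ζ x ^ 2)) * Θ t =
      (Λ ^ 3 * L ^ 2 + 6 * Λ * L ^ 2 * c) *
        (∫ t in Iminus t₀ R, (∫ x in ball x₀ R, max (v t x) 0 ^ 2) * Θ t) +
      2 * ∫ t in Iminus t₀ R, √(volume.real (ball x₀ R)) *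
        √(∫ x in ball x₀ R, max (v t x) 0 ^ 2 * ζ x ^ 2) *
        (P * Tail s (fun y => max (v t y) 0) x₀ R * Θ t) := by
    rw [← integral_const_mul, ← integral_const_mul,
      ← integral_add (j1.const_mul _) (j3.const_mul 2)]
    refine integral_congr_ae (.of_forall fun t => ?_)
    ring
  rw [e5]
  linarith

theorem exists_lintegral_ball_double_le (hd : 2 ≤ d) {s : ℝ} (hs : s ∈ Ioo (0 : ℝ) 1) :
    ∃ C : ℝ, 0 < C ∧ ∀ R ∈ Ioc (0 : ℝ) 1,
      ∫⁻ z in ball (0 : Ed d) (2 * R), ENNReal.ofReal (‖z‖ ^ 2 * jumpKer s z) ≤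
        ENNReal.ofReal C := by
  obtain ⟨C, hC, h⟩ := exists_lintegral_ball_sq_mul_jumpKer_le hd hs
  refine ⟨C * 2 ^ (2 - 2 * s), by positivity, fun R hR =>
    (h (2 * R) (by linarith [hR.1])).trans (ENNReal.ofReal_le_ofReal ?_)⟩
  exact mul_le_mul_of_nonneg_left (Real.rpow_le_rpow (by linarith [hR.1]) (by linarith [hR.2])
    (by linarith [hs.2])) hC.le

theorem gagConst_ne_top (hd : 2 ≤ d) {s : ℝ} (hs : s ∈ Ioo (0 : ℝ) 1) (ρ : ℝ) :
    gagConst d s ρ ≠ ∞ := by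
  obtain ⟨C, -, h⟩ := exists_lintegral_ball_sq_mul_jumpKer_le hd hs
  refine ENNReal.rpow_ne_top_of_nonneg (by norm_num) ?_
  rcases le_or_gt ρ 0 with hρ | hρ
  · simp [ball_eq_empty.2 (by linarith : 2 * ρ ≤ 0)]
  · exact ((h (2 * ρ) (by linarith)).trans_lt ENNReal.ofReal_lt_top).ne

theorem exists_ae_integral_pos_sq_le_of_subsolution (hd : 2 ≤ d) {s Λ : ℝ}
    (hs : s ∈ Ioo (0 : ℝ) 1) (hΛ : 1 ≤ Λ) :
    ∃ C : ℝ, 0 < C ∧ ∀ (T : ℝ) (Ω : Set (Ed d)) (A : ℝ → Ed d → Ed d → Ed d),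
      VectorFieldHyp d Λ A → ∀ K : ℝ → Ed d → Ed d → ℝ, KernelHyp d s Λ K →
      ∀ (v : ℝ → Ed d → ℝ) (Dv : ℝ → Ed d → Ed d), LocalWeakReg d s (Ioo 0 T) Ω v Dv →
      ∀ R ∈ Ioc (0 : ℝ) 1, ∀ (t₀ : ℝ) (x₀ : Ed d), Icc (t₀ - R ^ 2) t₀ ⊆ Ioo 0 T →
      closedBall x₀ (2 * R) ⊆ Ω → IsLocalWeakSubsolutionHom A K (Ioo 0 T) Ω v Dv →
      ∀ᵐ t ∂volume.restrict (Iminus t₀ (5 * R / 6)),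
        ∫ x in ball x₀ (5 * R / 6), max (v t x) 0 ^ 2 ≤
          C / R ^ 2 * (∫ τ in Iminus t₀ R, ∫ x in ball x₀ R, max (v τ x) 0 ^ 2) +
          C * volume.real (ball x₀ R) *
            ((∫ τ in Iminus t₀ R, Tail s (fun y => max (v τ y) 0) x₀ R) / R ^ 2) ^ 2 := by
  obtain ⟨C₁, hC₁, hζ⟩ := exists_scaled_bump (Ed d) (a := 5 / 6) (b := 11 / 12) (by norm_num)
    (by norm_num)
  obtain ⟨C₂, hC₂, hθ⟩ := exists_scaled_bump ℝ (a := 25 / 36) (b := 8 / 9) (by norm_num)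
    (by norm_num)
  obtain ⟨C₃, hC₃, hk⟩ := exists_lintegral_ball_double_le hd hs
  have hΛ0 : 0 < Λ := by linarith
  set p := Λ * 24 ^ ((d : ℝ) + 2 * s) with hp
  have hp0 : 0 < p := by positivity
  set κ := (Λ ^ 3 + 6 * Λ * C₃) * C₁ ^ 2 with hκ
  have hκ0 : 0 < κ := by positivity
  refine ⟨4 * C₂ + 4 * κ + 16 * p ^ 2, by positivity, ?_⟩
  intro T Ω A hA K hK v Dv hv R hR t₀ x₀ hI hB hsub
  have hR0 := hR.1
  obtain ⟨ζ, hζ, hζs, hζ0, hζ1, hζe, hζD⟩ := hζ x₀ R hR0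
  obtain ⟨θ, hθ, hθs, hθ0, hθ1, hθe, hθD⟩ := hθ t₀ (R ^ 2) (by positivity)
  have hR2 : 0 < R ^ 2 := by positivity
  have hIm : MeasurableSet (Iminus t₀ R) := measurableSet_Ioo
  have hζc : HasCompactSupport ζ := HasCompactSupport.of_support_subset_isCompact
    (isCompact_closedBall x₀ (11 / 12 * R)) ((subset_tsupport ζ).trans hζs)
  have hE := isEnergyData_localized hd hs hΛ hA hK hv hR0 hI hB (gagConst_ne_top hd hs R)
  have hwm : Measurable fun q : ℝ × Ed d => max (v q.1 q.2) 0 := hv.meas.max measurable_const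
  have hw := memLp_pos hR0 hv.meas hIm hE.memV
  have i0 : IntegrableOn (fun q : ℝ × Ed d => max (v q.1 q.2) 0 ^ 2) (Iminus t₀ R ×ˢ ball x₀ R) :=
    hw.integrable_sq
  have hζ2 : ∀ x, ‖ζ x ^ 2‖ ≤ 1 := fun x => by
    rw [Real.norm_of_nonneg (sq_nonneg _)]
    exact pow_le_one₀ (hζ0 x) (hζ1 x)
  have i1 : IntegrableOn (fun q : ℝ × Ed d => max (v q.1 q.2) 0 ^ 2 * ζ q.2 ^ 2)
      (Iminus t₀ R ×ˢ ball x₀ R) :=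
    Integrable.mul_bdd (c := 1) i0 ((hζ.continuous.comp continuous_snd).pow 2).aestronglyMeasurable
      (.of_forall fun q => hζ2 q.2)
  rw [IntegrableOn, volume_restrict_prod_two] at i0 i1
  have hV : IntegrableOn (fun t => ∫ x in ball x₀ R, max (v t x) 0 ^ 2) (Iminus t₀ R) :=
    i0.integral_prod_left
  have hG : IntegrableOn (fun t => ∫ x in ball x₀ R, max (v t x) 0 ^ 2 * ζ x ^ 2) (Iminus t₀ R) :=
    i1.integral_prod_left
  have hV0 : ∀ t, 0 ≤ ∫ x in ball x₀ R, max (v t x) 0 ^ 2 := fun t =>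
    integral_nonneg fun x => sq_nonneg _
  have hG0 : ∀ t, 0 ≤ ∫ x in ball x₀ R, max (v t x) 0 ^ 2 * ζ x ^ 2 := fun t =>
    integral_nonneg fun x => mul_nonneg (sq_nonneg _) (sq_nonneg _)
  have hGV : ∀ᵐ t ∂volume.restrict (Iminus t₀ R), ∫ x in ball x₀ R, max (v t x) 0 ^ 2 * ζ x ^ 2 ≤
      ∫ x in ball x₀ R, max (v t x) 0 ^ 2 := by
    filter_upwards [i0.prod_right_ae, i1.prod_right_ae] with t h0 h1
    exact integral_mono h1 h0 fun x => mul_le_of_le_one_right (sq_nonneg _)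
      ((le_abs_self _).trans (hζ2 x))
  obtain ⟨N, hN⟩ := exists_ae_integral_pos_sq_le hv hR0 hI hB
  have hTi : IntegrableOn (fun t => Tail s (fun y => max (v t y) 0) x₀ R) (Iminus t₀ R) := by
    have : IsFiniteMeasure ((volume : Measure ℝ).restrict (Iminus t₀ R)) :=
      ⟨by rw [Measure.restrict_apply_univ]; exact measure_Ioo_lt_top⟩
    exact (memLp_tail_pos hs.1 hv hR0 hI).integrable one_le_two
  set m := volume.real (ball x₀ R) with hm
  have hm0 : 0 ≤ m := measureReal_nonneg
  have hmain := ae_sq_mul_le (α := t₀ - R ^ 2) (α' := t₀ - 17 / 18 * R ^ 2) (β := t₀)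
    (D := C₂ / R ^ 2) (θ := θ)
    (G := fun t => ∫ x in ball x₀ R, max (v t x) 0 ^ 2 * ζ x ^ 2)
    (H₀ := fun t => (Λ ^ 3 * (C₁ / R) ^ 2 + 6 * Λ * (C₁ / R) ^ 2 * C₃) *
      ∫ x in ball x₀ R, max (v t x) 0 ^ 2)
    (H₁ := fun t => 2 * (p / R ^ 2) * √m * Tail s (fun y => max (v t y) 0) x₀ R)
    (by linarith) hG hG0 (N₀ := N) (by
      filter_upwards [hGV, hN] with t h1 h2
      exact h1.trans h2)
    (hV.const_mul _) (fun t => mul_nonneg (by positivity) (hV0 t)) (hTi.const_mul _)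
    (fun t => mul_nonneg (by positivity) (tail_nonneg _ _ _ _)) hθ hθ0 hθ1
    (fun t ht => image_eq_zero_of_notMem_tsupport fun h => by
      have := hθs h
      rw [Real.closedBall_eq_Icc] at this
      linarith [this.1])
    (fun t => by
      rw [← Real.norm_eq_abs, norm_deriv_eq_norm_fderiv]
      exact hθD t)
    (fun Θ h1 h2 h3 h4 => time_inequality hd hs hΛ hA hK hv hR0 hI hB hsub hζ
      (hζs.trans (closedBall_subset_ball (by linarith))) hζc hζ0 hζ1 hζD hC₃.le (hk R hR)
      (gagConst_ne_top hd hs) h1 h2 h3 h4)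
  have hsubI : Iminus t₀ (5 * R / 6) ⊆ Iminus t₀ R := Ioo_subset_Ioo (by nlinarith) le_rfl
  have hI' : MeasurableSet (Iminus t₀ (5 * R / 6)) := measurableSet_Ioo
  filter_upwards [ae_restrict_of_ae_restrict_of_subset hsubI hmain,
    ae_restrict_of_ae_restrict_of_subset hsubI i1.prod_right_ae, ae_restrict_mem hI']
    with t ht ht1 htI
  have hθt : θ t = 1 := hθe t (by
    rw [Real.closedBall_eq_Icc]
    exact ⟨by nlinarith [htI.1], by nlinarith [htI.2]⟩)
  rw [hθt, one_pow, one_mul, integral_const_mul, integral_const_mul] at ht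
  have hle : ∫ x in ball x₀ (5 * R / 6), max (v t x) 0 ^ 2 ≤
      ∫ x in ball x₀ R, max (v t x) 0 ^ 2 * ζ x ^ 2 := by
    calc _ = ∫ x in ball x₀ (5 * R / 6), max (v t x) 0 ^ 2 * ζ x ^ 2 := by
          refine setIntegral_congr_fun measurableSet_ball fun x hx => ?_
          have : ζ x = 1 := hζe x (closedBall_subset_closedBall (by linarith)
            (ball_subset_closedBall hx))
          simp [this]
      _ ≤ _ := setIntegral_mono_set ht1
          (.of_forall fun x => mul_nonneg (sq_nonneg _) (sq_nonneg _))
          (ball_subset_ball (by linarith)).eventuallyLE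
  have hGVi := integral_mono_ae hG hV hGV
  have hVi : 0 ≤ ∫ t in Iminus t₀ R, ∫ x in ball x₀ R, max (v t x) 0 ^ 2 := integral_nonneg hV0
  refine (hle.trans ht).trans ?_
  change 4 * (C₂ / R ^ 2) * (∫ t in Iminus t₀ R, ∫ x in ball x₀ R, max (v t x) 0 ^ 2 * ζ x ^ 2) +
    4 * (_ * ∫ t in Iminus t₀ R, ∫ x in ball x₀ R, max (v t x) 0 ^ 2) +
    4 * (_ * ∫ t in Iminus t₀ R, Tail s (fun y => max (v t y) 0) x₀ R) ^ 2 ≤ _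
  set V := ∫ t in Iminus t₀ R, ∫ x in ball x₀ R, max (v t x) 0 ^ 2
  set W := ∫ t in Iminus t₀ R, Tail s (fun y => max (v t y) 0) x₀ R
  calc _ ≤ 4 * (C₂ / R ^ 2) * V +
        4 * ((Λ ^ 3 * (C₁ / R) ^ 2 + 6 * Λ * (C₁ / R) ^ 2 * C₃) * V) +
        4 * (2 * (p / R ^ 2) * √m * W) ^ 2 := by gcongr
    _ = (4 * C₂ + 4 * κ) / R ^ 2 * V + 16 * p ^ 2 * m * (W / R ^ 2) ^ 2 := by
        rw [mul_pow, mul_pow _ (√m), Real.sq_sqrt hm0, hκ]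
        field_simp
        ring
    _ ≤ _ := by
        have h1 : 4 * C₂ + 4 * κ ≤ 4 * C₂ + 4 * κ + 16 * p ^ 2 := by nlinarith [sq_nonneg p]
        have h2 : 16 * p ^ 2 ≤ 4 * C₂ + 4 * κ + 16 * p ^ 2 := by linarith
        exact add_le_add
          (mul_le_mul_of_nonneg_right (div_le_div_of_nonneg_right h1 hR2.le) hVi)
          (mul_le_mul_of_nonneg_right (mul_le_mul_of_nonneg_right h2 hm0) (sq_nonneg _))

theorem le_sqrt_sq (a : ℝ) : a ≤ √a ^ 2 := by
  rcases le_or_gt 0 a with h | h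
  · exact (Real.sq_sqrt h).ge
  · exact h.le.trans (sq_nonneg _)

theorem sqrt_setAverage_le {C R t₀ : ℝ} {x₀ : Ed d} (hC : 0 ≤ C) (hR : 0 < R) {f : Ed d → ℝ}
    {F : ℝ → Ed d → ℝ} {H : ℝ → ℝ} (hH : ∀ t, 0 ≤ H t)
    (h : ∫ x in ball x₀ (5 * R / 6), f x ≤
      C / R ^ 2 * (∫ τ in Iminus t₀ R, ∫ x in ball x₀ R, F τ x) +
        C * volume.real (ball x₀ R) * ((∫ τ in Iminus t₀ R, H τ) / R ^ 2) ^ 2) :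
    √(⨍ x in ball x₀ (5 * R / 6), f x) ≤
      √(C * (6 / 5) ^ d) * √(⨍ τ in Iminus t₀ R, ⨍ x in ball x₀ R, F τ x) +
        √(C * (6 / 5) ^ d) * ⨍ τ in Iminus t₀ R, H τ := by
  have hm : 0 < volume.real (ball x₀ R) :=
    ENNReal.toReal_pos (measure_ball_pos _ _ hR).ne' measure_ball_lt_top.ne
  have hm' : volume.real (ball x₀ (5 * R / 6)) = (5 / 6) ^ d * volume.real (ball x₀ R) := by
    rw [show 5 * R / 6 = 5 / 6 * R by ring, measureReal_def,
      Measure.addHaar_ball_mul_of_pos _ _ (by norm_num), ENNReal.toReal_mul, measureReal_def,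
      finrank_euclideanSpace_fin, ENNReal.toReal_ofReal (by positivity),
      Measure.addHaar_ball_center volume x₀]
  have hI : volume.real (Iminus t₀ R) = R ^ 2 := by
    rw [Iminus, Real.volume_real_Ioo_of_le (by nlinarith)]
    ring
  simp only [setAverage_eq, smul_eq_mul, hm', hI]
  rw [integral_const_mul]
  set V := ∫ τ in Iminus t₀ R, ∫ x in ball x₀ R, F τ x
  set m := volume.real (ball x₀ R)
  have hW : 0 ≤ ∫ τ in Iminus t₀ R, H τ := integral_nonneg hH
  set W := ∫ τ in Iminus t₀ R, H τ
  have hle : ((5 / 6) ^ d * m)⁻¹ * (∫ x in ball x₀ (5 * R / 6), f x) ≤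
      C * (6 / 5) ^ d * ((R ^ 2)⁻¹ * (m⁻¹ * V) + ((R ^ 2)⁻¹ * W) ^ 2) := by
    calc _ ≤ ((5 / 6) ^ d * m)⁻¹ * (C / R ^ 2 * V + C * m * (W / R ^ 2) ^ 2) := by gcongr
      _ = _ := by
          rw [mul_inv, ← inv_pow, inv_div]
          field_simp
  rw [← mul_add]
  refine (Real.sqrt_le_sqrt hle).trans ?_
  rw [Real.sqrt_mul (by positivity)]
  refine mul_le_mul_of_nonneg_left ?_ (Real.sqrt_nonneg _)
  have hW' : 0 ≤ (R ^ 2)⁻¹ * W := by positivity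
  refine Real.sqrt_le_iff.2 ⟨by positivity, ?_⟩
  nlinarith [le_sqrt_sq ((R ^ 2)⁻¹ * (m⁻¹ * V)),
    mul_nonneg (Real.sqrt_nonneg ((R ^ 2)⁻¹ * (m⁻¹ * V))) hW']

theorem VectorFieldHyp.reflect {Λ : ℝ} {A : ℝ → Ed d → Ed d → Ed d} (hA : VectorFieldHyp d Λ A) :
    VectorFieldHyp d Λ fun t x ξ => -A t x (-ξ) where
  meas ξ := (hA.meas (-ξ)).neg
  cont t x := ((hA.cont t x).comp continuous_neg).neg
  growth t x ξ := by simpa using hA.growth t x (-ξ)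
  monotone t x ξ η := by
    have h := hA.monotone t x (-η) (-ξ)
    rwa [show -ξ - -η = η - ξ by abel, show A t x (-ξ) - A t x (-η) =
      -A t x (-η) - -A t x (-ξ) by abel] at h

theorem LocalWeakReg.reflect {s : ℝ} {J : Set ℝ} {Ω : Set (Ed d)} {v : ℝ → Ed d → ℝ}
    {Dv : ℝ → Ed d → Ed d} (hv : LocalWeakReg d s J Ω v Dv) :
    LocalWeakReg d s J Ω (fun t x => -v t x) (fun t x => -Dv t x) where
  meas := hv.meas.neg
  measD := hv.measD.neg
  grad t ht φ h1 h2 h3 e := by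
    simp only [inner_neg_left, neg_mul, mul_neg, integral_neg, hv.grad t ht φ h1 h2 h3 e]
  l2w12 := by simpa only [neg_sq, norm_neg] using hv.l2w12
  linfl2 := by simpa only [neg_sq] using hv.linfl2
  tail_ae := by simpa only [abs_neg] using hv.tail_ae
  tail_l2 := by simpa only [abs_neg] using hv.tail_l2

theorem mixedLHS_reflect (A : ℝ → Ed d → Ed d → Ed d) (K : ℝ → Ed d → Ed d → ℝ) (Ω : Set (Ed d))
    (u : ℝ → Ed d → ℝ) (Du : ℝ → Ed d → Ed d) (φ : ℝ → Ed d → ℝ) (t₁ t₂ : ℝ) :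
    mixedLHS (fun t x ξ => -A t x (-ξ)) K Ω (fun t x => -u t x) (fun t x => -Du t x) φ t₁ t₂ =
      mixedLHS A K Ω u Du (fun t x => -φ t x) t₁ t₂ := by
  have hg : ∀ t x, gradient (fun y => -φ t y) x = -gradient (φ t) x := fun t x => by
    rw [gradient, gradient, fderiv_fun_neg, map_neg]
  have hJ : ∀ t x y, (-u t x - -u t y) * (φ t x - φ t y) * K t x y =
      (u t x - u t y) * (-φ t x - -φ t y) * K t x y := fun t x y => by ring
  simp only [mixedLHS, hg, hJ, deriv.fun_neg, neg_neg, inner_neg_left, inner_neg_right, neg_mul,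
    mul_neg]

theorem IsTestFunction.neg {Ω : Set (Ed d)} {φ : ℝ → Ed d → ℝ} (hφ : IsTestFunction Ω φ) :
    IsTestFunction Ω fun t x => -φ t x := by
  obtain ⟨h1, Kc, h2, h3, h4⟩ := hφ
  refine ⟨h1.neg, Kc, h2, h3, fun t => ?_⟩
  have : tsupport (fun x => -φ t x) = tsupport (φ t) := by
    simp only [tsupport, Function.support_fun_neg]
  exact this ▸ h4 t

theorem IsLocalWeakSupersolutionHom.reflect {A : ℝ → Ed d → Ed d → Ed d}
    {K : ℝ → Ed d → Ed d → ℝ} {J : Set ℝ} {Ω : Set (Ed d)} {v : ℝ → Ed d → ℝ}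
    {Dv : ℝ → Ed d → Ed d} (h : IsLocalWeakSupersolutionHom A K J Ω v Dv) :
    IsLocalWeakSubsolutionHom (fun t x ξ => -A t x (-ξ)) K J Ω (fun t x => -v t x)
      (fun t x => -Dv t x) := by
  intro t₁ t₂ h12 hJ φ hφ hφ0
  rw [mixedLHS_reflect]
  exact h t₁ t₂ h12 hJ _ hφ.neg fun t x => neg_nonpos.2 (hφ0 t x)

theorem Icc_subset_and_closedBall_subset {R t₀ : ℝ} {x₀ : Ed d} {J : Set ℝ} {Ω : Set (Ed d)}
    (hR : 0 < R) (h : closure (Iminus t₀ (2 * R) ×ˢ ball x₀ (2 * R)) ⊆ J ×ˢ Ω) :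
    Icc (t₀ - R ^ 2) t₀ ⊆ J ∧ closedBall x₀ (2 * R) ⊆ Ω := by
  have hlt : t₀ - (2 * R) ^ 2 < t₀ := sub_lt_self _ (by positivity)
  rw [closure_prod_eq, Iminus, closure_Ioo hlt.ne, closure_ball _ (by positivity)] at h
  refine ⟨fun t ht => (h (mk_mem_prod (a := t) (b := x₀) ⟨by nlinarith [ht.1], ht.2⟩
    (mem_closedBall_self (by positivity)))).1, fun x hx => (h (mk_mem_prod (a := t₀) (b := x)
    ⟨hlt.le, le_rfl⟩ hx)).2⟩

/-- **Lemma 3.1: supremum-in-time `L²` bound with `L¹` tail.** -/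
theorem sup_in_time_L2_bound_with_L1_tail
    (d : ℕ) (hd : 2 ≤ d) (s Λ : ℝ) (hs : s ∈ Set.Ioo (0 : ℝ) 1) (hΛ : 1 ≤ Λ) :
    ∃ C : ℝ, 0 < C ∧
      ∀ (T : ℝ), 0 < T → ∀ (Ω : Set (Ed d)), IsOpen Ω → Bornology.IsBounded Ω →
      ∀ (A : ℝ → Ed d → Ed d → Ed d), VectorFieldHyp d Λ A →
      ∀ (K : ℝ → Ed d → Ed d → ℝ), KernelHyp d s Λ K →
      ∀ (v : ℝ → Ed d → ℝ) (Dv : ℝ → Ed d → Ed d),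
        LocalWeakReg d s (Set.Ioo 0 T) Ω v Dv →
        ∀ R ∈ Set.Ioc (0 : ℝ) 1, ∀ (t₀ : ℝ) (x₀ : Ed d),
          closure ((Iminus t₀ (2 * R)) ×ˢ Metric.ball x₀ (2 * R)) ⊆ (Set.Ioo 0 T) ×ˢ Ω →
          -- subsolution case, with `v₊ = max v 0`
          ((IsLocalWeakSubsolutionHom A K (Set.Ioo 0 T) Ω v Dv →
            ∀ᵐ t ∂(volume.restrict (Iminus t₀ (5 * R / 6))),
              Real.sqrt (⨍ x in Metric.ball x₀ (5 * R / 6), (max (v t x) 0) ^ 2) ≤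
                C * Real.sqrt (⨍ τ in Iminus t₀ R, ⨍ x in Metric.ball x₀ R,
                      (max (v τ x) 0) ^ 2)
                  + C * ⨍ τ in Iminus t₀ R, Tail s (fun y => max (v τ y) 0) x₀ R) ∧
          -- supersolution case, with `v₋ = max (-v) 0`
          (IsLocalWeakSupersolutionHom A K (Set.Ioo 0 T) Ω v Dv →
            ∀ᵐ t ∂(volume.restrict (Iminus t₀ (5 * R / 6))),
              Real.sqrt (⨍ x in Metric.ball x₀ (5 * R / 6), (max (-v t x) 0) ^ 2) ≤
                C * Real.sqrt (⨍ τ in Iminus t₀ R, ⨍ x in Metric.ball x₀ R,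
                      (max (-v τ x) 0) ^ 2)
                  + C * ⨍ τ in Iminus t₀ R, Tail s (fun y => max (-v τ y) 0) x₀ R)) := by
  obtain ⟨C, hC, h⟩ := exists_ae_integral_pos_sq_le_of_subsolution hd hs hΛ
  refine ⟨√(C * (6 / 5) ^ d), by positivity, ?_⟩
  intro T hT Ω hΩ hΩb A hA K hK v Dv hv R hR t₀ x₀ hcl
  obtain ⟨hI, hB⟩ := Icc_subset_and_closedBall_subset hR.1 hcl
  refine ⟨fun hsub => ?_, fun hsup => ?_⟩
  · filter_upwards [h T Ω A hA K hK v Dv hv R hR t₀ x₀ hI hB hsub] with t ht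
    exact sqrt_setAverage_le hC.le hR.1 (fun τ => tail_nonneg _ _ _ _) ht
  · filter_upwards [h T Ω _ hA.reflect K hK _ _ hv.reflect R hR t₀ x₀ hI hB hsup.reflect]
      with t ht
    exact sqrt_setAverage_le hC.le hR.1 (fun τ => tail_nonneg _ _ _ _) ht
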